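/- Let n ≥ 1 and 1 < p < ∞. For each k ∈ {1,…,n}, the symbol μ_{1k}(ξ,τ) := ξ_k·(1 + 4π²|ξ|² + iτ)^{−1/2} is an Lᵖ(ℝ^{n+1})-multiplier; that is, there exists M > 0 (depending only on n, p) such that ‖𝓕⁻¹(μ_{1k}·𝓕f)‖_{Lᵖ} ≤ M·‖f‖_{Lᵖ} for every Schwartz function f on ℝ^{n+1}. -/

import Mathlib

noncomputable section

open MeasureTheory Real Complex
open scoped ENNReal NNReal Real BigOperators

/-- Euclidean space `ℝⁿ`. -/
abbrev Rn (n : ℕ) : Type := EuclideanSpace ℝ (Fin n)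

/-- The space `ℝ^{n+1} = ℝⁿ × ℝ`, points written `(X, t)`. -/
abbrev Rn1 (n : ℕ) : Type := EuclideanSpace ℝ (Fin n) × ℝ

/-- Fourier transform on `ℝ^{n+1}`:
`𝓕f(ξ,τ) = ∫ e^{−2πi(X·ξ + tτ)} f(X,t) dX dt`. -/
def FT1 {n : ℕ} (f : Rn1 n → ℂ) (q : Rn1 n) : ℂ :=
  ∫ p : Rn1 n,
    Complex.exp (-(2 * (π : ℂ) * Complex.I) *
      (((∑ k, p.1 k * q.1 k) + p.2 * q.2 : ℝ) : ℂ)) * f p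

/-- Inverse Fourier transform on `ℝ^{n+1}`. -/
def IFT1 {n : ℕ} (f : Rn1 n → ℂ) (x : Rn1 n) : ℂ :=
  ∫ q : Rn1 n,
    Complex.exp ((2 * (π : ℂ) * Complex.I) *
      (((∑ k, q.1 k * x.1 k) + q.2 * x.2 : ℝ) : ℂ)) * f q

/-- The Fourier multiplier operator `f ↦ 𝓕⁻¹(m · 𝓕 f)` on `ℝ^{n+1}`. -/
def MOp {n : ℕ} (m : Rn1 n → ℂ) (f : Rn1 n → ℂ) : Rn1 n → ℂ :=
  IFT1 (fun q => m q * FT1 f q)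

/-- The symbol `m_α(ξ,τ) = (1 + 4π²|ξ|² + iτ)^{α/2}` (principal branch). -/
def mSym {n : ℕ} (α : ℝ) (q : Rn1 n) : ℂ :=
  (1 + 4 * (π : ℂ) ^ 2 * (‖q.1‖ : ℂ) ^ 2 + Complex.I * (q.2 : ℂ)) ^ ((α : ℂ) / 2)

/-- Partial derivative `∂_{X_k}`. -/
def dX {n : ℕ} (k : Fin n) (f : Rn1 n → ℂ) : Rn1 n → ℂ :=
  fun x => fderiv ℝ f x (EuclideanSpace.single k 1, 0)

/-- Partial derivative `∂_t`. -/
def dT {n : ℕ} (f : Rn1 n → ℂ) : Rn1 n → ℂ :=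
  fun x => fderiv ℝ f x (0, 1)

/-- Iterated spatial derivative `D_X^β` for a multi-index `β`. -/
def dXmulti {n : ℕ} (β : Fin n → ℕ) (f : Rn1 n → ℂ) : Rn1 n → ℂ :=
  (List.finRange n).foldr (fun k g => (dX k)^[β k] g) f

/-- The half time-derivative `D_t^{1/2} f = 𝓕⁻¹(|τ|^{1/2}·𝓕f)`. -/
def halfDt {n : ℕ} (f : Rn1 n → ℂ) : Rn1 n → ℂ :=
  MOp (fun q => ((|q.2| ^ ((1 : ℝ) / 2) : ℝ) : ℂ)) f

/-- The `Lᵖ(ℝ^{n+1})` norm (as a value in `ℝ≥0∞`), `p` a real exponent. -/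
def pNorm {n : ℕ} (p : ℝ) (f : Rn1 n → ℂ) : ℝ≥0∞ :=
  eLpNorm f (ENNReal.ofReal p) volume

/-- Multi-indices `β ∈ ℕⁿ` with `|β| = N`. -/
def multiIdx (n N : ℕ) : Finset (Fin n → ℕ) :=
  (Fintype.piFinset fun _ : Fin n => Finset.range (N + 1)).filter fun β => (∑ k, β k) = N

/-- Convolution on `ℝ^{n+1}`. -/
def conv1 {n : ℕ} (g f : Rn1 n → ℂ) : Rn1 n → ℂ :=
  fun x => ∫ y : Rn1 n, g (x - y) * f y

/-- A parabolic Littlewood–Paley family on `ℝ^{n+1}`. -/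
structure ParabolicLP (n : ℕ) where
  φ : SchwartzMap (Rn1 n) ℂ
  ψ : SchwartzMap (Rn1 n) ℂ
  ft_pos : ∀ q : Rn1 n,
    1 / 2 < ‖q.1‖ + |q.2| ^ ((1 : ℝ) / 2) → ‖q.1‖ + |q.2| ^ ((1 : ℝ) / 2) < 2 →
      0 < (FT1 (⇑φ) q).re ∧ (FT1 (⇑φ) q).im = 0
  ft_supp : ∀ q : Rn1 n,
    ¬(1 / 2 < ‖q.1‖ + |q.2| ^ ((1 : ℝ) / 2) ∧ ‖q.1‖ + |q.2| ^ ((1 : ℝ) / 2) < 2) →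
      FT1 (⇑φ) q = 0
  ft_sum : ∀ q : Rn1 n, q ≠ 0 →
    ∑' i : ℤ, FT1 (⇑φ) (((2 : ℝ) ^ (-i)) • q.1, ((2 : ℝ) ^ (-(2 * i))) * q.2) = 1
  ft_psi : ∀ q : Rn1 n,
    FT1 (⇑ψ) q =
      1 - ∑' i : ℕ,
        FT1 (⇑φ) (((2 : ℝ) ^ (-((i : ℤ) + 1))) • q.1, ((2 : ℝ) ^ (-(2 * ((i : ℤ) + 1)))) * q.2)

/-- The dilate `φ_i`, whose Fourier transform is `𝓕φ(2^{−i}ξ, 2^{−2i}τ)`. -/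
def lpPhi {n : ℕ} (P : ParabolicLP n) (i : ℕ) : Rn1 n → ℂ :=
  fun x => (((2 : ℝ) ^ (i * (n + 2)) : ℝ) : ℂ) *
    P.φ (((2 : ℝ) ^ i) • x.1, ((2 : ℝ) ^ (2 * i)) * x.2)

/-- Parabolic Besov norm `N_{s,p}(f)` on `ℝ^{n+1}`, `1 ≤ p < ∞`. -/
def pBesov {n : ℕ} (P : ParabolicLP n) (s p : ℝ) (f : Rn1 n → ℂ) : ℝ≥0∞ :=
  eLpNorm (conv1 (⇑P.ψ) f) (ENNReal.ofReal p) volume +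
  (∑' i : ℕ,
    (ENNReal.ofReal ((2 : ℝ) ^ (s * ((i : ℝ) + 1))) *
      eLpNorm (conv1 (lpPhi P (i + 1)) f) (ENNReal.ofReal p) volume) ^ p) ^ (1 / p)

/-- Parabolic Besov norm `N_{s,∞}(f)` on `ℝ^{n+1}`. -/
def pBesovInf {n : ℕ} (P : ParabolicLP n) (s : ℝ) (f : Rn1 n → ℂ) : ℝ≥0∞ :=
  max (eLpNorm (conv1 (⇑P.ψ) f) ⊤ volume)
    (⨆ i : ℕ, ENNReal.ofReal ((2 : ℝ) ^ (s * ((i : ℝ) + 1))) *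
      eLpNorm (conv1 (lpPhi P (i + 1)) f) ⊤ volume)

/-- The time interval `(0, T)` for `0 < T ≤ ∞`. -/
def tSet (T : ℝ≥0∞) : Set ℝ := {t : ℝ | 0 < t ∧ ENNReal.ofReal t < T}

/-- Lebesgue measure restricted to the strip `ℝⁿ × (0,T)`. -/
def stripMeasure (n : ℕ) (T : ℝ≥0∞) : Measure (Rn1 n) :=
  volume.restrict {x : Rn1 n | x.2 ∈ tSet T}

/-- The parabolic Sobolev norm `‖g‖_{W^{2i,i}_p(ℝⁿ_T)}`. -/
def wNorm {n : ℕ} (i : ℕ) (p : ℝ) (T : ℝ≥0∞) (g : Rn1 n → ℂ) : ℝ≥0∞ :=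
  ∑ l ∈ Finset.range (i + 1),
    ∑ β ∈ (Fintype.piFinset fun _ : Fin n => Finset.range (2 * i + 1)).filter
        (fun β => (∑ k, β k) + 2 * l ≤ 2 * i),
      eLpNorm (dXmulti β (dT^[l] g)) (ENNReal.ofReal p) (stripMeasure n T)

/-- Time-regularity seminorm `[g]_{t,β,p,T}`. -/
def semT {n : ℕ} (b p : ℝ) (T : ℝ≥0∞) (g : Rn1 n → ℂ) : ℝ≥0∞ :=
  (∫⁻ X : Rn n, ∫⁻ t in tSet T, ∫⁻ s in tSet T,
      ENNReal.ofReal (‖g (X, t) - g (X, s)‖ ^ p / |t - s| ^ (1 + p * b / 2))) ^ (1 / p)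

/-- Space-regularity seminorm `[g]_{x,β,p,T}`. -/
def semX {n : ℕ} (b p : ℝ) (T : ℝ≥0∞) (g : Rn1 n → ℂ) : ℝ≥0∞ :=
  (∫⁻ t in tSet T, ∫⁻ X : Rn n, ∫⁻ Y : Rn n,
      ENNReal.ofReal (‖g (X + Y, t) - 2 * g (X, t) + g (X - Y, t)‖ ^ p /
        ‖Y‖ ^ ((n : ℝ) + p * b))) ^ (1 / p)

/-- The parabolic Besov norm `‖g‖_{B^{α,α/2}_p(ℝⁿ_T)}`, formed with index `i` where
`2i < α < 2i+2`. -/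
def pbNorm {n : ℕ} (i : ℕ) (α p : ℝ) (T : ℝ≥0∞) (g : Rn1 n → ℂ) : ℝ≥0∞ :=
  wNorm i p T g +
  ∑ l ∈ Finset.range (i + 1),
    ∑ β ∈ (Fintype.piFinset fun _ : Fin n => Finset.range (2 * i + 1)).filter
        (fun β => (∑ k, β k) + 2 * l = 2 * i),
      (semT (α - 2 * i) p T (dXmulti β (dT^[l] g)) +
        semX (α - 2 * i) p T (dXmulti β (dT^[l] g)))

/-- Fourier transform on `ℝⁿ`. -/
def FTn {n : ℕ} (f : Rn n → ℂ) (ξ : Rn n) : ℂ :=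
  ∫ x : Rn n, Complex.exp (-(2 * (π : ℂ) * Complex.I) * (((∑ k, x k * ξ k : ℝ)) : ℂ)) * f x

/-- Inverse Fourier transform on `ℝⁿ`. -/
def IFTn {n : ℕ} (f : Rn n → ℂ) (x : Rn n) : ℂ :=
  ∫ ξ : Rn n, Complex.exp ((2 * (π : ℂ) * Complex.I) * (((∑ k, ξ k * x k : ℝ)) : ℂ)) * f ξ

/-- Convolution on `ℝⁿ`. -/
def convn {n : ℕ} (g f : Rn n → ℂ) : Rn n → ℂ := fun x => ∫ y : Rn n, g (x - y) * f y

/-- A Littlewood–Paley family on `ℝⁿ`. -/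
structure LPFamily (n : ℕ) where
  φ : SchwartzMap (Rn n) ℂ
  ψ : SchwartzMap (Rn n) ℂ
  ft_pos : ∀ ξ : Rn n, 1 / 2 < ‖ξ‖ → ‖ξ‖ < 2 →
    0 < (FTn (⇑φ) ξ).re ∧ (FTn (⇑φ) ξ).im = 0
  ft_supp : ∀ ξ : Rn n, ¬(1 / 2 < ‖ξ‖ ∧ ‖ξ‖ < 2) → FTn (⇑φ) ξ = 0
  ft_sum : ∀ ξ : Rn n, ξ ≠ 0 → ∑' i : ℤ, FTn (⇑φ) (((2 : ℝ) ^ (-i)) • ξ) = 1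
  ft_psi : ∀ ξ : Rn n,
    FTn (⇑ψ) ξ = 1 - ∑' i : ℕ, FTn (⇑φ) (((2 : ℝ) ^ (-((i : ℤ) + 1))) • ξ)

/-- The dilate `φ′_i(x) = 2^{in} φ′(2^i x)`. -/
def lpPhin {n : ℕ} (P : LPFamily n) (i : ℕ) : Rn n → ℂ :=
  fun x => (((2 : ℝ) ^ (i * n) : ℝ) : ℂ) * P.φ (((2 : ℝ) ^ i) • x)

/-- Besov norm `B_{s,p}(f)` on `ℝⁿ`, `1 ≤ p < ∞`. -/
def besovN {n : ℕ} (P : LPFamily n) (s p : ℝ) (f : Rn n → ℂ) : ℝ≥0∞ :=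
  eLpNorm (convn (⇑P.ψ) f) (ENNReal.ofReal p) volume +
  (∑' i : ℕ,
    (ENNReal.ofReal ((2 : ℝ) ^ (s * ((i : ℝ) + 1))) *
      eLpNorm (convn (lpPhin P (i + 1)) f) (ENNReal.ofReal p) volume) ^ p) ^ (1 / p)

/-- The heat kernel `Γ(X,t)` on `ℝⁿ` (zero for `t ≤ 0`). -/
def heatKer (n : ℕ) (X : Rn n) (t : ℝ) : ℝ :=
  if 0 < t then (4 * π * t) ^ (-(n : ℝ) / 2) * Real.exp (-‖X‖ ^ 2 / (4 * t)) else 0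

/-- The heat extension `u(X,t) = ∫ Γ(X−Y,t) f(Y) dY`. -/
def heatExt {n : ℕ} (f : Rn n → ℂ) : Rn1 n → ℂ :=
  fun x => ∫ Y : Rn n, (heatKer n (x.1 - Y) x.2 : ℂ) * f Y

section CalderonZygmund

open Filter Topology Set

/-- A filtration of a measure space by countable partitions into cubes of comparable measure,
each cube coming with an enlargement. -/
structure DyadicSystem (E : Type*) [TopologicalSpace E] [MeasureSpace E] (D : ℝ≥0) where
  /-- The cube of generation `k` containing `x`. -/
  Q : ℤ → E → Set E
  /-- The enlargement of the cube of generation `k` containing `x`. -/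
  star : ℤ → E → Set E
  mem_self : ∀ k x, x ∈ Q k x
  eq_of_mem : ∀ k x y, y ∈ Q k x → Q k y = Q k x
  succ_subset : ∀ k x, Q (k + 1) x ⊆ Q k x
  countable_range : ∀ k, (Set.range (Q k)).Countable
  measurableSet : ∀ k x, MeasurableSet (Q k x)
  measure_ne_zero : ∀ k x, volume (Q k x) ≠ 0
  measure_ne_top : ∀ k x, volume (Q k x) ≠ ∞
  measure_le_succ : ∀ k x, volume (Q k x) ≤ D * volume (Q (k + 1) x)
  tendsto_measure : ∀ x, Tendsto (fun k : ℕ => volume (Q (-(k : ℤ)) x)) atTop (𝓝 ∞)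
  eventually_subset : ∀ x, ∀ U ∈ 𝓝 x, ∀ᶠ k : ℕ in atTop, Q (k : ℤ) x ⊆ U
  measurableSet_star : ∀ k x, MeasurableSet (star k x)
  measure_star_le : ∀ k x, volume (star k x) ≤ D * volume (Q k x)

namespace DyadicSystem

variable {E : Type*} [TopologicalSpace E] [MeasureSpace E] {D : ℝ≥0}

/-- The maximal cubes on which the average of `F` exceeds `l`. -/
def stopping (S : DyadicSystem E D) (F : E → ℝ≥0∞) (l : ℝ≥0∞) : Set (Set E) :=
  {A | ∃ k x, A = S.Q k x ∧ l * volume (S.Q k x) < ∫⁻ y in S.Q k x, F y ∧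
    ∀ j < k, ∫⁻ y in S.Q j x, F y ≤ l * volume (S.Q j x)}

variable (S : DyadicSystem E D)

lemma antitone (x : E) : Antitone fun k => S.Q k x :=
  antitone_int_of_succ_le fun k => S.succ_subset k x

lemma eq_of_mem_of_le {j k : ℤ} {x y : E} (h : y ∈ S.Q k x) (hj : j ≤ k) : S.Q j y = S.Q j x :=
  S.eq_of_mem _ _ _ (S.antitone x hj h)

lemma stopping_countable (F : E → ℝ≥0∞) (l : ℝ≥0∞) : (S.stopping F l).Countable := by
  refine (Set.countable_iUnion S.countable_range).mono ?_
  rintro A ⟨k, x, rfl, -⟩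
  exact Set.mem_iUnion.2 ⟨k, x, rfl⟩

lemma stopping_pairwiseDisjoint (F : E → ℝ≥0∞) (l : ℝ≥0∞) :
    (S.stopping F l).PairwiseDisjoint id := by
  rintro A ⟨k, x, rfl, hk, hk'⟩ B ⟨m, y, rfl, hm, hm'⟩ hne
  rw [Function.onFun, Set.disjoint_left]
  rintro z hzx hzy
  simp only [id] at hzx hzy
  apply hne
  rcases lt_trichotomy k m with h | h | h
  · have := hm' k h
    rw [← S.eq_of_mem_of_le hzy h.le, S.eq_of_mem _ _ _ hzx] at this
    exact absurd this hk.not_ge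
  · subst h
    rw [← S.eq_of_mem _ _ _ hzx, S.eq_of_mem _ _ _ hzy]
  · have := hk' m h
    rw [← S.eq_of_mem_of_le hzx h.le, S.eq_of_mem _ _ _ hzy] at this
    exact absurd this hm.not_ge

lemma lintegral_le_of_mem_stopping {F : E → ℝ≥0∞} {l : ℝ≥0∞} {A : Set E}
    (hA : A ∈ S.stopping F l) : ∫⁻ y in A, F y ≤ D * l * volume A := by
  obtain ⟨k, x, rfl, -, hk⟩ := hA
  have h := hk (k - 1) (by omega)
  have h1 := S.succ_subset (k - 1) x
  have h2 := S.measure_le_succ (k - 1) x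
  rw [sub_add_cancel] at h1 h2
  calc ∫⁻ y in S.Q k x, F y ≤ ∫⁻ y in S.Q (k - 1) x, F y := lintegral_mono_set h1
    _ ≤ l * volume (S.Q (k - 1) x) := h
    _ ≤ l * (D * volume (S.Q k x)) := by gcongr
    _ = D * l * volume (S.Q k x) := by ring

lemma lintegral_le_of_notMem_stopping {F : E → ℝ≥0∞} (hF : ∫⁻ y, F y ≠ ∞) {l : ℝ≥0∞}
    (hl : l ≠ 0) {x : E} (hx : ∀ A ∈ S.stopping F l, x ∉ A) (k : ℤ) :
    ∫⁻ y in S.Q k x, F y ≤ l * volume (S.Q k x) := by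
  by_contra! hk
  obtain ⟨N, hN⟩ : ∃ N : ℤ, ∀ j ≤ N, ∫⁻ y in S.Q j x, F y ≤ l * volume (S.Q j x) := by
    have h1 : Tendsto (fun k : ℕ => l * volume (S.Q (-(k : ℤ)) x)) atTop (𝓝 ∞) := by
      have := ENNReal.Tendsto.const_mul (a := l) (S.tendsto_measure x) (Or.inl ENNReal.top_ne_zero)
      rwa [ENNReal.mul_top hl] at this
    obtain ⟨m, hm⟩ := (h1.eventually (lt_mem_nhds hF.lt_top)).exists
    refine ⟨-m, fun j hj => ?_⟩
    calc ∫⁻ y in S.Q j x, F y ≤ ∫⁻ y, F y := setLIntegral_le_lintegral _ _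
      _ ≤ l * volume (S.Q (-(m : ℤ)) x) := hm.le
      _ ≤ l * volume (S.Q j x) := by gcongr; exact S.antitone x hj
  obtain ⟨m, hm, hmin⟩ := Int.exists_least_of_bdd
    (P := fun j => l * volume (S.Q j x) < ∫⁻ y in S.Q j x, F y)
    ⟨N, fun z hz => by by_contra! h; exact absurd (hN z h.le) hz.not_ge⟩ ⟨k, hk⟩
  refine hx (S.Q m x) ⟨m, x, rfl, hm, fun j hj => ?_⟩ (S.mem_self m x)
  by_contra! h
  exact absurd (hmin j h) (by omega)

lemma le_of_notMem_stopping {F : E → ℝ≥0∞} (hF : ∫⁻ y, F y ≠ ∞) (hc : Continuous F) {l : ℝ≥0∞}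
    (hl : l ≠ 0) {x : E} (hx : ∀ A ∈ S.stopping F l, x ∉ A) : F x ≤ l := by
  refine le_of_forall_lt_imp_le_of_dense fun c hc' => ?_
  obtain ⟨k, hk⟩ := (S.eventually_subset x {y | c < F y}
    ((isOpen_lt continuous_const hc).mem_nhds hc')).exists
  have h1 : c * volume (S.Q k x) ≤ ∫⁻ y in S.Q k x, F y := by
    rw [← setLIntegral_const]
    exact setLIntegral_mono' (S.measurableSet _ _) fun y hy => (hk hy).le
  exact (ENNReal.mul_le_mul_iff_left (S.measure_ne_zero k x) (S.measure_ne_top k x)).1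
    (h1.trans (S.lintegral_le_of_notMem_stopping hF hl hx k))

end DyadicSystem

namespace DyadicSystem

variable {E : Type*} [TopologicalSpace E] [MeasureSpace E] {D : ℝ≥0} (S : DyadicSystem E D)

lemma measurableSet_of_mem_stopping {F : E → ℝ≥0∞} {l : ℝ≥0∞} {A : Set E}
    (hA : A ∈ S.stopping F l) : MeasurableSet A := by
  obtain ⟨k, x, rfl, -⟩ := hA
  exact S.measurableSet k x

lemma measure_ne_zero_of_mem_stopping {F : E → ℝ≥0∞} {l : ℝ≥0∞} {A : Set E}
    (hA : A ∈ S.stopping F l) : volume A ≠ 0 := by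
  obtain ⟨k, x, rfl, -⟩ := hA
  exact S.measure_ne_zero k x

lemma measure_ne_top_of_mem_stopping {F : E → ℝ≥0∞} {l : ℝ≥0∞} {A : Set E}
    (hA : A ∈ S.stopping F l) : volume A ≠ ∞ := by
  obtain ⟨k, x, rfl, -⟩ := hA
  exact S.measure_ne_top k x

lemma mul_measure_le_of_mem_stopping {F : E → ℝ≥0∞} {l : ℝ≥0∞} {A : Set E}
    (hA : A ∈ S.stopping F l) : l * volume A ≤ ∫⁻ y in A, F y := by
  obtain ⟨k, x, rfl, h, -⟩ := hA
  exact h.le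

/-- The union of the stopping cubes. -/
def bad (F : E → ℝ≥0∞) (l : ℝ≥0∞) : Set E := ⋃ A : S.stopping F l, (A : Set E)

lemma mem_bad {F : E → ℝ≥0∞} {l : ℝ≥0∞} {A : Set E} (hA : A ∈ S.stopping F l) {x : E}
    (hx : x ∈ A) : x ∈ S.bad F l := Set.mem_iUnion.2 ⟨⟨A, hA⟩, hx⟩

lemma measurableSet_bad (F : E → ℝ≥0∞) (l : ℝ≥0∞) : MeasurableSet (S.bad F l) := by
  have := (S.stopping_countable F l).to_subtype
  exact MeasurableSet.iUnion fun A => S.measurableSet_of_mem_stopping A.2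

lemma lintegral_bad (F : E → ℝ≥0∞) (l : ℝ≥0∞) (G : E → ℝ≥0∞) :
    ∫⁻ x in S.bad F l, G x = ∑' A : S.stopping F l, ∫⁻ x in (A : Set E), G x := by
  have := (S.stopping_countable F l).to_subtype
  exact lintegral_iUnion (s := fun A : S.stopping F l => (A : Set E))
    (fun A => S.measurableSet_of_mem_stopping A.2)
    (fun A B h => S.stopping_pairwiseDisjoint F l A.2 B.2 (Subtype.coe_injective.ne h)) _

lemma measure_bad (F : E → ℝ≥0∞) (l : ℝ≥0∞) :
    volume (S.bad F l) = ∑' A : S.stopping F l, volume (A : Set E) := by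
  simpa using S.lintegral_bad F l 1

lemma measure_bad_le {F : E → ℝ≥0∞} (hF : Measurable F) {l : ℝ≥0∞} (hl : l ≠ 0) (hl' : l ≠ ∞) :
    volume (S.bad F l) ≤ 2 * l⁻¹ * ∫⁻ x in {x | l / 2 < F x}, F x := by
  have hm : MeasurableSet {x | l / 2 < F x} := measurableSet_lt measurable_const hF
  have key : ∀ A ∈ S.stopping F l,
      volume A ≤ 2 * l⁻¹ * ∫⁻ x in A, {x | l / 2 < F x}.indicator F x := by
    intro A hA
    have h1 := S.mul_measure_le_of_mem_stopping hA
    have h2 : ∫⁻ y in A, F y ≤ (∫⁻ x in A, {x | l / 2 < F x}.indicator F x) + l / 2 * volume A := by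
      rw [← setLIntegral_const, ← lintegral_add_left (hF.indicator hm)]
      refine lintegral_mono fun y => ?_
      by_cases hy : l / 2 < F y
      · simp [Set.indicator, hy]
      · simp only [Set.indicator, Set.mem_ofPred_eq, hy, if_false, zero_add]
        exact not_lt.1 hy
    have h3 : l / 2 * volume A ≤ ∫⁻ x in A, {x | l / 2 < F x}.indicator F x := by
      have h4 : l * volume A = l / 2 * volume A + l / 2 * volume A := by
        rw [← add_mul, ENNReal.add_halves]
      rw [h4] at h1
      refine (ENNReal.add_le_add_iff_right (a := l / 2 * volume A) ?_).1 (h1.trans h2)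
      exact ENNReal.mul_ne_top (ENNReal.div_ne_top hl' (by simp))
        (S.measure_ne_top_of_mem_stopping hA)
    calc volume A = 2 * l⁻¹ * (l / 2 * volume A) := by
          rw [div_eq_mul_inv, show 2 * l⁻¹ * (l * 2⁻¹ * volume A)
            = (2 * 2⁻¹) * (l⁻¹ * l) * volume A by ring, ENNReal.inv_mul_cancel hl hl',
            ENNReal.mul_inv_cancel (by simp) (by simp)]
          simp
      _ ≤ _ := by gcongr
  rw [measure_bad]
  calc ∑' A : S.stopping F l, volume (A : Set E)
      ≤ ∑' A : S.stopping F l, 2 * l⁻¹ * ∫⁻ x in (A : Set E), {x | l / 2 < F x}.indicator F x :=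
        ENNReal.tsum_le_tsum fun A => key A A.2
    _ = 2 * l⁻¹ * ∫⁻ x in S.bad F l, {x | l / 2 < F x}.indicator F x := by
        rw [ENNReal.tsum_mul_left, lintegral_bad]
    _ ≤ 2 * l⁻¹ * ∫⁻ x in {x | l / 2 < F x}, F x := by
        refine mul_le_mul_right ?_ _
        rw [← lintegral_indicator hm]
        exact setLIntegral_le_lintegral _ _

open Classical in
/-- The good part of `f`: its average on every stopping cube, and `f` elsewhere. -/
def good (f : E → ℂ) (l : ℝ≥0∞) (x : E) : ℂ :=
  if h : ∃ A ∈ S.stopping (fun x => ‖f x‖ₑ) l, x ∈ A then ⨍ y in h.choose, f y else f x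

variable {S} {f : E → ℂ} {l : ℝ≥0∞}

lemma good_of_mem {A : Set E} (hA : A ∈ S.stopping (fun x => ‖f x‖ₑ) l) {x : E} (hx : x ∈ A) :
    S.good f l x = ⨍ y in A, f y := by
  have h : ∃ A ∈ S.stopping (fun x => ‖f x‖ₑ) l, x ∈ A := ⟨A, hA, hx⟩
  have : h.choose = A := (S.stopping_pairwiseDisjoint _ l).elim h.choose_spec.1 hA
    (Set.not_disjoint_iff.2 ⟨x, h.choose_spec.2, hx⟩)
  rw [good, dif_pos h, this]

lemma good_of_notMem {x : E} (hx : x ∉ S.bad (fun x => ‖f x‖ₑ) l) : S.good f l x = f x := by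
  rw [good, dif_neg]
  rintro ⟨A, hA, hxA⟩
  exact hx (S.mem_bad hA hxA)

lemma aestronglyMeasurable_good (hf : AEStronglyMeasurable f) :
    AEStronglyMeasurable (S.good f l) := by
  have := (S.stopping_countable (fun x => ‖f x‖ₑ) l).to_subtype
  have hb := S.measurableSet_bad (fun x => ‖f x‖ₑ) l
  rw [← Measure.restrict_univ (μ := volume), ← Set.union_compl_self (S.bad (fun x => ‖f x‖ₑ) l),
    aestronglyMeasurable_union_iff]
  constructor
  · rw [bad, aestronglyMeasurable_iUnion_iff]
    intro A
    refine (aestronglyMeasurable_const (b := ⨍ y in (A : Set E), f y)).congr ?_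
    filter_upwards [ae_restrict_mem (S.measurableSet_of_mem_stopping A.2)] with x hx
    exact (good_of_mem A.2 hx).symm
  · refine hf.restrict.congr ?_
    filter_upwards [ae_restrict_mem hb.compl] with x hx
    exact (good_of_notMem hx).symm

lemma enorm_good_le_of_mem {A : Set E} (hA : A ∈ S.stopping (fun x => ‖f x‖ₑ) l) {x : E}
    (hx : x ∈ A) : ‖S.good f l x‖ₑ ≤ D * l := by
  rw [good_of_mem hA hx, setAverage_eq, enorm_smul, Measure.real]
  have h0 := S.measure_ne_zero_of_mem_stopping hA
  have h1 := S.measure_ne_top_of_mem_stopping hA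
  have h2 : ‖((volume A).toReal)⁻¹‖ₑ = (volume A)⁻¹ := by
    rw [Real.enorm_of_nonneg (by positivity), ENNReal.ofReal_inv_of_pos
      (ENNReal.toReal_pos h0 h1), ENNReal.ofReal_toReal h1]
  rw [h2]
  calc (volume A)⁻¹ * ‖∫ y in A, f y‖ₑ ≤ (volume A)⁻¹ * (D * l * volume A) := by
        gcongr
        exact (enorm_integral_le_lintegral_enorm _).trans (S.lintegral_le_of_mem_stopping hA)
    _ = D * l * ((volume A)⁻¹ * volume A) := by ring
    _ = D * l := by rw [ENNReal.inv_mul_cancel h0 h1, mul_one]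

lemma enorm_good_le_of_notMem (hf : Continuous f) (hi : Integrable f) (hl : l ≠ 0)
    {x : E} (hx : x ∉ S.bad (fun x => ‖f x‖ₑ) l) : ‖f x‖ₑ ≤ l :=
  S.le_of_notMem_stopping (F := fun x => ‖f x‖ₑ) hi.2.ne hf.enorm hl
    fun _ hA hxA => hx (S.mem_bad hA hxA)

lemma enorm_good_le (hf : Continuous f) (hi : Integrable f) (hl : l ≠ 0) (x : E) :
    ‖S.good f l x‖ₑ ≤ (D + 1) * l := by
  by_cases hx : x ∈ S.bad (fun x => ‖f x‖ₑ) l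
  · obtain ⟨A, hxA⟩ := Set.mem_iUnion.1 hx
    refine (enorm_good_le_of_mem A.2 hxA).trans ?_
    gcongr
    exact le_self_add
  · rw [good_of_notMem hx]
    refine (enorm_good_le_of_notMem hf hi hl hx).trans ?_
    conv_lhs => rw [← one_mul l]
    gcongr
    exact le_add_self

lemma lintegral_good_sq_le (hf : Continuous f) (hi : Integrable f) [OpensMeasurableSpace E]
    (hl : l ≠ 0) :
    ∫⁻ x, ‖S.good f l x‖ₑ ^ 2 ≤ (∫⁻ x in {x | ‖f x‖ₑ ≤ l}, ‖f x‖ₑ ^ 2) +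
      (D * l) ^ 2 * volume (S.bad (fun x => ‖f x‖ₑ) l) := by
  have hb := S.measurableSet_bad (fun x => ‖f x‖ₑ) l
  rw [← lintegral_add_compl _ hb, add_comm]
  refine add_le_add ?_ ?_
  · rw [setLIntegral_congr_fun (g := fun x => ‖f x‖ₑ ^ 2) hb.compl
      fun x hx => by simp only [good_of_notMem hx]]
    exact lintegral_mono_set fun x hx => enorm_good_le_of_notMem hf hi hl hx
  · rw [← setLIntegral_const]
    refine setLIntegral_mono' hb fun x hx => ?_
    obtain ⟨A, hxA⟩ := Set.mem_iUnion.1 hx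
    have := enorm_good_le_of_mem A.2 hxA
    gcongr

lemma setIntegral_sub_good {A : Set E}
    (hA : A ∈ S.stopping (fun x => ‖f x‖ₑ) l) : ∫ y in A, (f y - S.good f l y) = 0 := by
  have h0 := S.measure_ne_zero_of_mem_stopping hA
  have h1 := S.measure_ne_top_of_mem_stopping hA
  rw [setIntegral_congr_fun (g := fun y => f y - ⨍ y in A, f y)
    (S.measurableSet_of_mem_stopping hA) fun y hy => by simp only [good_of_mem hA hy]]
  have : IsFiniteMeasure (volume.restrict A) := ⟨by simpa using h1.lt_top⟩
  exact integral_sub_average _ _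

lemma setLIntegral_sub_good_le {A : Set E}
    (hA : A ∈ S.stopping (fun x => ‖f x‖ₑ) l) :
    ∫⁻ y in A, ‖f y - S.good f l y‖ₑ ≤ 2 * D * l * volume A := by
  calc ∫⁻ y in A, ‖f y - S.good f l y‖ₑ ≤ ∫⁻ y in A, (‖f y‖ₑ + D * l) := by
        refine setLIntegral_mono' (S.measurableSet_of_mem_stopping hA) fun y hy => ?_
        exact (enorm_sub_le (E := ℂ)).trans (by gcongr; exact enorm_good_le_of_mem hA hy)
    _ = (∫⁻ y in A, ‖f y‖ₑ) + D * l * volume A := by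
        rw [lintegral_add_right _ measurable_const, setLIntegral_const]
    _ ≤ D * l * volume A + D * l * volume A := by
        gcongr
        exact S.lintegral_le_of_mem_stopping hA
    _ = _ := by ring

end DyadicSystem

lemma meas_lt_le_of_lintegral_le {E : Type*} [MeasureSpace E] {G : E → ℝ≥0∞} {s : Set E} {l c : ℝ≥0∞}
    (h : ∫⁻ x in sᶜ, G x ≤ c) (hG : AEMeasurable G) (hs : MeasurableSet s)
    (hl : l ≠ 0) (hl' : l ≠ ∞) :
    volume {x | l < G x} ≤ volume s + l⁻¹ * c := by
  calc volume {x | l < G x} ≤ volume (s ∪ ({x | l < G x} ∩ sᶜ)) := by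
        refine measure_mono fun x hx => ?_
        by_cases h : x ∈ s
        · exact Or.inl h
        · exact Or.inr ⟨hx, h⟩
    _ ≤ volume s + volume ({x | l < G x} ∩ sᶜ) := measure_union_le _ _
    _ ≤ _ := by
        gcongr
        rw [← Measure.restrict_apply' hs.compl, mul_comm, ← div_eq_mul_inv]
        refine (measure_mono fun x (hx : l < G x) => hx.le).trans
          ((meas_ge_le_lintegral_div hG.restrict hl hl').trans ?_)
        gcongr

section Kernel

set_option linter.unusedSectionVars false

variable {E : Type*} [NormedAddCommGroup E] [MeasureSpace E] [BorelSpace E]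
  [SecondCountableTopology E] [(volume : Measure E).IsAddHaarMeasure]
  [(volume : Measure E).IsNegInvariant] [SigmaFinite (volume : Measure E)]

/-- Convolution with the kernel `K`. -/
def cv (K f : E → ℂ) (x : E) : ℂ := ∫ y, K (x - y) * f y

/-- Integrable convolution kernels which are contractive on `L²` and satisfy the Hörmander
condition with constant `B` relative to a dyadic system. -/
structure CZKernel {D : ℝ≥0} (S : DyadicSystem E D) (B : ℝ≥0) (K : E → ℂ) : Prop where
  measurable : Measurable K
  integrable : Integrable K
  hormander : ∀ k x, ∀ y ∈ S.Q k x, ∫⁻ z in (S.star k x)ᶜ, ‖K (z - y) - K (z - x)‖ₑ ≤ B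
  lintegral_cv_sq : ∀ g : E → ℂ, Integrable g → (∃ C, ∀ x, ‖g x‖ ≤ C) →
    ∫⁻ x, ‖cv K g x‖ₑ ^ 2 ≤ ∫⁻ x, ‖g x‖ₑ ^ 2

lemma integrable_cv_integrand {K g : E → ℂ} (hK : Integrable K) (hg : AEStronglyMeasurable g)
    {C : ℝ} (hC : ∀ x, ‖g x‖ ≤ C) (x : E) : Integrable fun y => K (x - y) * g y :=
  (hK.comp_sub_left x).mul_bdd hg (.of_forall hC)

lemma aestronglyMeasurable_cv {K g : E → ℂ} (hK : Measurable K) (hg : AEStronglyMeasurable g) :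
    AEStronglyMeasurable (cv K g) := by
  have h : AEStronglyMeasurable (fun p : E × E => K (p.1 - p.2) * g p.2) (volume.prod volume) :=
    (hK.comp (measurable_fst.sub measurable_snd)).aestronglyMeasurable.mul hg.comp_snd
  exact h.integral_prod_right'

variable {D : ℝ≥0} {S : DyadicSystem E D} {B : ℝ≥0} {K : E → ℂ}

lemma CZKernel.lintegral_cv_compl_le (hK : CZKernel S B K) {F : E → ℝ≥0∞} {l : ℝ≥0∞}
    {b : E → ℂ} (hb : AEStronglyMeasurable b) {C : ℝ} (hC : ∀ x, ‖b x‖ ≤ C)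
    (hoff : ∀ x, x ∉ S.bad F l → b x = 0)
    (hmean : ∀ A ∈ S.stopping F l, ∫ y in A, b y = 0) {c : ℝ≥0∞} (hc : c ≠ ∞)
    (hsize : ∀ A ∈ S.stopping F l, ∫⁻ y in A, ‖b y‖ₑ ≤ c * volume A) :
    ∃ s, MeasurableSet s ∧ volume s ≤ D * volume (S.bad F l) ∧
      ∫⁻ x in sᶜ, ‖cv K b x‖ₑ ≤ B * c * volume (S.bad F l) := by
  have hcount := (S.stopping_countable F l).to_subtype
  choose k c₀ hkc _ using fun A : S.stopping F l => A.2
  set s : Set E := ⋃ A, S.star (k A) (c₀ A) with hs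
  have hsm : MeasurableSet s := MeasurableSet.iUnion fun A => S.measurableSet_star _ _
  have hAm (A : S.stopping F l) : MeasurableSet (A : Set E) := S.measurableSet_of_mem_stopping A.2
  refine ⟨s, hsm, ?_, ?_⟩
  · rw [S.measure_bad, ← ENNReal.tsum_mul_left]
    refine (measure_iUnion_le _).trans (ENNReal.tsum_le_tsum fun A => ?_)
    conv_rhs => rw [hkc A]
    exact S.measure_star_le _ _
  have hbi (A : S.stopping F l) : IntegrableOn b A :=
    ⟨hb.restrict, (hsize A A.2).trans_lt
      (ENNReal.mul_lt_top hc.lt_top (S.measure_ne_top_of_mem_stopping A.2).lt_top)⟩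
  have hrep (x : E) : cv K b x = ∑' A : S.stopping F l,
      ∫ y in (A : Set E), (K (x - y) - K (x - c₀ A)) * b y := by
    have hI := integrable_cv_integrand hK.integrable hb hC x
    have h1 : cv K b x = ∫ y in S.bad F l, K (x - y) * b y := by
      rw [cv, setIntegral_eq_integral_of_forall_compl_eq_zero]
      intro y hy
      rw [hoff y hy, mul_zero]
    rw [h1, DyadicSystem.bad, integral_iUnion hAm
      (fun A A' h => S.stopping_pairwiseDisjoint F l A.2 A'.2 (Subtype.coe_injective.ne h))
      hI.integrableOn]
    refine tsum_congr fun A => ?_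
    simp_rw [sub_mul]
    rw [integral_sub hI.integrableOn ((hbi A).const_mul _), integral_const_mul, hmean A A.2,
      mul_zero, sub_zero]
  have hpt (x : E) : ‖cv K b x‖ₑ ≤ ∑' A : S.stopping F l,
      ∫⁻ y in (A : Set E), ‖K (x - y) - K (x - c₀ A)‖ₑ * ‖b y‖ₑ := by
    rw [hrep]
    refine (enorm_tsum_le_tsum_enorm).trans (ENNReal.tsum_le_tsum fun A => ?_)
    refine (enorm_integral_le_lintegral_enorm _).trans_eq ?_
    simp_rw [enorm_mul]
  have hjm (A : S.stopping F l) (μ : Measure E) [SFinite μ] (ν : Measure E) [SFinite ν]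
      (hν : ν ≪ volume) : AEMeasurable
      (fun p : E × E => ‖K (p.1 - p.2) - K (p.1 - c₀ A)‖ₑ * ‖b p.2‖ₑ) (μ.prod ν) := by
    refine AEMeasurable.mul (Measurable.aemeasurable ?_) (hb.mono_ac hν).enorm.comp_snd
    exact ((hK.measurable.comp (measurable_fst.sub measurable_snd)).sub
      (hK.measurable.comp (measurable_fst.sub_const _))).enorm
  calc ∫⁻ x in sᶜ, ‖cv K b x‖ₑ ≤ ∫⁻ x in sᶜ, ∑' A : S.stopping F l,
      ∫⁻ y in (A : Set E), ‖K (x - y) - K (x - c₀ A)‖ₑ * ‖b y‖ₑ := lintegral_mono fun x => hpt x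
    _ = ∑' A : S.stopping F l, ∫⁻ x in sᶜ,
      ∫⁻ y in (A : Set E), ‖K (x - y) - K (x - c₀ A)‖ₑ * ‖b y‖ₑ := by
        refine lintegral_tsum fun A => ?_
        exact (hjm A _ _ Measure.restrict_le_self.absolutelyContinuous).lintegral_prod_right'
    _ ≤ ∑' A : S.stopping F l, B * (c * volume (A : Set E)) := by
        refine ENNReal.tsum_le_tsum fun A => ?_
        rw [lintegral_lintegral_swap (hjm A _ _ Measure.restrict_le_self.absolutelyContinuous)]
        calc ∫⁻ y in (A : Set E), ∫⁻ x in sᶜ, ‖K (x - y) - K (x - c₀ A)‖ₑ * ‖b y‖ₑ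
            ≤ ∫⁻ y in (A : Set E), B * ‖b y‖ₑ := by
              refine setLIntegral_mono' (hAm A) fun y hy => ?_
              rw [lintegral_mul_const' _ _ enorm_ne_top]
              gcongr
              rw [hkc A] at hy
              refine (lintegral_mono_set ?_).trans (hK.hormander (k A) (c₀ A) y hy)
              exact Set.compl_subset_compl.2 (Set.subset_iUnion (fun A => S.star (k A) (c₀ A)) A)
          _ ≤ _ := by
              rw [lintegral_const_mul' _ _ ENNReal.coe_ne_top]
              gcongr
              exact hsize A A.2
    _ = B * c * volume (S.bad F l) := by
        rw [S.measure_bad, ENNReal.tsum_mul_left, ENNReal.tsum_mul_left, mul_assoc]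

lemma CZKernel.meas_lt_cv_le (hK : CZKernel S B K) {f : E → ℂ} (hf : Continuous f)
    (hi : Integrable f) {C : ℝ} (hC : ∀ x, ‖f x‖ ≤ C) {l : ℝ≥0∞} (hl : l ≠ 0) (hl' : l ≠ ∞) :
    volume {x | 2 * l < ‖cv K f x‖ₑ} ≤
      (l ^ 2)⁻¹ * (∫⁻ x in {x | ‖f x‖ₑ ≤ l}, ‖f x‖ₑ ^ 2) +
      2 * (D ^ 2 + D + 2 * B * D) * (l⁻¹ * ∫⁻ x in {x | l / 2 < ‖f x‖ₑ}, ‖f x‖ₑ) := by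
  set F : E → ℝ≥0∞ := fun x => ‖f x‖ₑ with hF
  set g := S.good f l with hg
  set Ω := S.bad F l with hΩ
  have hgm : AEStronglyMeasurable g := DyadicSystem.aestronglyMeasurable_good hf.aestronglyMeasurable
  have hgb (x : E) : ‖g x‖ ≤ ((D + 1) * l).toReal := by
    have h := DyadicSystem.enorm_good_le (S := S) hf hi hl x
    rw [← toReal_enorm]
    exact ENNReal.toReal_mono (ENNReal.mul_ne_top (by simp) hl') h
  have hbm : AEStronglyMeasurable (fun x => f x - g x) := hf.aestronglyMeasurable.sub hgm
  have hbb (x : E) : ‖f x - g x‖ ≤ C + ((D + 1) * l).toReal :=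
    (norm_sub_le _ _).trans (add_le_add (hC x) (hgb x))
  have hsplit (x : E) : cv K f x = cv K g x + cv K (fun x => f x - g x) x := by
    rw [cv, cv, cv, ← integral_add (integrable_cv_integrand hK.integrable hgm hgb x)
      (integrable_cv_integrand hK.integrable hbm hbb x)]
    congr 1
    ext y
    ring
  have hcD : 2 * D * l ≠ ∞ := ENNReal.mul_ne_top (by finiteness) hl'
  have hoff : ∀ x, x ∉ Ω → f x - g x = 0 := fun x hx => by
    rw [hg, DyadicSystem.good_of_notMem hx, sub_self]
  obtain ⟨s, hsm, hs1, hs2⟩ := hK.lintegral_cv_compl_le hbm hbb hoff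
    (fun A hA => DyadicSystem.setIntegral_sub_good hA) hcD
    (fun A hA => DyadicSystem.setLIntegral_sub_good_le hA)
  have hΩle : volume Ω ≤ 2 * l⁻¹ * ∫⁻ x in {x | l / 2 < F x}, F x :=
    S.measure_bad_le hf.measurable.enorm hl hl'
  have hΩfin : volume Ω ≠ ∞ := by
    refine (hΩle.trans_lt (ENNReal.mul_lt_top ?_ ?_)).ne
    · exact ENNReal.mul_lt_top (by simp) (by simpa using hl.bot_lt)
    · exact (setLIntegral_le_lintegral _ _).trans_lt hi.2
  have hbint : Integrable fun x => f x - g x := by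
    refine ⟨hbm, ?_⟩
    have h1 : ∫⁻ x, ‖f x - g x‖ₑ = ∫⁻ x in Ω, ‖f x - g x‖ₑ := by
      rw [← lintegral_indicator (S.measurableSet_bad _ _)]
      congr 1
      ext x
      by_cases hx : x ∈ Ω
      · rw [Set.indicator_of_mem hx]
      · rw [Set.indicator_of_notMem hx, hoff x hx, enorm_zero]
    rw [HasFiniteIntegral, h1, S.lintegral_bad]
    calc ∑' A : S.stopping F l, ∫⁻ x in (A : Set E), ‖f x - g x‖ₑ
        ≤ ∑' A : S.stopping F l, 2 * D * l * volume (A : Set E) :=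
          ENNReal.tsum_le_tsum fun A => DyadicSystem.setLIntegral_sub_good_le A.2
      _ = 2 * D * l * volume Ω := by rw [ENNReal.tsum_mul_left, S.measure_bad]
      _ < ∞ := ENNReal.mul_lt_top hcD.lt_top hΩfin.lt_top
  have hgint : Integrable g := by
    refine (hi.sub hbint).congr (.of_forall fun x => ?_)
    simp
  have hTg : volume {x | l < ‖cv K g x‖ₑ} ≤ (l ^ 2)⁻¹ *
      ((∫⁻ x in {x | ‖f x‖ₑ ≤ l}, ‖f x‖ₑ ^ 2) + (D * l) ^ 2 * volume Ω) := by
    have h1 : {x | l < ‖cv K g x‖ₑ} ⊆ {x | l ^ 2 ≤ ‖cv K g x‖ₑ ^ 2} := fun x hx => by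
      have : l ≤ ‖cv K g x‖ₑ := le_of_lt hx
      exact pow_le_pow_left' this 2
    refine (measure_mono h1).trans ((meas_ge_le_lintegral_div
      ((aestronglyMeasurable_cv hK.measurable hgm).enorm.pow_const 2)
      (pow_ne_zero 2 hl) (ENNReal.pow_ne_top hl')).trans ?_)
    rw [div_eq_mul_inv, mul_comm]
    gcongr
    exact (hK.lintegral_cv_sq g hgint ⟨_, hgb⟩).trans (DyadicSystem.lintegral_good_sq_le hf hi hl)
  have hTb := meas_lt_le_of_lintegral_le hs2 (aestronglyMeasurable_cv hK.measurable hbm).enorm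
    hsm hl hl'
  have hll : l⁻¹ * l = 1 := ENNReal.inv_mul_cancel hl hl'
  have hll2 : (l ^ 2)⁻¹ * l ^ 2 = 1 :=
    ENNReal.inv_mul_cancel (pow_ne_zero 2 hl) (ENNReal.pow_ne_top hl')
  calc volume {x | 2 * l < ‖cv K f x‖ₑ}
      ≤ volume ({x | l < ‖cv K g x‖ₑ} ∪ {x | l < ‖cv K (fun x => f x - g x) x‖ₑ}) := by
        refine measure_mono fun x hx => ?_
        by_contra! h
        simp only [Set.mem_union, Set.mem_ofPred_eq, not_or, not_lt] at h hx
        have := (enorm_add_le (cv K g x) (cv K (fun x => f x - g x) x)).trans (add_le_add h.1 h.2)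
        rw [← hsplit, ← two_mul] at this
        exact absurd this hx.not_ge
    _ ≤ (l ^ 2)⁻¹ * ((∫⁻ x in {x | ‖f x‖ₑ ≤ l}, ‖f x‖ₑ ^ 2) + (D * l) ^ 2 * volume Ω) +
        (D * volume Ω + l⁻¹ * (B * (2 * D * l) * volume Ω)) :=
        (measure_union_le _ _).trans (add_le_add hTg (hTb.trans (by gcongr)))
    _ = (l ^ 2)⁻¹ * (∫⁻ x in {x | ‖f x‖ₑ ≤ l}, ‖f x‖ₑ ^ 2) +
        (D ^ 2 * ((l ^ 2)⁻¹ * l ^ 2) + D + 2 * B * D * (l⁻¹ * l)) * volume Ω := by ring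
    _ ≤ (l ^ 2)⁻¹ * (∫⁻ x in {x | ‖f x‖ₑ ≤ l}, ‖f x‖ₑ ^ 2) +
        (D ^ 2 * ((l ^ 2)⁻¹ * l ^ 2) + D + 2 * B * D * (l⁻¹ * l)) *
          (2 * l⁻¹ * ∫⁻ x in {x | l / 2 < F x}, F x) := by gcongr
    _ = _ := by
        rw [hll, hll2]
        ring

end Kernel

lemma lintegral_Ioi_large_le {p : ℝ} (hp2 : p < 2) {a : ℝ} (ha : 0 ≤ a) :
    ∫⁻ t in Set.Ioi (0 : ℝ), ENNReal.ofReal (t ^ (p - 1)) * ((ENNReal.ofReal (t / 2) ^ 2)⁻¹ *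
      (if ENNReal.ofReal a ≤ ENNReal.ofReal (t / 2) then ENNReal.ofReal a ^ 2 else 0)) ≤
      ENNReal.ofReal (4 * 2 ^ (p - 2) / (2 - p)) * ENNReal.ofReal a ^ p := by
  rcases ha.eq_or_lt with rfl | ha
  · simp
  have hInt : IntegrableOn (fun t : ℝ => 4 * a ^ 2 * t ^ (p - 3)) (Set.Ioi (2 * a)) :=
    (integrableOn_Ioi_rpow_of_lt (by linarith) (by positivity)).const_mul _
  have hval : ∫ t in Set.Ioi (2 * a), 4 * a ^ 2 * t ^ (p - 3) = 4 * 2 ^ (p - 2) / (2 - p) * a ^ p := by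
    rw [integral_const_mul, integral_Ioi_rpow_of_lt (by linarith) (by positivity),
      show p - 3 + 1 = p - 2 by ring, Real.mul_rpow (by norm_num) ha.le, Real.rpow_sub ha p 2]
    have h1 : (2 - p) ≠ 0 := by linarith
    have h2 : (p - 2) ≠ 0 := by linarith
    rw [show (2 : ℝ) = ((2 : ℕ) : ℝ) by norm_num, Real.rpow_natCast]
    push_cast
    rw [show p - 2 = - (2 - p) by ring]
    field_simp
  rw [ENNReal.ofReal_rpow_of_pos ha, ← ENNReal.ofReal_mul (by
    have : 0 < 2 - p := by linarith
    positivity), ← hval, ofReal_integral_eq_lintegral_ofReal hInt (by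
      filter_upwards [ae_restrict_mem measurableSet_Ioi] with t ht
      have : 0 < t := lt_trans (by positivity) ht
      simp only [Pi.zero_apply]
      positivity), ← lintegral_indicator measurableSet_Ioi, ← lintegral_indicator measurableSet_Ioi]
  have hne : ∀ᵐ t : ℝ, t ≠ 2 * a := by
    simp [ae_iff]
  refine lintegral_mono_ae ?_
  filter_upwards [hne] with t htne
  by_cases ht : t ∈ Set.Ioi (0 : ℝ)
  · rw [Set.indicator_of_mem ht]
    have ht0 : 0 < t := ht
    split_ifs with h
    · rw [ENNReal.ofReal_le_ofReal_iff (by positivity)] at h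
      have h2 : t ∈ Set.Ioi (2 * a) := lt_of_le_of_ne (by linarith) htne.symm
      rw [Set.indicator_of_mem h2, ← ENNReal.ofReal_pow (by positivity),
        ← ENNReal.ofReal_inv_of_pos (by positivity), ← ENNReal.ofReal_pow ha.le,
        ← ENNReal.ofReal_mul (by positivity), ← ENNReal.ofReal_mul (by positivity)]
      refine ENNReal.ofReal_le_ofReal (le_of_eq ?_)
      rw [show p - 3 = (p - 1) - 2 by ring, Real.rpow_sub ht0 (p - 1) 2]
      rw [show (2 : ℝ) = ((2 : ℕ) : ℝ) by norm_num, Real.rpow_natCast]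
      push_cast
      field_simp
      try norm_num
    · simp
  · rw [Set.indicator_of_notMem ht]
    exact zero_le

lemma lintegral_Ioi_small_le {p : ℝ} (hp1 : 1 < p) {a : ℝ} (ha : 0 ≤ a) :
    ∫⁻ t in Set.Ioi (0 : ℝ), ENNReal.ofReal (t ^ (p - 1)) * ((ENNReal.ofReal (t / 2))⁻¹ *
      (if ENNReal.ofReal (t / 2) / 2 < ENNReal.ofReal a then ENNReal.ofReal a else 0)) ≤
      ENNReal.ofReal (2 * 4 ^ (p - 1) / (p - 1)) * ENNReal.ofReal a ^ p := by
  rcases ha.eq_or_lt with rfl | ha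
  · simp
  have hInt : IntegrableOn (fun t : ℝ => 2 * a * t ^ (p - 2)) (Set.Ioc 0 (4 * a)) := by
    have := (intervalIntegral.intervalIntegrable_rpow' (a := 0) (b := 4 * a) (r := p - 2)
      (by linarith)).const_mul (2 * a)
    rwa [intervalIntegrable_iff_integrableOn_Ioc_of_le (by positivity)] at this
  have hp0 : 0 < p - 1 := by linarith
  have hval : ∫ t in Set.Ioc 0 (4 * a), 2 * a * t ^ (p - 2) = 2 * 4 ^ (p - 1) / (p - 1) * a ^ p := by
    rw [← intervalIntegral.integral_of_le (by positivity), intervalIntegral.integral_const_mul,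
      integral_rpow (Or.inl (by linarith)), show p - 2 + 1 = p - 1 by ring,
      Real.zero_rpow hp0.ne', Real.mul_rpow (by norm_num) ha.le, Real.rpow_sub ha p 1,
      Real.rpow_one]
    field_simp
    ring
  rw [ENNReal.ofReal_rpow_of_pos ha, ← ENNReal.ofReal_mul (by positivity), ← hval,
    ofReal_integral_eq_lintegral_ofReal hInt (by
      filter_upwards [ae_restrict_mem measurableSet_Ioc] with t ht
      have : 0 < t := ht.1
      simp only [Pi.zero_apply]
      positivity), ← lintegral_indicator measurableSet_Ioi, ← lintegral_indicator measurableSet_Ioc]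
  refine lintegral_mono fun t => ?_
  by_cases ht : t ∈ Set.Ioi (0 : ℝ)
  · rw [Set.indicator_of_mem ht]
    have ht0 : 0 < t := ht
    split_ifs with h
    · rw [show (2 : ℝ≥0∞) = ENNReal.ofReal 2 by simp, ← ENNReal.ofReal_div_of_pos (by norm_num),
        ENNReal.ofReal_lt_ofReal_iff ha] at h
      have h2 : t ∈ Set.Ioc 0 (4 * a) := ⟨ht0, by linarith⟩
      rw [Set.indicator_of_mem h2, 
        ← ENNReal.ofReal_inv_of_pos (by positivity),
        ← ENNReal.ofReal_mul (by positivity), ← ENNReal.ofReal_mul (by positivity)]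
      refine ENNReal.ofReal_le_ofReal (le_of_eq ?_)
      rw [show p - 2 = (p - 1) - 1 by ring, Real.rpow_sub ht0 (p - 1) 1, Real.rpow_one]
      field_simp
    · simp
  · rw [Set.indicator_of_notMem ht]
    exact zero_le

/-- The constant in the `Lᵖ` bound, `1 < p < 2`. -/
def czConst (p : ℝ) (D B : ℝ≥0) : ℝ≥0 :=
  (p * (4 * 2 ^ (p - 2) / (2 - p) + 2 * (D ^ 2 + D + 2 * B * D) * (2 * 4 ^ (p - 1) / (p - 1)))).toNNReal

section Kernel

set_option linter.unusedSectionVars false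

variable {E : Type*} [NormedAddCommGroup E] [MeasureSpace E] [BorelSpace E]
  [SecondCountableTopology E] [(volume : Measure E).IsAddHaarMeasure]
  [(volume : Measure E).IsNegInvariant] [SigmaFinite (volume : Measure E)]
  {D : ℝ≥0} {S : DyadicSystem E D} {B : ℝ≥0} {K : E → ℂ}

lemma CZKernel.lintegral_cv_rpow_le_of_lt_two (hK : CZKernel S B K) {p : ℝ} (hp1 : 1 < p)
    (hp2 : p < 2) {f : E → ℂ} (hf : Continuous f)
    (hi : Integrable f) {C : ℝ} (hC : ∀ x, ‖f x‖ ≤ C) :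
    ∫⁻ x, ‖cv K f x‖ₑ ^ p ≤ czConst p D B * ∫⁻ x, ‖f x‖ₑ ^ p := by
  set c : ℝ≥0∞ := 2 * (D ^ 2 + D + 2 * B * D) with hc
  have hm := aestronglyMeasurable_cv hK.measurable hf.aestronglyMeasurable
  have hfm : Measurable fun x => ‖f x‖ₑ := hf.measurable.enorm
  have h1 : ∫⁻ x, ‖cv K f x‖ₑ ^ p = ENNReal.ofReal p * ∫⁻ t in Set.Ioi (0 : ℝ),
      volume {x | t < ‖cv K f x‖} * ENNReal.ofReal (t ^ (p - 1)) := by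
    rw [← lintegral_rpow_eq_lintegral_meas_lt_mul _ (.of_forall fun x => norm_nonneg _)
      hm.norm.aemeasurable (by linarith)]
    refine lintegral_congr fun x => ?_
    rw [← ENNReal.ofReal_rpow_of_nonneg (norm_nonneg _) (by linarith), ofReal_norm]
  have h2 : ∀ t ∈ Set.Ioi (0 : ℝ), volume {x | t < ‖cv K f x‖} * ENNReal.ofReal (t ^ (p - 1)) ≤
      ∫⁻ x, (ENNReal.ofReal (t ^ (p - 1)) * ((ENNReal.ofReal (t / 2) ^ 2)⁻¹ *
      (if ‖f x‖ₑ ≤ ENNReal.ofReal (t / 2) then ‖f x‖ₑ ^ 2 else 0)) + c *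
      (ENNReal.ofReal (t ^ (p - 1)) * ((ENNReal.ofReal (t / 2))⁻¹ *
      (if ENNReal.ofReal (t / 2) / 2 < ‖f x‖ₑ then ‖f x‖ₑ else 0)))) := by
    intro t ht
    have ht0 : 0 < t := ht
    have hl : ENNReal.ofReal (t / 2) ≠ 0 := by
      simpa using ht0
    have hset : {x | t < ‖cv K f x‖} = {x | 2 * ENNReal.ofReal (t / 2) < ‖cv K f x‖ₑ} := by
      ext x
      simp only [Set.mem_ofPred_eq]
      rw [← ofReal_norm, show (2 : ℝ≥0∞) = ENNReal.ofReal 2 by simp,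
        ← ENNReal.ofReal_mul (by norm_num), show 2 * (t / 2) = t by ring,
        ENNReal.ofReal_lt_ofReal_iff_of_nonneg ht0.le]
    have hs1 : MeasurableSet {x | ‖f x‖ₑ ≤ ENNReal.ofReal (t / 2)} :=
      measurableSet_le hfm measurable_const
    have hs2 : MeasurableSet {x | ENNReal.ofReal (t / 2) / 2 < ‖f x‖ₑ} :=
      measurableSet_lt measurable_const hfm
    rw [hset, lintegral_add_left (by
      refine (Measurable.ite hs1 (hfm.pow_const 2) measurable_const).const_mul _ |>.const_mul _),
      lintegral_const_mul' _ _ (by finiteness), lintegral_const_mul' _ _ (by finiteness),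
      lintegral_const_mul' _ _ (by finiteness), lintegral_const_mul' _ _ (by finiteness),
      lintegral_const_mul' _ _ (by finiteness)]
    have h := hK.meas_lt_cv_le hf hi hC hl ENNReal.ofReal_ne_top
    rw [← lintegral_indicator hs1, ← lintegral_indicator hs2] at h
    rw [mul_comm, ← mul_assoc c, mul_comm c, mul_assoc _ c, ← mul_add]
    simp only [Set.indicator, Set.mem_ofPred_eq] at h
    refine mul_le_mul_right ?_ _
    convert h
  rw [h1]
  calc ENNReal.ofReal p * ∫⁻ t in Set.Ioi (0 : ℝ),
      volume {x | t < ‖cv K f x‖} * ENNReal.ofReal (t ^ (p - 1))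
      ≤ ENNReal.ofReal p * ∫⁻ t in Set.Ioi (0 : ℝ), ∫⁻ x,
      (ENNReal.ofReal (t ^ (p - 1)) * ((ENNReal.ofReal (t / 2) ^ 2)⁻¹ *
      (if ‖f x‖ₑ ≤ ENNReal.ofReal (t / 2) then ‖f x‖ₑ ^ 2 else 0)) + c *
      (ENNReal.ofReal (t ^ (p - 1)) * ((ENNReal.ofReal (t / 2))⁻¹ *
      (if ENNReal.ofReal (t / 2) / 2 < ‖f x‖ₑ then ‖f x‖ₑ else 0)))) := by
        gcongr ENNReal.ofReal p * ?_
        exact setLIntegral_mono' measurableSet_Ioi h2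
    _ = ENNReal.ofReal p * ∫⁻ x, ∫⁻ t in Set.Ioi (0 : ℝ),
      (ENNReal.ofReal (t ^ (p - 1)) * ((ENNReal.ofReal (t / 2) ^ 2)⁻¹ *
      (if ‖f x‖ₑ ≤ ENNReal.ofReal (t / 2) then ‖f x‖ₑ ^ 2 else 0)) + c *
      (ENNReal.ofReal (t ^ (p - 1)) * ((ENNReal.ofReal (t / 2))⁻¹ *
      (if ENNReal.ofReal (t / 2) / 2 < ‖f x‖ₑ then ‖f x‖ₑ else 0)))) := by
        rw [lintegral_lintegral_swap]
        have hfm2 : Measurable fun a : ℝ × E => ‖f a.2‖ₑ := hfm.comp measurable_snd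
        refine Measurable.aemeasurable ?_
        refine Measurable.add (Measurable.mul (by fun_prop) (Measurable.mul (by fun_prop) ?_))
          (Measurable.const_mul (Measurable.mul (by fun_prop) (Measurable.mul (by fun_prop) ?_)) _)
        · exact Measurable.ite (measurableSet_le (by fun_prop) (by fun_prop)) (by fun_prop)
            measurable_const
        · exact Measurable.ite (measurableSet_lt (by fun_prop) (by fun_prop)) (by fun_prop)
            measurable_const
    _ ≤ ENNReal.ofReal p * ∫⁻ x, (ENNReal.ofReal (4 * 2 ^ (p - 2) / (2 - p)) +
        c * ENNReal.ofReal (2 * 4 ^ (p - 1) / (p - 1))) * ‖f x‖ₑ ^ p := by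
        gcongr ENNReal.ofReal p * ?_
        refine lintegral_mono fun x => ?_
        rw [← ofReal_norm]
        rw [lintegral_add_left, lintegral_const_mul' _ _ (by finiteness), add_mul, mul_assoc c]
        · gcongr
          · exact lintegral_Ioi_large_le hp2 (norm_nonneg _)
          · exact lintegral_Ioi_small_le hp1 (norm_nonneg _)
        · refine Measurable.mul (by fun_prop) (Measurable.mul (by fun_prop) ?_)
          exact Measurable.ite (measurableSet_le (by fun_prop) (by fun_prop)) (by fun_prop)
            measurable_const
    _ = _ := by
        rw [lintegral_const_mul' _ _ (by finiteness), ← mul_assoc]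
        congr 1
        have hp2' : 0 < 2 - p := by linarith
        have hp1' : 0 < p - 1 := by linarith
        have : c = ENNReal.ofReal (2 * (D ^ 2 + D + 2 * B * D)) := by
          rw [hc]
          norm_cast
          rw [← ENNReal.ofReal_coe_nnreal]
        rw [this, ← ENNReal.ofReal_mul (by positivity), ← ENNReal.ofReal_add (by positivity)
          (by positivity), ← ENNReal.ofReal_mul (by positivity)]
        rfl

end Kernel

section Kernel

set_option linter.unusedSectionVars false

variable {E : Type*} [NormedAddCommGroup E] [MeasureSpace E] [BorelSpace E]
  [SecondCountableTopology E] [(volume : Measure E).IsAddHaarMeasure]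
  [(volume : Measure E).IsNegInvariant] [SigmaFinite (volume : Measure E)]
  {D : ℝ≥0} {S : DyadicSystem E D} {B : ℝ≥0} {K : E → ℂ}

lemma cv_eq_integral_mul_sub (K f : E → ℂ) (x : E) : cv K f x = ∫ y, K y * f (x - y) := by
  rw [cv, ← integral_sub_left_eq_self _ volume x]
  simp

lemma continuous_cv {f : E → ℂ} (hK : Integrable K) (hf : Continuous f) {C : ℝ}
    (hC : ∀ x, ‖f x‖ ≤ C) : Continuous (cv K f) := by
  rw [show cv K f = fun x => ∫ y, K y * f (x - y) from funext (cv_eq_integral_mul_sub K f)]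
  refine continuous_of_dominated (bound := fun y => ‖K y‖ * C) (fun x => ?_) (fun x => ?_)
    (hK.norm.mul_const _) ?_
  · exact hK.aestronglyMeasurable.mul (by fun_prop : Continuous fun y => f (x - y)).aestronglyMeasurable
  · refine .of_forall fun y => ?_
    rw [norm_mul]
    gcongr
    exact hC _
  · exact .of_forall fun y => by fun_prop

lemma norm_cv_le {f : E → ℂ} (hK : Integrable K) {C : ℝ}
    (hC : ∀ x, ‖f x‖ ≤ C) (x : E) : ‖cv K f x‖ ≤ (∫ y, ‖K y‖) * C := by
  rw [cv_eq_integral_mul_sub, ← integral_mul_const]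
  refine norm_integral_le_of_norm_le (hK.norm.mul_const _) (.of_forall fun y => ?_)
  rw [norm_mul]
  gcongr
  exact hC _

lemma integrable_cv_prod {f : E → ℂ} (hK : Integrable K) (hf : Integrable f) :
    Integrable (fun p : E × E => K (p.1 - p.2) * f p.2) (volume.prod volume) := by
  have h := Integrable.convolution_integrand (ContinuousLinearMap.mul ℝ ℂ) hf hK
  refine h.congr (.of_forall fun p => ?_)
  simp [mul_comm]

lemma integrable_cv {f : E → ℂ} (hK : Integrable K) (hf : Integrable f) :
    Integrable (cv K f) :=
  (integrable_cv_prod hK hf).integral_prod_left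

lemma integral_mul_cv {f g : E → ℂ} (hK : Integrable K) (hf : Integrable f) (hg : Continuous g)
    {C : ℝ} (hC : ∀ x, ‖g x‖ ≤ C) :
    ∫ x, g x * cv K f x = ∫ y, cv K (fun x => g (-x)) (-y) * f y := by
  have h : Integrable (fun p : E × E => g p.1 * (K (p.1 - p.2) * f p.2)) (volume.prod volume) :=
    (integrable_cv_prod hK hf).bdd_mul (hg.comp continuous_fst).aestronglyMeasurable
      (.of_forall fun p => hC p.1)
  simp_rw [cv, ← integral_const_mul]
  rw [integral_integral_swap h]
  refine integral_congr_ae (.of_forall fun y => ?_)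
  simp only
  rw [← integral_mul_const, ← integral_neg_eq_self]
  refine integral_congr_ae (.of_forall fun x => ?_)
  simp only
  rw [neg_sub_comm]
  ring

lemma lintegral_enorm_rpow_lt_top {u : E → ℂ} (hu : Integrable u) {C : ℝ} (hC : ∀ x, ‖u x‖ ≤ C)
    {p : ℝ} (hp : 1 ≤ p) : ∫⁻ x, ‖u x‖ₑ ^ p < ∞ := by
  calc ∫⁻ x, ‖u x‖ₑ ^ p ≤ ∫⁻ x, ENNReal.ofReal C ^ (p - 1) * ‖u x‖ₑ := by
        refine lintegral_mono fun x => ?_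
        have h : ‖u x‖ₑ ≤ ENNReal.ofReal C := by
          rw [← ofReal_norm]
          exact ENNReal.ofReal_le_ofReal (hC x)
        calc ‖u x‖ₑ ^ p = ‖u x‖ₑ ^ (p - 1) * ‖u x‖ₑ := by
              conv_lhs => rw [show p = (p - 1) + 1 by ring,
                ENNReal.rpow_add_of_nonneg _ _ (by linarith) (by norm_num), ENNReal.rpow_one]
          _ ≤ _ := by
              gcongr
    _ = ENNReal.ofReal C ^ (p - 1) * ∫⁻ x, ‖u x‖ₑ := by
        rw [lintegral_const_mul' _ _ (by finiteness)]
    _ < ∞ := ENNReal.mul_lt_top (by finiteness) hu.2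

/-- The constant in the `Lᵖ` bound, `1 < p < ∞`. -/
def czConst' (p : ℝ) (D B : ℝ≥0) : ℝ≥0 :=
  czConst p D B + 1 + czConst (p / (p - 1)) D B ^ (p - 1)

lemma CZKernel.lintegral_cv_rpow_le_of_two_lt (hK : CZKernel S B K) {p : ℝ} (hp : 2 < p)
    {f : E → ℂ} (hf : Continuous f)
    (hi : Integrable f) {C : ℝ} (hC : ∀ x, ‖f x‖ ≤ C) :
    ∫⁻ x, ‖cv K f x‖ₑ ^ p ≤ (czConst (p / (p - 1)) D B) ^ (p - 1) * ∫⁻ x, ‖f x‖ₑ ^ p := by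
  set u := cv K f with hu
  set q := p / (p - 1) with hq
  have hp1 : 0 < p - 1 := by linarith
  have hq1 : 1 < q := by rw [hq, one_lt_div hp1]; linarith
  have hq2 : q < 2 := by rw [hq, div_lt_iff₀ hp1]; linarith
  have hpq : p.HolderConjugate q := Real.HolderConjugate.conjExponent (by linarith)
  have huc : Continuous u := continuous_cv hK.integrable hf hC
  have hub : ∀ x, ‖u x‖ ≤ (∫ y, ‖K y‖) * C := norm_cv_le hK.integrable hC
  have hui : Integrable u := integrable_cv hK.integrable hi
  set M := (∫ y, ‖K y‖) * C with hM
  have hM0 : 0 ≤ M := (norm_nonneg _).trans (hub 0)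
  set g : E → ℂ := fun x => ((‖u x‖ ^ (p - 2) : ℝ) : ℂ) * (starRingEnd ℂ) (u x) with hg
  have hgc : Continuous g := by
    refine Continuous.mul ?_ (by fun_prop)
    exact Complex.continuous_ofReal.comp (huc.norm.rpow_const fun x => Or.inr (by linarith))
  have hgn (x : E) : ‖g x‖ = ‖u x‖ ^ (p - 1) := by
    simp only [hg, norm_mul, Complex.norm_real, RCLike.norm_conj, Real.norm_eq_abs]
    rw [abs_of_nonneg (by positivity), show p - 1 = (p - 2) + 1 by ring,
      Real.rpow_add_one' (norm_nonneg _) (by linarith)]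
  have hge (x : E) : ‖g x‖ₑ = ‖u x‖ₑ ^ (p - 1) := by
    rw [← ofReal_norm, hgn, ← ENNReal.ofReal_rpow_of_nonneg (norm_nonneg _) hp1.le, ofReal_norm]
  have hgb (x : E) : ‖g x‖ ≤ M ^ (p - 1) := by
    rw [hgn]
    gcongr
    exact hub x
  have hgi : Integrable g := by
    refine hui.norm.const_mul (M ^ (p - 2)) |>.mono' hgc.aestronglyMeasurable
      (.of_forall fun x => ?_)
    rw [hgn, show p - 1 = (p - 2) + 1 by ring,
      Real.rpow_add_one' (norm_nonneg _) (by linarith)]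
    gcongr
    exact hub x
  have hgu (x : E) : g x * u x = ((‖u x‖ ^ p : ℝ) : ℂ) := by
    simp only [hg]
    rw [mul_assoc, ← Complex.normSq_eq_conj_mul_self, Complex.normSq_eq_norm_sq, ← Complex.ofReal_mul]
    congr 1
    rw [← Real.rpow_natCast, ← Real.rpow_add_of_nonneg (norm_nonneg _) (by linarith) (by simp)]
    norm_num
  set I := ∫⁻ x, ‖u x‖ₑ ^ p with hI
  have hIfin : I ≠ ∞ := (lintegral_enorm_rpow_lt_top hui hub (by linarith)).ne
  have h1 : I = ‖∫ x, g x * u x‖ₑ := by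
    simp_rw [hgu]
    rw [integral_complex_ofReal, ← ofReal_norm, Complex.norm_real, Real.norm_of_nonneg (by positivity),
      ofReal_integral_eq_lintegral_ofReal]
    · refine lintegral_congr fun x => ?_
      rw [← ENNReal.ofReal_rpow_of_nonneg (norm_nonneg _) (by linarith), ofReal_norm]
    · refine ⟨(huc.norm.rpow_const fun x => Or.inr (by linarith)).aestronglyMeasurable, ?_⟩
      rw [HasFiniteIntegral]
      convert hIfin.lt_top using 2
      ext x
      rw [Real.enorm_of_nonneg (by positivity),
        ← ENNReal.ofReal_rpow_of_nonneg (norm_nonneg _) (by linarith), ofReal_norm]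
    · exact .of_forall fun x => by positivity
  set gr : E → ℂ := fun x => g (-x) with hgr
  have hgrm : Continuous (cv K gr) := continuous_cv hK.integrable (by fun_prop) (fun x => hgb (-x))
  have h2 : I ≤ (∫⁻ x, ‖cv K gr x‖ₑ ^ q) ^ (1 / q) * (∫⁻ x, ‖f x‖ₑ ^ p) ^ (1 / p) := by
    rw [h1, hu, integral_mul_cv hK.integrable hi hgc hgb]
    refine (enorm_integral_le_lintegral_enorm _).trans ?_
    simp_rw [enorm_mul]
    refine (ENNReal.lintegral_mul_le_Lp_mul_Lq volume hpq.symm (by fun_prop) (by fun_prop)).trans_eq ?_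
    congr 2
    exact lintegral_neg_eq_self (fun x => ‖cv K gr x‖ₑ ^ q) 
  have h3 : ∫⁻ x, ‖cv K gr x‖ₑ ^ q ≤ czConst q D B * I := by
    refine (hK.lintegral_cv_rpow_le_of_lt_two hq1 hq2 (by fun_prop) hgi.comp_neg
      (fun x => hgb (-x))).trans_eq ?_
    congr 1
    rw [lintegral_neg_eq_self (fun x => ‖g x‖ₑ ^ q)]
    refine lintegral_congr fun x => ?_
    rw [hge, ← ENNReal.rpow_mul, hq, mul_div_cancel₀ _ hp1.ne']
  have h4 : I ≤ (czConst q D B * I) ^ (1 / q) * (∫⁻ x, ‖f x‖ₑ ^ p) ^ (1 / p) :=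
    h2.trans (by gcongr)
  rcases eq_or_ne I 0 with h0 | h0
  · rw [h0]; exact zero_le
  have hq' : 1 / q = (p - 1) / p := by rw [hq]; field_simp
  have hp0 : 0 < p := by linarith
  have h5 : I ^ (1 / p) ≤ czConst q D B ^ (1 / q) * (∫⁻ x, ‖f x‖ₑ ^ p) ^ (1 / p) := by
    have h6 : I ^ (1 / q) * I ^ (1 / p) = I := by
      rw [← ENNReal.rpow_add _ _ h0 hIfin]
      convert ENNReal.rpow_one I
      rw [hq']; field_simp; ring
    rw [ENNReal.mul_rpow_of_nonneg _ _ (by rw [hq']; positivity)] at h4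
    refine (ENNReal.mul_le_mul_iff_right (a := I ^ (1 / q)) ?_ ?_).1 ?_
    · simp [h0, hIfin]
    · exact ENNReal.rpow_ne_top_of_nonneg (by rw [hq']; positivity) hIfin
    · rw [h6]
      refine h4.trans_eq ?_
      ring
  have h7 := ENNReal.rpow_le_rpow h5 hp0.le
  rw [ENNReal.mul_rpow_of_nonneg _ _ hp0.le, ← ENNReal.rpow_mul, ← ENNReal.rpow_mul,
    ← ENNReal.rpow_mul, hq', div_mul_cancel₀ _ hp0.ne', div_mul_cancel₀ _ hp0.ne',
    ENNReal.rpow_one, ENNReal.rpow_one] at h7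
  exact h7

lemma CZKernel.lintegral_cv_rpow_le (hK : CZKernel S B K) {p : ℝ} (hp : 1 < p)
    {f : E → ℂ} (hf : Continuous f)
    (hi : Integrable f) {C : ℝ} (hC : ∀ x, ‖f x‖ ≤ C) :
    ∫⁻ x, ‖cv K f x‖ₑ ^ p ≤ czConst' p D B * ∫⁻ x, ‖f x‖ₑ ^ p := by
  have hcoe : (czConst' p D B : ℝ≥0∞) =
      czConst p D B + 1 + (czConst (p / (p - 1)) D B : ℝ≥0∞) ^ (p - 1) := by
    rw [czConst', ENNReal.coe_add, ENNReal.coe_add, ENNReal.coe_rpow_of_nonneg _ (by linarith)]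
    rfl
  rw [hcoe]
  rcases lt_trichotomy p 2 with h | rfl | h
  · refine (hK.lintegral_cv_rpow_le_of_lt_two hp h hf hi hC).trans ?_
    gcongr
    rw [add_assoc]
    exact le_self_add
  · have := hK.lintegral_cv_sq f hi ⟨C, hC⟩
    simp_rw [ENNReal.rpow_two]
    refine this.trans ?_
    conv_lhs => rw [← one_mul (∫⁻ x, ‖f x‖ₑ ^ 2)]
    gcongr
    rw [add_right_comm]
    exact le_add_self
  · refine (hK.lintegral_cv_rpow_le_of_two_lt h hf hi hC).trans ?_
    gcongr
    exact le_add_self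

end Kernel

section ParabolicCubes

lemma setOf_floor_mul_eq {a : ℝ} (ha : 0 < a) (c : ℤ) :
    {y : ℝ | ⌊a * y⌋ = c} = Set.Ico (c / a) ((c + 1) / a) := by
  ext y
  simp only [Set.mem_ofPred_eq, Int.floor_eq_iff, Set.mem_Ico, div_le_iff₀ ha, lt_div_iff₀ ha,
    mul_comm a]

lemma abs_sub_le_of_floor_eq {a : ℝ} (ha : 0 < a) {x y : ℝ} (h : ⌊a * y⌋ = ⌊a * x⌋) :
    |y - x| ≤ a⁻¹ := by
  have h1 := (Int.abs_sub_lt_one_of_floor_eq_floor h).le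
  rw [← mul_sub, abs_mul, abs_of_pos ha] at h1
  rwa [← one_div, le_div_iff₀' ha]

variable {n : ℕ}

/-- The parabolic dyadic cube of generation `k` containing `x`. -/
def paraCube (k : ℤ) (x : Rn1 n) : Set (Rn1 n) :=
  {y | (∀ i, ⌊(2 : ℝ) ^ k * y.1 i⌋ = ⌊(2 : ℝ) ^ k * x.1 i⌋) ∧
    ⌊(4 : ℝ) ^ k * y.2⌋ = ⌊(4 : ℝ) ^ k * x.2⌋}

/-- The parabolic box with center `x` and radius `r`. -/
def paraBox (x : Rn1 n) (r : ℝ) : Set (Rn1 n) :=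
  Metric.closedBall x.1 r ×ˢ Metric.closedBall x.2 (r ^ 2)

/-- The radius of a parabolic box containing a cube of generation `k`. -/
def paraRadius (n : ℕ) (k : ℤ) : ℝ := (n + 1) * ((2 : ℝ) ^ k)⁻¹

lemma paraRadius_pos (n : ℕ) (k : ℤ) : 0 < paraRadius n k := by
  unfold paraRadius; positivity

lemma four_zpow (k : ℤ) : (4 : ℝ) ^ k = ((2 : ℝ) ^ k) ^ 2 := by
  rw [show (4 : ℝ) = 2 ^ 2 by norm_num, ← zpow_natCast, ← zpow_natCast, ← zpow_mul, ← zpow_mul,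
    mul_comm]

lemma norm_le_of_abs_le {X : Rn n} {a : ℝ} (ha : 0 ≤ a) (h : ∀ i, |X i| ≤ a) :
    ‖X‖ ≤ (n + 1) * a := by
  refine le_of_sq_le_sq ?_ (by positivity)
  rw [EuclideanSpace.norm_sq_eq]
  calc ∑ i, ‖X i‖ ^ 2 ≤ ∑ _i : Fin n, a ^ 2 := by
        gcongr with i
        exact h i
    _ = n * a ^ 2 := by simp
    _ ≤ ((n + 1) * a) ^ 2 := by
        rw [mul_pow]
        gcongr
        have : (0 : ℝ) ≤ n := by positivity
        nlinarith

lemma paraCube_subset_paraBox (k : ℤ) (x : Rn1 n) :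
    paraCube k x ⊆ paraBox x (paraRadius n k) := by
  rintro y ⟨h1, h2⟩
  have h2' := abs_sub_le_of_floor_eq (by positivity) h2
  refine ⟨?_, ?_⟩
  · rw [mem_closedBall_iff_norm]
    exact norm_le_of_abs_le (by positivity)
      fun i => by simpa using abs_sub_le_of_floor_eq (by positivity) (h1 i)
  · rw [mem_closedBall_iff_norm, Real.norm_eq_abs]
    refine h2'.trans ?_
    rw [four_zpow, paraRadius, mul_pow, inv_pow]
    refine le_mul_of_one_le_left (by positivity) ?_
    have : (0 : ℝ) ≤ n := by positivity
    nlinarith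

lemma paraCube_eq_prod (k : ℤ) (x : Rn1 n) : paraCube k x =
    ((WithLp.ofLp : Rn n → (Fin n → ℝ)) ⁻¹' Set.pi Set.univ
      fun i => Set.Ico ((⌊(2 : ℝ) ^ k * x.1 i⌋ : ℝ) / 2 ^ k) ((⌊(2 : ℝ) ^ k * x.1 i⌋ + 1 : ℝ) / 2 ^ k))
    ×ˢ Set.Ico ((⌊(4 : ℝ) ^ k * x.2⌋ : ℝ) / 4 ^ k) ((⌊(4 : ℝ) ^ k * x.2⌋ + 1 : ℝ) / 4 ^ k) := by
  simp_rw [← setOf_floor_mul_eq (show (0 : ℝ) < 2 ^ k by positivity)]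
  rw [← setOf_floor_mul_eq (show (0 : ℝ) < 4 ^ k by positivity)]
  ext y
  simp [paraCube]

lemma measurableSet_paraCube (k : ℤ) (x : Rn1 n) : MeasurableSet (paraCube k x) := by
  rw [paraCube_eq_prod]
  refine MeasurableSet.prod ?_ measurableSet_Ico
  exact (WithLp.measurable_ofLp 2 _) (MeasurableSet.univ_pi fun i => measurableSet_Ico)

lemma volume_paraCube (k : ℤ) (x : Rn1 n) :
    volume (paraCube k x) = ENNReal.ofReal ((((2 : ℝ) ^ k)⁻¹) ^ (n + 2)) := by
  rw [paraCube_eq_prod, Measure.volume_eq_prod, Measure.prod_prod,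
    (PiLp.volume_preserving_ofLp (Fin n)).measure_preimage
      (MeasurableSet.univ_pi fun i => measurableSet_Ico).nullMeasurableSet, volume_pi_pi]
  simp only [Real.volume_Ico, ← sub_div, add_sub_cancel_left, Finset.prod_const,
    Finset.card_univ, Fintype.card_fin]
  rw [← ENNReal.ofReal_pow (by positivity), ← ENNReal.ofReal_mul (by positivity), four_zpow,
    pow_add]
  simp

lemma measurableSet_paraBox (x : Rn1 n) (r : ℝ) : MeasurableSet (paraBox x r) :=
  measurableSet_closedBall.prod measurableSet_closedBall

/-- The doubling constant of the parabolic dyadic system. -/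
def paraDoubling (n : ℕ) : ℝ≥0 :=
  2 ^ (n + 2) + 2 * (2 * (n + 1)) ^ (n + 2) * (volume (Metric.closedBall (0 : Rn n) 1)).toNNReal

lemma volume_paraBox (x : Rn1 n) {r : ℝ} (hr : 0 ≤ r) : volume (paraBox x r) =
    ENNReal.ofReal (2 * r ^ (n + 2)) * volume (Metric.closedBall (0 : Rn n) 1) := by
  rw [paraBox, Measure.volume_eq_prod, Measure.prod_prod, Measure.addHaar_closedBall _ _ hr,
    Real.volume_closedBall, finrank_euclideanSpace_fin, mul_right_comm,
    ← ENNReal.ofReal_mul (by positivity), Measure.addHaar_unitClosedBall_eq_addHaar_unitBall]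
  congr 2
  ring

/-- The parabolic dyadic system on `ℝ^{n+1}`. -/
def paraSystem (n : ℕ) : DyadicSystem (Rn1 n) (paraDoubling n) where
  Q := paraCube
  star k x := paraBox x (2 * paraRadius n k)
  mem_self k x := ⟨fun _ => rfl, rfl⟩
  eq_of_mem k x y h := by
    ext z
    simp only [paraCube, Set.mem_ofPred_eq, h.2, h.1]
  succ_subset k x := by
    rintro y ⟨h1, h2⟩
    have key (b : ℕ) (hb : 0 < b) (u v : ℝ) (h : ⌊(b : ℝ) ^ (k + 1) * u⌋ = ⌊(b : ℝ) ^ (k + 1) * v⌋) :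
        ⌊(b : ℝ) ^ k * u⌋ = ⌊(b : ℝ) ^ k * v⌋ := by
      have hb' : (b : ℝ) ≠ 0 := by positivity
      have h3 (w : ℝ) : ⌊(b : ℝ) ^ k * w⌋ = ⌊(b : ℝ) ^ (k + 1) * w⌋ / (b : ℤ) := by
        rw [← Int.floor_div_natCast, zpow_add_one₀ hb']
        congr 1
        field_simp
      rw [h3, h3, h]
    exact ⟨fun i => key 2 (by norm_num) _ _ (h1 i), key 4 (by norm_num) _ _ h2⟩
  countable_range k := by
    refine (Set.countable_range fun c : (Fin n → ℤ) × ℤ =>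
      {y : Rn1 n | (∀ i, ⌊(2 : ℝ) ^ k * y.1 i⌋ = c.1 i) ∧ ⌊(4 : ℝ) ^ k * y.2⌋ = c.2}).mono ?_
    rintro _ ⟨x, rfl⟩
    exact ⟨(fun i => ⌊(2 : ℝ) ^ k * x.1 i⌋, ⌊(4 : ℝ) ^ k * x.2⌋), rfl⟩
  measurableSet := measurableSet_paraCube
  measure_ne_zero k x := by
    rw [volume_paraCube]
    simp only [ne_eq, ENNReal.ofReal_eq_zero, not_le]
    positivity
  measure_ne_top k x := by
    rw [volume_paraCube]
    finiteness
  measure_le_succ k x := by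
    rw [volume_paraCube, volume_paraCube, zpow_add_one₀ (by norm_num), mul_inv, mul_pow,
      mul_comm ((((2 : ℝ) ^ k)⁻¹) ^ (n + 2)), ENNReal.ofReal_mul (by positivity), ← mul_assoc]
    refine le_mul_of_one_le_left zero_le ?_
    have h : (2 : ℝ≥0∞) ^ (n + 2) ≤ paraDoubling n := by
      rw [paraDoubling]
      push_cast
      exact le_self_add
    calc (1 : ℝ≥0∞) = 2 ^ (n + 2) * ENNReal.ofReal (2⁻¹ ^ (n + 2)) := by
          rw [ENNReal.ofReal_pow (by positivity), ← mul_pow, ENNReal.ofReal_inv_of_pos (by norm_num)]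
          simp [ENNReal.mul_inv_cancel]
      _ ≤ _ := by gcongr
  tendsto_measure x := by
    simp_rw [volume_paraCube]
    refine ENNReal.tendsto_ofReal_nhds_top.2 ?_
    simp only [zpow_neg, zpow_natCast, inv_inv, ← pow_mul]
    refine (tendsto_pow_atTop_atTop_of_one_lt (show (1 : ℝ) < 2 by norm_num)).comp ?_
    exact tendsto_id.atTop_mul_const' (by positivity)
  eventually_subset x U hU := by
    obtain ⟨e, he, hU⟩ := Metric.mem_nhds_iff.1 hU
    have h : Tendsto (fun k : ℕ => paraRadius n (k : ℤ)) atTop (𝓝 0) := by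
      have := (tendsto_inv_atTop_zero.comp
        (tendsto_pow_atTop_atTop_of_one_lt (show (1 : ℝ) < 2 by norm_num))).const_mul ((n : ℝ) + 1)
      simpa [paraRadius] using this
    have h' : Tendsto (fun k : ℕ => paraRadius n (k : ℤ) ^ 2) atTop (𝓝 0) := by
      simpa using h.pow 2
    filter_upwards [h.eventually (gt_mem_nhds he), h'.eventually (gt_mem_nhds he)] with k hk hk'
    intro y hy
    obtain ⟨h1, h2⟩ := paraCube_subset_paraBox _ _ hy
    exact hU (max_lt (lt_of_le_of_lt h1 hk) (lt_of_le_of_lt h2 hk'))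
  measurableSet_star k x := measurableSet_paraBox _ _
  measure_star_le k x := by
    have hV : volume (Metric.closedBall (0 : Rn n) 1) ≠ ∞ := measure_closedBall_lt_top.ne
    rw [volume_paraBox _ (by have := paraRadius_pos n k; positivity), volume_paraCube, paraDoubling]
    push_cast
    rw [ENNReal.coe_toNNReal hV]
    refine le_trans (le_of_eq ?_) (mul_le_mul_left le_add_self _)
    rw [mul_right_comm]
    congr 1
    rw [show (2 * (2 * ((n : ℝ≥0∞) + 1)) ^ (n + 2)) =
      ENNReal.ofReal (2 * (2 * ((n : ℝ) + 1)) ^ (n + 2)) by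
        rw [ENNReal.ofReal_mul (by positivity), ENNReal.ofReal_pow (by positivity),
          ENNReal.ofReal_mul (by positivity), ENNReal.ofReal_add (by positivity) (by positivity)]
        simp, ← ENNReal.ofReal_mul (by positivity), paraRadius, ← mul_assoc 2 ((n : ℝ) + 1), mul_pow]
    ring_nf

end ParabolicCubes

section Plancherel

set_option linter.unusedSectionVars false

open scoped FourierTransform SchwartzMap

lemma lintegral_enorm_sq_le_iff_eLpNorm {α : Type*} [MeasurableSpace α] {μ : Measure α}
    {u v : α → ℂ} :
    ∫⁻ x, ‖u x‖ₑ ^ 2 ∂μ ≤ ∫⁻ x, ‖v x‖ₑ ^ 2 ∂μ ↔ eLpNorm u 2 μ ≤ eLpNorm v 2 μ := by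
  rw [eLpNorm_eq_lintegral_rpow_enorm_toReal (by norm_num) (by norm_num),
    eLpNorm_eq_lintegral_rpow_enorm_toReal (by norm_num) (by norm_num),
    ENNReal.rpow_le_rpow_iff (by norm_num)]
  simp

lemma eLpNorm_le_of_tendsto {α : Type*} [MeasurableSpace α] {μ : Measure α} {p : ℝ≥0∞}
    {u : ℕ → α → ℂ} {v : α → ℂ} (hu : ∀ j, AEStronglyMeasurable (u j) μ)
    (hlim : ∀ x, Tendsto (fun j => u j x) atTop (𝓝 (v x))) {a : ℕ → ℝ≥0∞} {b : ℝ≥0∞}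
    (ha : ∀ j, eLpNorm (u j) p μ ≤ a j) (hab : Tendsto a atTop (𝓝 b)) : eLpNorm v p μ ≤ b := by
  refine (Lp.eLpNorm_lim_le_liminf_eLpNorm hu v (.of_forall hlim)).trans ?_
  rw [← hab.liminf_eq]
  exact liminf_le_liminf (.of_forall ha)

variable {V : Type*} [NormedAddCommGroup V] [InnerProductSpace ℝ V] [FiniteDimensional ℝ V]
  [MeasurableSpace V] [BorelSpace V]

lemma exists_schwartz_seq {g : V → ℂ} {p : ℝ≥0∞} [Fact (1 ≤ p)] (hp : p ≠ ∞) (hg : MemLp g p) :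
    ∃ G : ℕ → 𝓢(V, ℂ), ∀ j, eLpNorm (fun x => G j x - g x) p volume ≤ ENNReal.ofReal (1 / (j + 1)) := by
  have h (j : ℕ) : ∃ G : 𝓢(V, ℂ),
      eLpNorm (fun x => G x - g x) p volume ≤ ENNReal.ofReal (1 / (j + 1)) := by
    obtain ⟨G, hG⟩ := (SchwartzMap.denseRange_toLpCLM (E := V) (F := ℂ) (μ := volume) hp).exists_dist_lt
      (hg.toLp g) (show (0 : ℝ) < 1 / (j + 1) by positivity)
    refine ⟨G, ?_⟩
    rw [dist_comm, dist_eq_norm, SchwartzMap.toLpCLM_apply] at hG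
    rw [show (fun x => G x - g x) = (⇑G - g) from rfl]
    have : G.toLp p volume - hg.toLp g = ((G.memLp p volume).sub hg).toLp _ := by
      rw [MemLp.toLp_sub]; rfl
    rw [this, Lp.norm_toLp] at hG
    rw [← ENNReal.ofReal_toReal ((G.memLp p volume).sub hg).eLpNorm_ne_top]
    exact ENNReal.ofReal_le_ofReal hG.le
  choose G hG using h
  exact ⟨G, hG⟩

lemma tendsto_ofReal_one_div : Tendsto (fun j : ℕ => ENNReal.ofReal (1 / ((j : ℝ) + 1))) atTop (𝓝 0) := by
  simpa using ENNReal.tendsto_ofReal tendsto_one_div_add_atTop_nhds_zero_nat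

lemma SchwartzMap.eLpNorm_two_sq (f : 𝓢(V, ℂ)) :
    eLpNorm f 2 volume = ENNReal.ofReal ((∫ x, ‖f x‖ ^ 2) ^ (1 / 2 : ℝ)) := by
  rw [(f.memLp 2 volume).eLpNorm_eq_integral_rpow_norm (by norm_num) (by norm_num)]
  simp

lemma eLpNorm_cv_le_of_schwartz (K g : 𝓢(V, ℂ)) {c : ℝ} (hc : ∀ w, ‖𝓕 (K : V → ℂ) w‖ ≤ c) :
    eLpNorm (cv K g) 2 volume ≤ ENNReal.ofReal c * eLpNorm g 2 volume := by
  have hc0 : 0 ≤ c := (norm_nonneg _).trans (hc 0)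
  set h := SchwartzMap.convolution (ContinuousLinearMap.mul ℂ ℂ) K g with hh
  have h1 : cv K g = h := by
    ext x
    rw [hh, SchwartzMap.convolution_apply, cv_eq_integral_mul_sub]
    rfl
  rw [h1, SchwartzMap.eLpNorm_two_sq, SchwartzMap.eLpNorm_two_sq, ← ENNReal.ofReal_mul hc0]
  refine ENNReal.ofReal_le_ofReal ?_
  rw [← SchwartzMap.integral_norm_sq_fourier, ← SchwartzMap.integral_norm_sq_fourier g]
  have h2 : ∫ x, ‖(𝓕 h) x‖ ^ 2 ≤ c ^ 2 * ∫ x, ‖(𝓕 g) x‖ ^ 2 := by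
    rw [← integral_const_mul]
    refine integral_mono_of_nonneg (.of_forall fun x => by positivity)
      (((𝓕 g).memLp 2).integrable_norm_pow (by norm_num) |>.const_mul _) (.of_forall fun x => ?_)
    simp only
    rw [SchwartzMap.fourier_convolution_apply, Real.fourier_mul_convolution_eq K.integrable
      g.integrable, norm_mul, mul_pow, SchwartzMap.fourier_coe]
    gcongr
    exact hc x
  calc (∫ x, ‖(𝓕 h) x‖ ^ 2) ^ (1 / 2 : ℝ) ≤ (c ^ 2 * ∫ x, ‖(𝓕 g) x‖ ^ 2) ^ (1 / 2 : ℝ) := by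
        gcongr
    _ = _ := by
        rw [Real.mul_rpow (by positivity) (by positivity), ← Real.sqrt_eq_rpow, Real.sqrt_sq hc0]

lemma eLpNorm_cv_le_of_schwartz_left (K : 𝓢(V, ℂ)) {c : ℝ} (hc : ∀ w, ‖𝓕 (K : V → ℂ) w‖ ≤ c)
    {g : V → ℂ} (hg : MemLp g 2) :
    eLpNorm (cv K g) 2 volume ≤ ENNReal.ofReal c * eLpNorm g 2 volume := by
  have : Fact ((1 : ℝ≥0∞) ≤ 2) := ⟨by norm_num⟩
  obtain ⟨G, hG⟩ := exists_schwartz_seq (by norm_num) hg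
  have hK2 (x : V) : MemLp (fun y => K (x - y)) 2 :=
    (K.memLp 2).comp_measurePreserving (Measure.measurePreserving_sub_left volume x)
  refine eLpNorm_le_of_tendsto (u := fun j => cv K (G j))
    (a := fun j => ENNReal.ofReal c * (eLpNorm g 2 volume + ENNReal.ofReal (1 / (j + 1))))
    (fun j => aestronglyMeasurable_cv K.continuous.measurable (G j).continuous.aestronglyMeasurable)
    (fun x => ?_) (fun j => ?_) ?_
  · rw [tendsto_iff_edist_tendsto_0]
    have hb (j : ℕ) : edist (cv K (G j) x) (cv K g x) ≤
        eLpNorm (fun y => K (x - y)) 2 volume * ENNReal.ofReal (1 / (j + 1)) := by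
      have i1 : Integrable fun y => K (x - y) * G j y := (hK2 x).integrable_mul ((G j).memLp 2)
      have i2 : Integrable fun y => K (x - y) * g y := (hK2 x).integrable_mul hg
      rw [edist_eq_enorm_sub, cv, cv, ← integral_sub i1 i2]
      simp_rw [← mul_sub]
      refine (enorm_integral_le_lintegral_enorm _).trans ?_
      rw [← eLpNorm_one_eq_lintegral_enorm]
      have h3 := eLpNorm_smul_le_mul_eLpNorm (p := 2) (q := 2) (r := 1)
        (f := fun y => G j y - g y) (φ := fun y => K (x - y))
        (((G j).memLp 2 volume).sub hg).aestronglyMeasurable (hK2 x).aestronglyMeasurable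
      refine h3.trans ?_
      gcongr
      exact hG j
    refine tendsto_of_tendsto_of_tendsto_of_le_of_le tendsto_const_nhds ?_ (fun _ => zero_le) hb
    simpa using ENNReal.Tendsto.const_mul tendsto_ofReal_one_div (Or.inr (hK2 x).eLpNorm_ne_top)
  · refine (eLpNorm_cv_le_of_schwartz K (G j) hc).trans ?_
    gcongr
    calc eLpNorm (G j) 2 volume = eLpNorm (g + fun x => G j x - g x) 2 volume := by
          congr 1; ext x; simp
      _ ≤ _ := (eLpNorm_add_le hg.aestronglyMeasurable (((G j).memLp 2).sub hg).aestronglyMeasurable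
          (by norm_num)).trans (by gcongr; exact hG j)
  · have := (tendsto_ofReal_one_div.const_add (eLpNorm g 2 volume))
    rw [add_zero] at this
    exact ENNReal.Tendsto.const_mul this (Or.inr (by finiteness))

lemma eLpNorm_cv_le_of_norm_fourier_le {K : V → ℂ} (hK : Integrable K) {c : ℝ}
    (hc : ∀ w, ‖𝓕 K w‖ ≤ c) {g : V → ℂ} (hg : Integrable g) {C : ℝ} (hC : ∀ x, ‖g x‖ ≤ C) :
    eLpNorm (cv K g) 2 volume ≤ ENNReal.ofReal c * eLpNorm g 2 volume := by
  have hg2 : MemLp g 2 := by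
    refine ⟨hg.aestronglyMeasurable, ?_⟩
    rw [eLpNorm_lt_top_iff_lintegral_rpow_enorm_lt_top (by norm_num) (by norm_num)]
    exact lintegral_enorm_rpow_lt_top hg hC (by norm_num)
  have hc0 : 0 ≤ c := (norm_nonneg _).trans (hc 0)
  obtain ⟨G, hG⟩ := exists_schwartz_seq (p := 1) (by norm_num) (memLp_one_iff_integrable.2 hK)
  have hGK (j : ℕ) : Integrable fun x => G j x - K x := (G j).integrable.sub hK
  have hG' (j : ℕ) : ∫ x, ‖G j x - K x‖ ≤ 1 / (j + 1) := by
    rw [← ENNReal.ofReal_le_ofReal_iff (by positivity), ofReal_integral_norm_eq_lintegral_enorm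
      (hGK j), ← eLpNorm_one_eq_lintegral_enorm]
    exact hG j
  have hft (j : ℕ) (w : V) : ‖𝓕 (G j : V → ℂ) w‖ ≤ c + 1 / (j + 1) := by
    have h1 : 𝓕 (G j : V → ℂ) w = 𝓕 K w + 𝓕 (fun x => G j x - K x) w := by
      simp only [Real.fourier_eq]
      rw [← integral_add ((Real.fourierIntegral_convergent_iff w).2 hK)
        ((Real.fourierIntegral_convergent_iff w).2 (hGK j))]
      congr 1
      ext v
      rw [← smul_add]
      simp
    rw [h1]
    refine (norm_add_le _ _).trans (add_le_add (hc w) ?_)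
    exact (VectorFourier.norm_fourierIntegral_le_integral_norm _ _ _ _ _).trans (hG' j)
  refine eLpNorm_le_of_tendsto (u := fun j => cv (G j) g)
    (a := fun j => ENNReal.ofReal (c + 1 / (j + 1)) * eLpNorm g 2 volume)
    (fun j => aestronglyMeasurable_cv (G j).continuous.measurable hg.aestronglyMeasurable)
    (fun x => ?_) (fun j => eLpNorm_cv_le_of_schwartz_left (G j) (hft j) hg2) ?_
  · rw [tendsto_iff_norm_sub_tendsto_zero]
    have hb (j : ℕ) : ‖cv (G j) g x - cv K g x‖ ≤ 1 / (j + 1) * C := by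
      have h1 : cv (G j) g x - cv K g x = cv (fun x => G j x - K x) g x := by
        rw [cv, cv, cv, ← integral_sub
          (integrable_cv_integrand (G j).integrable hg.aestronglyMeasurable hC x)
          (integrable_cv_integrand hK hg.aestronglyMeasurable hC x)]
        simp_rw [sub_mul]
      have hC0 : 0 ≤ C := (norm_nonneg _).trans (hC 0)
      rw [h1]
      exact (norm_cv_le (hGK j) hC x).trans (by gcongr; exact hG' j)
    refine squeeze_zero (fun _ => norm_nonneg _) hb ?_
    simpa using (tendsto_one_div_add_atTop_nhds_zero_nat (𝕜 := ℝ)).mul_const C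
  · refine ENNReal.Tendsto.mul_const ?_ (Or.inr hg2.eLpNorm_ne_top)
    refine ENNReal.tendsto_ofReal ?_
    simpa using (tendsto_one_div_add_atTop_nhds_zero_nat (𝕜 := ℝ)).const_add c

end Plancherel

section Transport

open scoped FourierTransform SchwartzMap

variable {n : ℕ}

lemma FT1_ofLp (f : Rn1 n → ℂ) (w : WithLp 2 (Rn1 n)) :
    FT1 f (WithLp.ofLp w) = 𝓕 (fun v : WithLp 2 (Rn1 n) => f (WithLp.ofLp v)) w := by
  rw [FT1, Real.fourier_eq', ← (WithLp.volume_preserving_ofLp (Rn n) ℝ).integral_comp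
    (MeasurableEquiv.toLp 2 (Rn1 n)).symm.measurableEmbedding]
  refine integral_congr_ae (.of_forall fun v => ?_)
  simp only [WithLp.prod_inner_apply, PiLp.inner_apply, RCLike.inner_apply, conj_trivial,
    smul_eq_mul]
  congr 2
  push_cast
  simp_rw [mul_comm]
  ring

lemma IFT1_ofLp (f : Rn1 n → ℂ) (w : WithLp 2 (Rn1 n)) :
    IFT1 f (WithLp.ofLp w) = 𝓕⁻ (fun v : WithLp 2 (Rn1 n) => f (WithLp.ofLp v)) w := by
  rw [IFT1, Real.fourierInv_eq', ← (WithLp.volume_preserving_ofLp (Rn n) ℝ).integral_comp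
    (MeasurableEquiv.toLp 2 (Rn1 n)).symm.measurableEmbedding]
  refine integral_congr_ae (.of_forall fun v => ?_)
  simp only [WithLp.prod_inner_apply, PiLp.inner_apply, RCLike.inner_apply, conj_trivial,
    smul_eq_mul]
  congr 2
  push_cast
  simp_rw [mul_comm]
  ring

lemma cv_ofLp (K g : Rn1 n → ℂ) (x : WithLp 2 (Rn1 n)) :
    cv (fun v : WithLp 2 (Rn1 n) => K (WithLp.ofLp v)) (fun v => g (WithLp.ofLp v)) x =
      cv K g (WithLp.ofLp x) := by
  rw [cv, cv, ← (WithLp.volume_preserving_ofLp (Rn n) ℝ).integral_comp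
    (MeasurableEquiv.toLp 2 (Rn1 n)).symm.measurableEmbedding]
  rfl

lemma integrable_comp_ofLp {g : Rn1 n → ℂ} (hg : Integrable g) :
    Integrable (fun v : WithLp 2 (Rn1 n) => g (WithLp.ofLp v)) :=
  (WithLp.volume_preserving_ofLp (Rn n) ℝ).integrable_comp_of_integrable hg

lemma eLpNorm_comp_ofLp (g : Rn1 n → ℂ) (p : ℝ≥0∞) :
    eLpNorm (fun v : WithLp 2 (Rn1 n) => g (WithLp.ofLp v)) p volume = eLpNorm g p volume := by
  have h := (WithLp.volume_preserving_ofLp (Rn n) ℝ).map_eq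
  conv_rhs => rw [← h]
  exact ((MeasurableEquiv.toLp 2 (Rn1 n)).symm.measurableEmbedding.eLpNorm_map_measure).symm

lemma lintegral_cv_sq_le_of_norm_FT1_le {K : Rn1 n → ℂ} (hK : Integrable K)
    (hK1 : ∀ q, ‖FT1 K q‖ ≤ 1) {g : Rn1 n → ℂ} (hg : Integrable g) {C : ℝ} (hC : ∀ x, ‖g x‖ ≤ C) :
    ∫⁻ x, ‖cv K g x‖ₑ ^ 2 ≤ ∫⁻ x, ‖g x‖ₑ ^ 2 := by
  rw [lintegral_enorm_sq_le_iff_eLpNorm, ← eLpNorm_comp_ofLp, ← eLpNorm_comp_ofLp g]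
  have h := eLpNorm_cv_le_of_norm_fourier_le (c := 1) (integrable_comp_ofLp hK)
    (fun w => by rw [← FT1_ofLp]; exact hK1 _) (integrable_comp_ofLp hg)
    (fun x => hC (WithLp.ofLp x))
  simpa [funext (cv_ofLp K g)] using h

/-- A Schwartz function on `ℝⁿ × ℝ`, seen on the Euclidean product. -/
def schwartzLp (f : 𝓢(Rn1 n, ℂ)) : 𝓢(WithLp 2 (Rn1 n), ℂ) :=
  SchwartzMap.compCLMOfContinuousLinearEquiv ℂ (WithLp.prodContinuousLinearEquiv 2 ℝ (Rn n) ℝ) f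

lemma FT1_schwartz (f : 𝓢(Rn1 n, ℂ)) (q : Rn1 n) :
    FT1 f q = 𝓕 (schwartzLp f) (WithLp.toLp 2 q) := by
  rw [SchwartzMap.fourier_coe]
  exact FT1_ofLp f (WithLp.toLp 2 q)

lemma integrable_FT1_schwartz (f : 𝓢(Rn1 n, ℂ)) : Integrable (FT1 f) := by
  simp_rw [funext (FT1_schwartz f)]
  exact (WithLp.volume_preserving_toLp (Rn n) ℝ).integrable_comp_of_integrable
    (𝓕 (schwartzLp f)).integrable

lemma continuous_FT1_schwartz (f : 𝓢(Rn1 n, ℂ)) : Continuous (FT1 f) := by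
  simp_rw [funext (FT1_schwartz f)]
  exact (𝓕 (schwartzLp f)).continuous.comp (WithLp.prod_continuous_toLp 2 _ _)

lemma MOp_FT1_eq_cv {K : Rn1 n → ℂ} (hK : Integrable K) (f : 𝓢(Rn1 n, ℂ)) :
    MOp (FT1 K) f = cv K f := by
  ext x
  obtain ⟨v, rfl⟩ := (WithLp.equiv 2 (Rn1 n)).surjective x
  change IFT1 _ (WithLp.ofLp v) = cv K f (WithLp.ofLp v)
  rw [IFT1_ofLp, ← cv_ofLp]
  set Kv : WithLp 2 (Rn1 n) → ℂ := fun v => K (WithLp.ofLp v) with hKv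
  have hKi : Integrable Kv := integrable_comp_ofLp hK
  set fv := schwartzLp f with hfv
  obtain ⟨C, hC⟩ : ∃ C, ∀ x, ‖fv x‖ ≤ C := by
    obtain ⟨C, hC⟩ := fv.decay 0 0
    exact ⟨C, fun x => by simpa using hC.2 x⟩
  have h1 : (fun w : WithLp 2 (Rn1 n) => FT1 K (WithLp.ofLp w) * FT1 f (WithLp.ofLp w)) =
      𝓕 (cv Kv fv) := by
    ext w
    have h2 : cv Kv fv = convolution Kv fv (ContinuousLinearMap.mul ℂ ℂ) volume := by
      ext x
      rw [cv_eq_integral_mul_sub]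
      rfl
    rw [h2, Real.fourier_mul_convolution_eq hKi fv.integrable, FT1_ofLp, FT1_ofLp]
    rfl
  rw [h1]
  change 𝓕⁻ (𝓕 (cv Kv fv)) v = cv Kv fv v
  rw [Continuous.fourierInv_fourier_eq]
  · exact continuous_cv hKi fv.continuous hC
  · exact integrable_cv hKi fv.integrable
  · rw [← h1]
    have h3 : Continuous fun w : WithLp 2 (Rn1 n) => FT1 K (WithLp.ofLp w) := by
      simp_rw [FT1_ofLp]
      exact VectorFourier.fourierIntegral_continuous Real.continuous_fourierChar
        continuous_inner hKi
    refine (integrable_comp_ofLp (integrable_FT1_schwartz f)).bdd_mul (c := ∫ v, ‖Kv v‖)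
      h3.aestronglyMeasurable (.of_forall fun w => ?_)
    rw [FT1_ofLp]
    exact VectorFourier.norm_fourierIntegral_le_integral_norm _ _ _ _ _

end Transport

section ParabolicKernel

variable {n : ℕ}

instance isAddHaarMeasure_volume_Rn1 : (volume : Measure (Rn1 n)).IsAddHaarMeasure := by
  rw [Measure.volume_eq_prod]
  infer_instance

/-- The Gaussian majorant `t^{-n/2} exp(-|X|² / (16πt))`. -/
def gaussMaj (p : Rn1 n) : ℝ := p.2 ^ (-(n : ℝ) / 2) * Real.exp (-(‖p.1‖ ^ 2) / (16 * π * p.2))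

lemma gaussMaj_nonneg {p : Rn1 n} (hp : 0 < p.2) : 0 ≤ gaussMaj p := by
  rw [gaussMaj]; positivity

lemma measurable_gaussMaj : Measurable (gaussMaj (n := n)) := by
  unfold gaussMaj
  fun_prop

lemma integrable_rexp_neg_mul_sq_norm {V : Type*} [NormedAddCommGroup V] [InnerProductSpace ℝ V]
    [FiniteDimensional ℝ V] [MeasurableSpace V] [BorelSpace V] {b : ℝ} (hb : 0 < b) :
    Integrable fun v : V => Real.exp (-b * ‖v‖ ^ 2) := by
  have h := GaussianFourier.integrable_cexp_neg_mul_sq_norm_add (V := V)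
    (b := (b : ℂ)) (by simpa using hb) 0 0
  refine h.norm.congr (.of_forall fun v => ?_)
  have e : -(b : ℂ) * (‖v‖ : ℂ) ^ 2 + 0 * (inner ℝ (0 : V) v : ℝ) = ((-b * ‖v‖ ^ 2 : ℝ) : ℂ) := by
    push_cast; ring
  simp only [Complex.norm_exp]
  rw [e, Complex.ofReal_re]

lemma lintegral_gaussMaj {t : ℝ} (ht : 0 < t) :
    ∫⁻ X : Rn n, ENNReal.ofReal (gaussMaj (X, t)) = ENNReal.ofReal ((4 * π) ^ n) := by
  have hb : 0 < (16 * π * t)⁻¹ := by positivity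
  have h1 : ∀ X : Rn n, gaussMaj (X, t) =
      t ^ (-(n : ℝ) / 2) * Real.exp (-(16 * π * t)⁻¹ * ‖X‖ ^ 2) := fun X => by
    rw [gaussMaj]
    congr 2
    field_simp
  have hi := integrable_rexp_neg_mul_sq_norm (V := Rn n) hb
  simp_rw [h1]
  rw [← ofReal_integral_eq_lintegral_ofReal (hi.const_mul _) (.of_forall fun X => by positivity),
    integral_const_mul, GaussianFourier.integral_rexp_neg_mul_sq_norm hb]
  congr 1
  rw [finrank_euclideanSpace_fin, show π / (16 * π * t)⁻¹ = (4 * π) ^ (2 : ℝ) * t by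
      rw [Real.rpow_two]; field_simp; ring, Real.mul_rpow (by positivity) ht.le,
    ← Real.rpow_mul (by positivity), mul_left_comm, ← Real.rpow_add ht]
  rw [show -(n : ℝ) / 2 + n / 2 = 0 by ring, Real.rpow_zero, mul_one,
    show (2 : ℝ) * (n / 2) = n by ring, Real.rpow_natCast]

lemma lintegral_mul_gaussMaj {F : ℝ → ℝ≥0∞} (hF : Measurable F) {S : Set ℝ} (hS : MeasurableSet S)
    (hS0 : S ⊆ Ioi 0) :
    ∫⁻ p : Rn1 n in {p | p.2 ∈ S}, F p.2 * ENNReal.ofReal (gaussMaj p) =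
      ENNReal.ofReal ((4 * π) ^ n) * ∫⁻ t in S, F t := by
  have hS' : MeasurableSet {p : Rn1 n | p.2 ∈ S} := measurable_snd hS
  rw [← lintegral_indicator hS', Measure.volume_eq_prod, lintegral_prod_symm]
  · rw [← lintegral_indicator hS, ← lintegral_const_mul _ (hF.indicator hS)]
    refine lintegral_congr fun t => ?_
    by_cases ht : t ∈ S
    · have h1 : ∀ X : Rn n, ({p : Rn1 n | p.2 ∈ S}.indicator
          (fun p => F p.2 * ENNReal.ofReal (gaussMaj p))) (X, t) =
          F t * ENNReal.ofReal (gaussMaj (X, t)) := fun X => by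
        rw [indicator_of_mem (by exact ht)]
      simp_rw [h1]
      rw [lintegral_const_mul, lintegral_gaussMaj (hS0 ht), indicator_of_mem ht, mul_comm]
      exact (measurable_gaussMaj.comp measurable_prodMk_right).ennreal_ofReal
    · have h1 : ∀ X : Rn n, ({p : Rn1 n | p.2 ∈ S}.indicator
          (fun p => F p.2 * ENNReal.ofReal (gaussMaj p))) (X, t) = 0 := fun X => by
        rw [indicator_of_notMem (by exact ht)]
      simp [ht]
  · exact (((hF.comp measurable_snd).mul measurable_gaussMaj.ennreal_ofReal).indicator hS').aemeasurable

/-- Parabolic size and smoothness bounds for a kernel supported in `t > 0`. -/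
structure ParaKernelBound (K : Rn1 n → ℂ) (A : ℝ) : Prop where
  nonneg : 0 ≤ A
  measurable : Measurable K
  zero : ∀ p : Rn1 n, p.2 ≤ 0 → K p = 0
  size : ∀ p : Rn1 n, 0 < p.2 → ‖p.1‖ * ‖K p‖ ≤ A * p.2 ^ (-1 / 2 : ℝ) * gaussMaj p
  smooth : ∀ p : Rn1 n, 0 < p.2 → ∀ h : Rn1 n, ∃ d : ℂ, HasLineDerivAt ℝ K d p h ∧
    ‖d‖ ≤ A * (‖h.1‖ * p.2 ^ (-3 / 2 : ℝ) + |h.2| * p.2 ^ (-2 : ℝ)) * gaussMaj p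

variable {K : Rn1 n → ℂ} {A : ℝ}

lemma lintegral_rpow_neg_half {ρ A : ℝ} (hρ : 0 < ρ) (hA : 0 ≤ A) :
    ∫⁻ t in Ioc 0 (5 * ρ ^ 2), ENNReal.ofReal (ρ⁻¹ * A * t ^ (-1 / 2 : ℝ)) ≤
      ENNReal.ofReal (5 * A) := by
  have hi : IntervalIntegrable (fun t : ℝ => t ^ (-1 / 2 : ℝ)) volume 0 (5 * ρ ^ 2) :=
    intervalIntegral.intervalIntegrable_rpow' (by norm_num)
  rw [← ofReal_integral_eq_lintegral_ofReal ((hi.1).const_mul _)]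
  · refine ENNReal.ofReal_le_ofReal ?_
    rw [integral_const_mul, ← intervalIntegral.integral_of_le (by positivity),
      integral_rpow (Or.inl (by norm_num))]
    norm_num
    rw [← Real.sqrt_eq_rpow, Real.sqrt_mul (by norm_num), Real.sqrt_sq hρ.le]
    have h5 : √5 ≤ 5 / 2 := by rw [Real.sqrt_le_left (by norm_num)]; norm_num
    calc ρ⁻¹ * A * (√5 * ρ / (1 / 2)) = A * (√5 * 2) := by field_simp
      _ ≤ 5 * A := by nlinarith
  · filter_upwards [ae_restrict_mem measurableSet_Ioc] with t ht
    have := ht.1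
    simp only [Pi.zero_apply]
    positivity

lemma lintegral_rpow_neg_tail {ρ A : ℝ} (hρ : 0 < ρ) (hA : 0 ≤ A) :
    ∫⁻ t in Ioi (3 * ρ ^ 2),
      ENNReal.ofReal (A * (ρ * t ^ (-3 / 2 : ℝ) + ρ ^ 2 * t ^ (-2 : ℝ))) ≤
      ENNReal.ofReal (3 * A) := by
  have hc : 0 < 3 * ρ ^ 2 := by positivity
  have h1 : IntegrableOn (fun t : ℝ => t ^ (-3 / 2 : ℝ)) (Ioi (3 * ρ ^ 2)) :=
    integrableOn_Ioi_rpow_of_lt (by norm_num) hc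
  have h2 : IntegrableOn (fun t : ℝ => t ^ (-2 : ℝ)) (Ioi (3 * ρ ^ 2)) :=
    integrableOn_Ioi_rpow_of_lt (by norm_num) hc
  have h12 : IntegrableOn (fun t : ℝ => A * (ρ * t ^ (-3 / 2 : ℝ) + ρ ^ 2 * t ^ (-2 : ℝ)))
      (Ioi (3 * ρ ^ 2)) := ((h1.const_mul _).add (h2.const_mul _)).const_mul _
  rw [← ofReal_integral_eq_lintegral_ofReal h12]
  · refine ENNReal.ofReal_le_ofReal ?_
    have h3 : (1 : ℝ) ≤ √3 := by rw [Real.one_le_sqrt]; norm_num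
    rw [integral_const_mul, integral_add (h1.const_mul _) (h2.const_mul _), integral_const_mul,
      integral_const_mul, integral_Ioi_rpow_of_lt (by norm_num) hc,
      integral_Ioi_rpow_of_lt (by norm_num) hc]
    rw [show (-3 / 2 + 1 : ℝ) = -(1 / 2 : ℝ) by norm_num, show (-2 + 1 : ℝ) = -1 by norm_num,
      Real.rpow_neg hc.le, ← Real.sqrt_eq_rpow,
      Real.sqrt_mul (by norm_num), Real.sqrt_sq hρ.le, Real.rpow_neg hc.le, Real.rpow_one]
    have e : ρ * (-(√3 * ρ)⁻¹ / -(1 / 2)) + ρ ^ 2 * (-(3 * ρ ^ 2)⁻¹ / -1) = 2 / √3 + 1 / 3 := by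
      field_simp
    have e2 : 2 / √3 ≤ 2 := by rw [div_le_iff₀ (by positivity)]; linarith
    rw [e]
    nlinarith
  · filter_upwards [ae_restrict_mem measurableSet_Ioi] with t ht
    have : 0 < t := hc.trans ht
    simp only [Pi.zero_apply]
    positivity

end ParabolicKernel

section ParabolicHormander

variable {n : ℕ} {K : Rn1 n → ℂ} {A : ℝ}

namespace ParaKernelBound

lemma lintegral_size (hK : ParaKernelBound K A) {ρ : ℝ} (hρ : 0 < ρ) :
    ∫⁻ p in {p : Rn1 n | ρ < ‖p.1‖ ∧ p.2 ≤ 5 * ρ ^ 2}, ‖K p‖ₑ ≤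
      ENNReal.ofReal ((4 * π) ^ n) * ENNReal.ofReal (5 * A) := by
  have hT : MeasurableSet {p : Rn1 n | ρ < ‖p.1‖ ∧ p.2 ≤ 5 * ρ ^ 2} :=
    (measurableSet_lt measurable_const measurable_fst.norm).inter
      (measurableSet_le measurable_snd measurable_const)
  have hS : MeasurableSet {p : Rn1 n | p.2 ∈ Ioc 0 (5 * ρ ^ 2)} := measurable_snd measurableSet_Ioc
  calc ∫⁻ p in {p : Rn1 n | ρ < ‖p.1‖ ∧ p.2 ≤ 5 * ρ ^ 2}, ‖K p‖ₑ
      ≤ ∫⁻ p in {p : Rn1 n | p.2 ∈ Ioc 0 (5 * ρ ^ 2)},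
        ENNReal.ofReal (ρ⁻¹ * A * p.2 ^ (-1 / 2 : ℝ)) * ENNReal.ofReal (gaussMaj p) := by
        rw [← lintegral_indicator hT, ← lintegral_indicator hS]
        refine lintegral_mono fun p => ?_
        by_cases hp : p ∈ {p : Rn1 n | ρ < ‖p.1‖ ∧ p.2 ≤ 5 * ρ ^ 2}
        · rw [indicator_of_mem hp]
          obtain ⟨hp1, hp2⟩ := hp
          rcases le_or_gt p.2 0 with h0 | h0
          · simp [hK.zero p h0]
          · rw [indicator_of_mem (show p ∈ {p : Rn1 n | p.2 ∈ Ioc 0 (5 * ρ ^ 2)} from ⟨h0, hp2⟩),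
              ← ENNReal.ofReal_mul (by have := hK.nonneg; positivity), ← ofReal_norm]
            refine ENNReal.ofReal_le_ofReal ?_
            rw [mul_assoc, mul_assoc, ← mul_assoc A, le_inv_mul_iff₀ hρ]
            exact (mul_le_mul_of_nonneg_right hp1.le (norm_nonneg _)).trans (hK.size p h0)
        · rw [indicator_of_notMem hp]
          exact zero_le
    _ ≤ _ := by
        rw [lintegral_mul_gaussMaj (F := fun t => ENNReal.ofReal (ρ⁻¹ * A * t ^ (-1 / 2 : ℝ)))
          (by fun_prop) measurableSet_Ioc (fun t ht => ht.1)]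
        gcongr
        exact lintegral_rpow_neg_half hρ hK.nonneg

/-- The majorant of the directional derivatives along vectors in the parabolic box of size `ρ`. -/
def derivMaj (n : ℕ) (A ρ : ℝ) (p : Rn1 n) : ℝ :=
  A * (ρ * p.2 ^ (-3 / 2 : ℝ) + ρ ^ 2 * p.2 ^ (-2 : ℝ)) * gaussMaj p

lemma measurable_derivMaj {ρ : ℝ} : Measurable (derivMaj n A ρ) := by
  have := measurable_gaussMaj (n := n)
  unfold derivMaj
  fun_prop

lemma enorm_sub_le_lintegral (hK : ParaKernelBound K A) {ρ : ℝ} {h z : Rn1 n}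
    (h1 : ‖h.1‖ ≤ ρ) (h2 : |h.2| ≤ ρ ^ 2) (hz : ρ ^ 2 < z.2) :
    ‖K (z - h) - K z‖ₑ ≤ ∫⁻ θ in Ioc (0 : ℝ) 1, ENNReal.ofReal (derivMaj n A ρ (z - θ • h)) := by
  have hρ : 0 ≤ ρ := (norm_nonneg _).trans h1
  have hpos : ∀ θ ∈ Icc (0 : ℝ) 1, 0 < (z - θ • h).2 := fun θ hθ => by
    have h3 : θ * h.2 ≤ ρ ^ 2 := by
      calc θ * h.2 ≤ |θ * h.2| := le_abs_self _
        _ = θ * |h.2| := by rw [abs_mul, abs_of_nonneg hθ.1]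
        _ ≤ 1 * |h.2| := by gcongr; exact hθ.2
        _ ≤ ρ ^ 2 := by linarith
    simp only [Prod.snd_sub, Prod.smul_snd, smul_eq_mul]
    linarith
  have hder : ∀ θ ∈ Icc (0 : ℝ) 1, ∃ d : ℂ, HasDerivAt (fun θ : ℝ => K (z - θ • h)) d θ ∧
      ‖d‖ ≤ derivMaj n A ρ (z - θ • h) := fun θ hθ => by
    obtain ⟨d, hd, hb⟩ := hK.smooth (z - θ • h) (hpos θ hθ) (-h)
    refine ⟨d, ?_, hb.trans ?_⟩
    · have h3 : HasDerivAt (fun s : ℝ => K (z - θ • h + s • -h)) d (θ - θ) := by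
        rw [sub_self]; exact hd
      refine (h3.comp_sub_const θ θ).congr_of_eventuallyEq (.of_forall fun s => ?_)
      simp only
      congr 1
      module
    · have := hpos θ hθ
      have := gaussMaj_nonneg (hpos θ hθ)
      have := hK.nonneg
      rw [derivMaj]
      simp only [Prod.fst_neg, Prod.snd_neg, norm_neg, abs_neg]
      gcongr
  have hcont : ContinuousOn (fun θ : ℝ => derivMaj n A ρ (z - θ • h)) (Icc 0 1) := by
    unfold derivMaj gaussMaj
    have hc : ContinuousOn (fun θ : ℝ => (z - θ • h).2) (Icc 0 1) := by fun_prop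
    have hr (σ : ℝ) : ContinuousOn (fun θ : ℝ => (z - θ • h).2 ^ σ) (Icc 0 1) :=
      hc.rpow_const fun θ hθ => Or.inl (hpos θ hθ).ne'
    refine ((((hr _).const_smul ρ).add ((hr _).const_smul (ρ ^ 2))).const_smul A).mul
      ((hr _).mul (Real.continuous_exp.comp_continuousOn (ContinuousOn.div (by fun_prop)
        (by fun_prop) fun θ hθ => ?_)))
    have := hpos θ hθ
    positivity
  have hInt : IntervalIntegrable (fun θ : ℝ => derivMaj n A ρ (z - θ • h)) volume 0 1 :=
    ContinuousOn.intervalIntegrable_of_Icc zero_le_one hcont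
  have hmain := norm_sub_le_integral_of_norm_deriv_le_of_le (f := fun θ : ℝ => K (z - θ • h))
    zero_le_one
    (fun θ hθ => (hder θ hθ).choose_spec.1.continuousAt.continuousWithinAt)
    (fun θ hθ => (hder θ ⟨hθ.1.le, hθ.2.le⟩).choose_spec.1.differentiableAt.differentiableWithinAt)
    (.of_forall fun θ hθ => by
      obtain ⟨d, hd, hb⟩ := hder θ ⟨hθ.1.le, hθ.2.le⟩
      rw [hd.deriv]
      exact hb) hInt
  simp only [one_smul, zero_smul, sub_zero] at hmain
  rw [← ofReal_norm]
  refine (ENNReal.ofReal_le_ofReal hmain).trans ?_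
  rw [intervalIntegral.integral_of_le zero_le_one, ofReal_integral_eq_lintegral_ofReal hInt.1]
  filter_upwards [ae_restrict_mem measurableSet_Ioc] with θ hθ
  obtain ⟨d, -, hb⟩ := hder θ ⟨hθ.1.le, hθ.2⟩
  exact (norm_nonneg _).trans hb

lemma lintegral_derivMaj (hA : 0 ≤ A) {ρ : ℝ} (hρ : 0 < ρ) :
    ∫⁻ p in {p : Rn1 n | 3 * ρ ^ 2 < p.2}, ENNReal.ofReal (derivMaj n A ρ p) ≤
      ENNReal.ofReal ((4 * π) ^ n) * ENNReal.ofReal (3 * A) := by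
  have h0 : ∀ p : Rn1 n, p ∈ {p : Rn1 n | 3 * ρ ^ 2 < p.2} → ENNReal.ofReal (derivMaj n A ρ p) =
      ENNReal.ofReal (A * (ρ * p.2 ^ (-3 / 2 : ℝ) + ρ ^ 2 * p.2 ^ (-2 : ℝ))) *
        ENNReal.ofReal (gaussMaj p) := fun p hp => by
    have : 0 < p.2 := lt_trans (by positivity) hp
    rw [derivMaj, ENNReal.ofReal_mul (by positivity)]
  rw [setLIntegral_congr_fun (measurableSet_lt measurable_const measurable_snd) h0]
  refine (lintegral_mul_gaussMaj (F := fun t => ENNReal.ofReal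
    (A * (ρ * t ^ (-3 / 2 : ℝ) + ρ ^ 2 * t ^ (-2 : ℝ)))) (S := Ioi (3 * ρ ^ 2)) (by fun_prop)
    measurableSet_Ioi (fun t ht => lt_trans (by positivity : 0 < 3 * ρ ^ 2) ht)).le.trans ?_
  gcongr
  exact lintegral_rpow_neg_tail hρ hA

lemma setLIntegral_comp_sub_le {F : Rn1 n → ℝ≥0∞} {S T : Set (Rn1 n)} (hS : MeasurableSet S)
    (hT : MeasurableSet T) (h : Rn1 n) (hST : ∀ z ∈ S, z - h ∈ T) :
    ∫⁻ z in S, F (z - h) ≤ ∫⁻ z in T, F z := by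
  rw [← lintegral_indicator hS, ← lintegral_indicator hT,
    ← lintegral_sub_right_eq_self (T.indicator F) h]
  refine lintegral_mono fun z => ?_
  by_cases hz : z ∈ S
  · rw [indicator_of_mem hz, indicator_of_mem (hST z hz)]
  · rw [indicator_of_notMem hz]
    exact zero_le

lemma lintegral_tail (hK : ParaKernelBound K A) {ρ : ℝ} (hρ : 0 < ρ) {h : Rn1 n}
    (h1 : ‖h.1‖ ≤ ρ) (h2 : |h.2| ≤ ρ ^ 2) :
    ∫⁻ z in {z : Rn1 n | 4 * ρ ^ 2 < z.2}, ‖K (z - h) - K z‖ₑ ≤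
      ENNReal.ofReal ((4 * π) ^ n) * ENNReal.ofReal (3 * A) := by
  have hR : MeasurableSet {z : Rn1 n | 4 * ρ ^ 2 < z.2} :=
    measurableSet_lt measurable_const measurable_snd
  have hR' : MeasurableSet {z : Rn1 n | 3 * ρ ^ 2 < z.2} :=
    measurableSet_lt measurable_const measurable_snd
  calc ∫⁻ z in {z : Rn1 n | 4 * ρ ^ 2 < z.2}, ‖K (z - h) - K z‖ₑ
      ≤ ∫⁻ z in {z : Rn1 n | 4 * ρ ^ 2 < z.2}, ∫⁻ θ in Ioc (0 : ℝ) 1,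
        ENNReal.ofReal (derivMaj n A ρ (z - θ • h)) := by
        refine setLIntegral_mono' hR fun z hz => hK.enorm_sub_le_lintegral h1 h2 ?_
        have : 4 * ρ ^ 2 < z.2 := hz
        nlinarith [sq_nonneg ρ]
    _ = ∫⁻ θ in Ioc (0 : ℝ) 1, ∫⁻ z in {z : Rn1 n | 4 * ρ ^ 2 < z.2},
        ENNReal.ofReal (derivMaj n A ρ (z - θ • h)) := by
        refine lintegral_lintegral_swap (Measurable.aemeasurable ?_)
        refine (measurable_derivMaj.comp ?_).ennreal_ofReal
        exact (by fun_prop : Continuous fun q : Rn1 n × ℝ => q.1 - q.2 • h).measurable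
    _ ≤ ∫⁻ θ in Ioc (0 : ℝ) 1, ENNReal.ofReal ((4 * π) ^ n) * ENNReal.ofReal (3 * A) := by
        refine setLIntegral_mono' measurableSet_Ioc fun θ hθ => ?_
        refine (setLIntegral_comp_sub_le
          (F := fun z => ENNReal.ofReal (derivMaj n A ρ z)) hR hR' (θ • h) fun z hz => ?_).trans
          (lintegral_derivMaj hK.nonneg hρ)
        have h3 : θ * h.2 ≤ ρ ^ 2 := by
          calc θ * h.2 ≤ |θ * h.2| := le_abs_self _
            _ = θ * |h.2| := by rw [abs_mul, abs_of_nonneg hθ.1.le]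
            _ ≤ 1 * |h.2| := by gcongr; exact hθ.2
            _ ≤ ρ ^ 2 := by linarith
        have : 4 * ρ ^ 2 < z.2 := hz
        simp only [Set.mem_ofPred_eq, Prod.snd_sub, Prod.smul_snd, smul_eq_mul]
        linarith
    _ = _ := by simp

lemma lintegral_near (hK : ParaKernelBound K A) {ρ : ℝ} (hρ : 0 < ρ) {h : Rn1 n}
    (h1 : ‖h.1‖ ≤ ρ) (h2 : |h.2| ≤ ρ ^ 2) :
    ∫⁻ z in {z : Rn1 n | 2 * ρ < ‖z.1‖ ∧ z.2 ≤ 4 * ρ ^ 2}, ‖K (z - h)‖ₑ ≤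
      ENNReal.ofReal ((4 * π) ^ n) * ENNReal.ofReal (5 * A) := by
  refine (setLIntegral_comp_sub_le (F := fun z => ‖K z‖ₑ) ?_ ?_ h fun z hz => ?_).trans
    (hK.lintegral_size hρ)
  · exact (measurableSet_lt measurable_const measurable_fst.norm).inter
      (measurableSet_le measurable_snd measurable_const)
  · exact (measurableSet_lt measurable_const measurable_fst.norm).inter
      (measurableSet_le measurable_snd measurable_const)
  · obtain ⟨hz1, hz2⟩ := hz
    have h3 := norm_sub_norm_le z.1 h.1
    have h4 := abs_le.1 h2
    exact ⟨by simp only [Prod.fst_sub]; linarith, by simp only [Prod.snd_sub]; linarith⟩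

/-- The Hörmander constant of a kernel with parabolic bounds. -/
def hormanderConst (n : ℕ) (A : ℝ) : ℝ≥0 := Real.toNNReal ((4 * π) ^ n * (13 * A))

lemma lintegral_compl_paraBox (hK : ParaKernelBound K A) {ρ : ℝ} (hρ : 0 < ρ) {h : Rn1 n}
    (h1 : ‖h.1‖ ≤ ρ) (h2 : |h.2| ≤ ρ ^ 2) :
    ∫⁻ z in (paraBox 0 (2 * ρ))ᶜ, ‖K (z - h) - K z‖ₑ ≤ hormanderConst n A := by
  set R1 := {z : Rn1 n | 2 * ρ < ‖z.1‖ ∧ z.2 ≤ 4 * ρ ^ 2} with hR1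
  set R2 := {z : Rn1 n | 4 * ρ ^ 2 < z.2} with hR2
  set R3 := {z : Rn1 n | z.2 < -(4 * ρ ^ 2)} with hR3
  have hsub : (paraBox 0 (2 * ρ))ᶜ ⊆ R1 ∪ R2 ∪ R3 := by
    intro z hz
    rw [paraBox, mem_compl_iff, mem_prod, Metric.mem_closedBall, Metric.mem_closedBall,
      dist_eq_norm, Real.dist_eq, not_and_or, not_le, not_le] at hz
    simp only [Prod.fst_zero, Prod.snd_zero, sub_zero] at hz
    by_cases h4 : 4 * ρ ^ 2 < z.2
    · exact Or.inl (Or.inr h4)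
    rcases hz with hz | hz
    · exact Or.inl (Or.inl ⟨hz, not_lt.1 h4⟩)
    · rcases lt_abs.1 hz with h5 | h5
      · exact absurd (by linarith) h4
      · exact Or.inr (by change z.2 < _; linarith)
  have h0 : ∫⁻ z in R3, ‖K (z - h) - K z‖ₑ = 0 := by
    rw [setLIntegral_congr_fun (g := fun _ => 0) (measurableSet_lt measurable_snd measurable_const)]
    · simp
    · intro z hz
      have hz' : z.2 < -(4 * ρ ^ 2) := hz
      have h4 := abs_le.1 h2
      have := sq_nonneg ρ
      simp only
      rw [hK.zero z (by linarith), hK.zero (z - h) (by simp only [Prod.snd_sub]; linarith)]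
      simp
  have hnear : ∫⁻ z in R1, ‖K (z - h) - K z‖ₑ ≤
      ENNReal.ofReal ((4 * π) ^ n) * ENNReal.ofReal (5 * A) +
      ENNReal.ofReal ((4 * π) ^ n) * ENNReal.ofReal (5 * A) := by
    have h5 := hK.lintegral_near hρ (h := 0) (by simpa using hρ.le) (by simpa using sq_nonneg ρ)
    simp only [sub_zero] at h5
    refine le_trans ?_ (add_le_add (hK.lintegral_near hρ h1 h2) h5)
    rw [← lintegral_add_right _ hK.measurable.enorm]
    exact lintegral_mono fun z => enorm_sub_le
  calc _ ≤ ∫⁻ z in R1 ∪ R2 ∪ R3, ‖K (z - h) - K z‖ₑ := lintegral_mono_set hsub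
    _ ≤ (∫⁻ z in R1, ‖K (z - h) - K z‖ₑ) + (∫⁻ z in R2, ‖K (z - h) - K z‖ₑ) +
        ∫⁻ z in R3, ‖K (z - h) - K z‖ₑ :=
      (lintegral_union_le _ _ _).trans (add_le_add_left (lintegral_union_le _ _ _) _)
    _ ≤ _ := by
      rw [h0, add_zero]
      refine (add_le_add hnear (hK.lintegral_tail hρ h1 h2)).trans_eq ?_
      have := hK.nonneg
      rw [hormanderConst, ← ENNReal.ofReal, ← ENNReal.ofReal_mul (by positivity),
        ← ENNReal.ofReal_mul (by positivity), ← ENNReal.ofReal_add (by positivity) (by positivity),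
        ← ENNReal.ofReal_add (by positivity) (by positivity)]
      congr 1
      ring

lemma hormander (hK : ParaKernelBound K A) (k : ℤ) (x : Rn1 n) {y : Rn1 n}
    (hy : y ∈ (paraSystem n).Q k x) :
    ∫⁻ z in ((paraSystem n).star k x)ᶜ, ‖K (z - y) - K (z - x)‖ₑ ≤ hormanderConst n A := by
  have hy' := paraCube_subset_paraBox k x hy
  rw [paraBox, mem_prod, Metric.mem_closedBall, Metric.mem_closedBall, dist_eq_norm,
    Real.dist_eq] at hy'
  refine le_trans ?_ (hK.lintegral_compl_paraBox (h := y - x) (paraRadius_pos n k) hy'.1 hy'.2)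
  change ∫⁻ z in (paraBox x (2 * paraRadius n k))ᶜ, _ ≤ _
  refine le_trans (le_of_eq ?_) (setLIntegral_comp_sub_le
    (F := fun z => ‖K (z - (y - x)) - K z‖ₑ)
    (measurableSet_paraBox x (2 * paraRadius n k)).compl
    (measurableSet_paraBox ..).compl x fun z hz => ?_)
  · simp only [sub_sub, add_sub_cancel]
  · simpa [paraBox, Metric.mem_closedBall, dist_eq_norm] using hz

end ParaKernelBound

end ParabolicHormander

section BesselKernel

variable {n : ℕ}

/-- The profile `s^(δ - 3/2 - n/2) e^{-s} X_k exp(-|X|²/(4s))`. -/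
def besselProfile (δ : ℝ) (k : Fin n) (X : Rn n) (s : ℝ) : ℝ :=
  s ^ (δ - 3 / 2 - n / 2) * Real.exp (-s) * X k * Real.exp (-(‖X‖ ^ 2) / (4 * s))

/-- The normalising constant of the kernel. -/
def besselConst (n : ℕ) (δ : ℝ) : ℂ :=
  ((4 * π) ^ (-(n : ℝ) / 2) / (2 * Real.Gamma (1 / 2 + δ)) : ℝ) * Complex.I

/-- The kernel whose Fourier transform is `ξ_k (1 + 4π²|ξ|² + iτ)^{-1/2-δ}`. -/
def besselKernel (δ : ℝ) (k : Fin n) (p : Rn1 n) : ℂ :=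
  if 0 < p.2 then besselConst n δ * (besselProfile δ k p.1 (2 * π * p.2) : ℝ) else 0

lemma one_le_Gamma {a : ℝ} (ha : 0 < a) (ha1 : a ≤ 1) : 1 ≤ Real.Gamma a := by
  rcases ha1.eq_or_lt with rfl | h
  · simp
  · have h1 := Real.convexOn_Gamma.le_left_of_right_le'' (x := a) (y := 1) (z := 2) ha
      (show (0 : ℝ) < 2 by norm_num) h.le (by norm_num) (by simp)
    simpa using h1

lemma norm_besselConst_le {δ : ℝ} (h0 : 0 ≤ δ) (h1 : δ ≤ 1 / 2) : ‖besselConst n δ‖ ≤ 1 := by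
  have h2 := one_le_Gamma (a := 1 / 2 + δ) (by linarith) (by linarith)
  have h3 : (4 * π) ^ (-(n : ℝ) / 2) ≤ 1 := by
    refine Real.rpow_le_one_of_one_le_of_nonpos (by linarith [Real.pi_gt_three]) ?_
    have : (0 : ℝ) ≤ n := n.cast_nonneg
    linarith
  rw [besselConst, norm_mul, Complex.norm_I, mul_one, Complex.norm_real, Real.norm_of_nonneg
    (by positivity), div_le_one (by positivity)]
  linarith

lemma rpow_mul_exp_neg_le_one {s δ : ℝ} (hs : 0 < s) (h0 : 0 ≤ δ) (h1 : δ ≤ 1) :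
    s ^ δ * Real.exp (-s) ≤ 1 := by
  rw [Real.exp_neg, ← div_eq_mul_inv, div_le_one (Real.exp_pos s)]
  have h2 : s ^ δ ≤ 1 + s := by
    rcases le_total s 1 with h | h
    · linarith [Real.rpow_le_one hs.le h h0]
    · have := Real.rpow_le_rpow_of_exponent_le h h1
      rw [Real.rpow_one] at this
      linarith
  linarith [Real.add_one_le_exp s]

lemma rpow_mul_exp_neg_mul_self_le {s δ : ℝ} (hs : 0 < s) (h0 : 0 ≤ δ) (h1 : δ ≤ 1) :
    s ^ δ * Real.exp (-s) * s ≤ 2 := by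
  rw [Real.exp_neg, mul_right_comm, ← div_eq_mul_inv, div_le_iff₀ (Real.exp_pos s)]
  have h2 : s ^ δ * s ≤ 1 + s ^ 2 := by
    rcases le_total s 1 with h | h
    · have := Real.rpow_le_one hs.le h h0
      nlinarith
    · have := Real.rpow_le_rpow_of_exponent_le h h1
      rw [Real.rpow_one] at this
      nlinarith
  have := Real.quadratic_le_exp_of_nonneg hs.le
  nlinarith

lemma one_add_pow_four_mul_exp_le (q : ℝ) :
    (1 + q ^ 4) * Real.exp (-(q ^ 2) / 4) ≤ 129 * Real.exp (-(q ^ 2) / 8) := by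
  have h1 : Real.exp (-(q ^ 2) / 4) = Real.exp (-(q ^ 2) / 8) * Real.exp (-(q ^ 2) / 8) := by
    rw [← Real.exp_add]; ring_nf
  have h2 : (1 + q ^ 4) * Real.exp (-(q ^ 2) / 8) ≤ 129 := by
    rw [show -(q ^ 2) / 8 = -(q ^ 2 / 8) by ring, Real.exp_neg, ← div_eq_mul_inv,
      div_le_iff₀ (Real.exp_pos _)]
    have := Real.quadratic_le_exp_of_nonneg (show 0 ≤ q ^ 2 / 8 by positivity)
    nlinarith [sq_nonneg q]
  rw [h1, ← mul_assoc]
  gcongr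

/-- Weighted Gaussians are controlled by a wider Gaussian. -/
lemma mul_exp_le_gaussMaj {X : Rn n} {t Q : ℝ} (ht : 0 < t)
    (hQ : Q ≤ 1 + (‖X‖ / √(2 * π * t)) ^ 4) :
    Q * ((2 * π * t) ^ (-(n : ℝ) / 2) * Real.exp (-(‖X‖ ^ 2) / (4 * (2 * π * t)))) ≤
      129 * gaussMaj (X, t) := by
  set s := 2 * π * t with hs
  have hs0 : 0 < s := by positivity
  have hst : t ≤ s := by rw [hs]; nlinarith [Real.pi_gt_three]
  have e1 : -(‖X‖ ^ 2) / (4 * s) = -((‖X‖ / √s) ^ 2) / 4 := by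
    rw [div_pow, Real.sq_sqrt hs0.le]; field_simp
  have e2 : -(‖X‖ ^ 2) / (16 * π * t) = -((‖X‖ / √s) ^ 2) / 8 := by
    rw [div_pow, Real.sq_sqrt hs0.le, hs]; field_simp; ring
  rw [gaussMaj, e1]
  simp only
  rw [e2]
  have h1 := one_add_pow_four_mul_exp_le (‖X‖ / √s)
  have h2 : s ^ (-(n : ℝ) / 2) ≤ t ^ (-(n : ℝ) / 2) :=
    Real.rpow_le_rpow_of_nonpos ht hst (by have : (0 : ℝ) ≤ n := n.cast_nonneg
                                           linarith)
  calc _ = s ^ (-(n : ℝ) / 2) * (Q * Real.exp (-((‖X‖ / √s) ^ 2) / 4)) := by ring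
    _ ≤ t ^ (-(n : ℝ) / 2) * (129 * Real.exp (-((‖X‖ / √s) ^ 2) / 8)) := by
      refine (mul_le_mul_of_nonneg_left ?_ (by positivity)).trans
        (mul_le_mul_of_nonneg_right h2 (by positivity))
      exact (mul_le_mul_of_nonneg_right hQ (Real.exp_pos _).le).trans h1
    _ = _ := by ring

lemma hasDerivAt_besselProfile {δ : ℝ} {k : Fin n} {X Y : Rn n} {s η : ℝ} (hs : 0 < s) :
    HasDerivAt (fun θ : ℝ => besselProfile δ k (X + θ • Y) (s + θ * η))
      (s ^ (δ - 3 / 2 - n / 2) * Real.exp (-s) * Real.exp (-(‖X‖ ^ 2) / (4 * s)) *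
        ((δ - 3 / 2 - n / 2) * η / s * X k - η * X k + Y k
          - X k * (inner ℝ X Y) / (2 * s) + X k * ‖X‖ ^ 2 * η / (4 * s ^ 2))) 0 := by
  have h1 : HasDerivAt (fun θ : ℝ => s + θ * η) η 0 := by
    simpa using ((hasDerivAt_id (0 : ℝ)).mul_const η).const_add s
  have h2 : HasDerivAt (fun θ : ℝ => X + θ • Y) Y 0 := by
    simpa using ((hasDerivAt_id (0 : ℝ)).smul_const Y).const_add X
  have h3 : HasDerivAt (fun θ : ℝ => ‖X + θ • Y‖ ^ 2) (2 * inner ℝ X Y) 0 := by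
    simpa using h2.norm_sq
  have h4 : HasDerivAt (fun θ : ℝ => (X + θ • Y) k) (Y k) 0 := by
    simpa using ((hasDerivAt_id (0 : ℝ)).mul_const (Y k)).const_add (X k)
  have h5 := ((h1.rpow_const (p := δ - 3 / 2 - n / 2) (Or.inl (by simpa using hs.ne'))).mul
    h1.neg.exp).mul h4
  have h6 := (h3.neg.div (h1.const_mul 4) (by simpa using hs.ne')).exp
  refine (h5.mul h6).congr_deriv ?_
  simp only [zero_mul, add_zero, zero_smul, Real.rpow_sub_one hs.ne']
  simp
  field_simp
  ring

lemma abs_bracket_le {σ η q r x y N i D : ℝ} (hq : 0 ≤ q) (hr : 0 < r) (hx : |x| ≤ q * r)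
    (hy : |y| ≤ N) (hi : |i| ≤ q * r * N) (hD : 0 ≤ D) (hD1 : D ≤ 1) (hD2 : D * r ^ 2 ≤ 2) :
    D * |σ * η / r ^ 2 * x - η * x + y - x * i / (2 * r ^ 2)
        + x * (q * r) ^ 2 * η / (4 * (r ^ 2) ^ 2)| ≤
      (1 + q ^ 4) * ((|σ| + 3) * |η| / r + 2 * N) := by
  have hN : 0 ≤ N := (abs_nonneg y).trans hy
  have q1 : q ≤ 1 + q ^ 4 := by nlinarith [sq_nonneg (q ^ 2 - 1), sq_nonneg (q - 1), sq_nonneg q]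
  have q2 : q ^ 2 ≤ 1 + q ^ 4 := by nlinarith [sq_nonneg (q ^ 2 - 1)]
  have q3 : q ^ 3 ≤ 1 + q ^ 4 := by nlinarith [sq_nonneg (q ^ 2 - 1), sq_nonneg (q ^ 2 - q)]
  have a1 : |σ * η / r ^ 2 * x| ≤ |σ| * |η| / r * q := by
    rw [abs_mul, abs_div, abs_mul, abs_of_pos (pow_pos hr 2)]
    calc _ ≤ |σ| * |η| / r ^ 2 * (q * r) := by gcongr
      _ = _ := by field_simp
  have a2 : D * |η * x| ≤ 2 * (|η| / r) * q := by
    rw [abs_mul]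
    calc D * (|η| * |x|) ≤ D * (|η| * (q * r)) := by gcongr
      _ = D * r ^ 2 * (|η| / r * q) := by field_simp
      _ ≤ 2 * (|η| / r * q) := by gcongr
      _ = _ := by ring
  have a4 : |x * i / (2 * r ^ 2)| ≤ N * q ^ 2 / 2 := by
    rw [abs_div, abs_mul, abs_of_pos (by positivity : 0 < 2 * r ^ 2)]
    calc _ ≤ (q * r) * (q * r * N) / (2 * r ^ 2) := by gcongr
      _ = _ := by field_simp
  have a5 : |x * (q * r) ^ 2 * η / (4 * (r ^ 2) ^ 2)| ≤ |η| / r * q ^ 3 / 4 := by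
    rw [abs_div, abs_mul, abs_mul, abs_of_pos (by positivity : 0 < 4 * (r ^ 2) ^ 2),
      abs_of_nonneg (by positivity : 0 ≤ (q * r) ^ 2)]
    calc _ ≤ (q * r) * (q * r) ^ 2 * |η| / (4 * (r ^ 2) ^ 2) := by gcongr
      _ = _ := by field_simp
  have key : |σ * η / r ^ 2 * x - η * x + y - x * i / (2 * r ^ 2)
        + x * (q * r) ^ 2 * η / (4 * (r ^ 2) ^ 2)| ≤ |σ * η / r ^ 2 * x| + |η * x| + |y| +
        |x * i / (2 * r ^ 2)| + |x * (q * r) ^ 2 * η / (4 * (r ^ 2) ^ 2)| := by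
    refine (abs_add_le _ _).trans (add_le_add_left ?_ _)
    refine (abs_sub _ _).trans (add_le_add_left ?_ _)
    refine (abs_add_le _ _).trans (add_le_add_left ?_ _)
    exact abs_sub _ _
  have hηr : 0 ≤ |η| / r := by positivity
  calc _ ≤ D * (|σ * η / r ^ 2 * x| + |η * x| + |y| +
        |x * i / (2 * r ^ 2)| + |x * (q * r) ^ 2 * η / (4 * (r ^ 2) ^ 2)|) := by gcongr
    _ = D * |σ * η / r ^ 2 * x| + D * |η * x| + D * |y| +
        D * |x * i / (2 * r ^ 2)| + D * |x * (q * r) ^ 2 * η / (4 * (r ^ 2) ^ 2)| := by ring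
    _ ≤ 1 * (|σ| * |η| / r * q) + 2 * (|η| / r) * q + 1 * N + 1 * (N * q ^ 2 / 2)
        + 1 * (|η| / r * q ^ 3 / 4) := by gcongr
    _ = |σ| * (|η| / r) * q + (2 * (|η| / r)) * q + N + N / 2 * q ^ 2 + (|η| / r) / 4 * q ^ 3 := by
      ring
    _ ≤ |σ| * (|η| / r) * (1 + q ^ 4) + (2 * (|η| / r)) * (1 + q ^ 4) + N * (1 + q ^ 4)
        + N / 2 * (1 + q ^ 4) + (|η| / r) / 4 * (1 + q ^ 4) := by
      gcongr
      nlinarith [pow_nonneg hq 4]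
    _ ≤ _ := by
      have h1 : 0 ≤ (1 + q ^ 4) * (|η| / r) := by positivity
      have h2 : 0 ≤ (1 + q ^ 4) * N := by positivity
      rw [mul_div_assoc]
      nlinarith

lemma rpow_split {δ s : ℝ} (hs : 0 < s) : s ^ (δ - 3 / 2 - n / 2) =
    s ^ δ * s ^ (-3 / 2 : ℝ) * s ^ (-(n : ℝ) / 2) := by
  rw [← Real.rpow_add hs, ← Real.rpow_add hs]; ring_nf

lemma norm_besselKernel_le {δ : ℝ} (h0 : 0 ≤ δ) (h1 : δ ≤ 1 / 2) (k : Fin n) {p : Rn1 n}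
    (hp : 0 < p.2) : ‖besselKernel δ k p‖ ≤ |besselProfile δ k p.1 (2 * π * p.2)| := by
  rw [besselKernel, if_pos hp, norm_mul, Complex.norm_real, Real.norm_eq_abs]
  exact mul_le_of_le_one_left (abs_nonneg _) (norm_besselConst_le h0 h1)

lemma abs_besselProfile {δ : ℝ} {k : Fin n} {X : Rn n} {s : ℝ} (hs : 0 < s) :
    |besselProfile δ k X s| = s ^ δ * Real.exp (-s) * s ^ (-3 / 2 : ℝ) * |X k| *
      (s ^ (-(n : ℝ) / 2) * Real.exp (-(‖X‖ ^ 2) / (4 * s))) := by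
  rw [besselProfile, abs_mul, abs_mul, abs_mul, abs_of_pos (Real.rpow_pos_of_pos hs _),
    Real.abs_exp, Real.abs_exp, rpow_split hs]
  ring

lemma size_besselKernel {δ : ℝ} (h0 : 0 ≤ δ) (h1 : δ ≤ 1 / 2) (k : Fin n) {p : Rn1 n}
    (hp : 0 < p.2) :
    ‖p.1‖ * ‖besselKernel δ k p‖ ≤ 129 * p.2 ^ (-1 / 2 : ℝ) * gaussMaj p := by
  obtain ⟨X, t⟩ := p
  simp only at hp ⊢
  have hs : 0 < 2 * π * t := by positivity
  have hX : |X k| ≤ ‖X‖ := PiLp.norm_apply_le X k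
  have hQ : (‖X‖ / √(2 * π * t)) ^ 2 ≤ 1 + (‖X‖ / √(2 * π * t)) ^ 4 := by
    nlinarith [sq_nonneg ((‖X‖ / √(2 * π * t)) ^ 2 - 1)]
  have hG := mul_exp_le_gaussMaj hp hQ
  rw [div_pow, Real.sq_sqrt hs.le] at hG
  have hle := rpow_mul_exp_neg_le_one hs h0 (by linarith)
  have hst : t ≤ 2 * π * t := by nlinarith [Real.pi_gt_three]
  refine (mul_le_mul_of_nonneg_left (norm_besselKernel_le h0 h1 k hp) (norm_nonneg _)).trans ?_
  simp only
  rw [abs_besselProfile hs]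
  generalize 2 * π * t = s at *
  have e : s ^ (-3 / 2 : ℝ) = s ^ (-1 / 2 : ℝ) / s := by
    rw [← Real.rpow_sub_one hs.ne']; norm_num
  have ht : s ^ (-1 / 2 : ℝ) ≤ t ^ (-1 / 2 : ℝ) :=
    Real.rpow_le_rpow_of_nonpos hp hst (by norm_num)
  have hGn := gaussMaj_nonneg (p := (X, t)) hp
  calc _ ≤ ‖X‖ * (1 * s ^ (-3 / 2 : ℝ) * ‖X‖ *
        (s ^ (-(n : ℝ) / 2) * Real.exp (-(‖X‖ ^ 2) / (4 * s)))) := by gcongr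
    _ = s ^ (-1 / 2 : ℝ) * (‖X‖ ^ 2 / s *
        (s ^ (-(n : ℝ) / 2) * Real.exp (-(‖X‖ ^ 2) / (4 * s)))) := by rw [e]; ring
    _ ≤ t ^ (-1 / 2 : ℝ) * (129 * gaussMaj (X, t)) := by gcongr
    _ = _ := by ring

/-- The constant in the kernel bounds for `besselKernel`. -/
def besselBound (n : ℕ) : ℝ := 129 * (2 * π * (n / 2 + 5))

lemma smooth_besselKernel {δ : ℝ} (h0 : 0 ≤ δ) (h1 : δ ≤ 1 / 2) (k : Fin n) {p : Rn1 n}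
    (hp : 0 < p.2) (h : Rn1 n) : ∃ d : ℂ, HasLineDerivAt ℝ (besselKernel δ k) d p h ∧
    ‖d‖ ≤ besselBound n * (‖h.1‖ * p.2 ^ (-3 / 2 : ℝ) + |h.2| * p.2 ^ (-2 : ℝ)) * gaussMaj p := by
  obtain ⟨X, t⟩ := p
  obtain ⟨Y, τ⟩ := h
  simp only at hp ⊢
  have hs : 0 < 2 * π * t := by positivity
  refine ⟨_, HasDerivAt.congr_of_eventuallyEq (((hasDerivAt_besselProfile (δ := δ) (k := k) (X := X)
    (Y := Y) (η := 2 * π * τ) hs).ofReal_comp).const_mul (besselConst n δ)) ?_, ?_⟩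
  · have hc : ContinuousAt (fun θ : ℝ => t + θ * τ) 0 := by fun_prop
    have hc' := hc.eventually (lt_mem_nhds (show 0 < t + 0 * τ by simpa using hp))
    filter_upwards [hc'] with θ hθ
    simp only [besselKernel, Prod.snd_add, Prod.smul_snd, smul_eq_mul, hθ, if_true, Prod.fst_add,
      Prod.smul_fst]
    ring_nf
  · rw [norm_mul, Complex.norm_real, Real.norm_eq_abs]
    refine (mul_le_of_le_one_left (abs_nonneg _) (norm_besselConst_le h0 h1)).trans ?_
    have hX : |X k| ≤ ‖X‖ := PiLp.norm_apply_le X k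
    have hY : |Y k| ≤ ‖Y‖ := PiLp.norm_apply_le Y k
    have hXY : |inner ℝ X Y| ≤ ‖X‖ * ‖Y‖ := abs_real_inner_le_norm X Y
    have hG := mul_exp_le_gaussMaj (X := X) hp le_rfl
    have hGn := gaussMaj_nonneg (p := (X, t)) hp
    have hst : t ≤ 2 * π * t := by nlinarith [Real.pi_gt_three]
    have hη : |2 * π * τ| = 2 * π * |τ| := by
      rw [abs_mul, abs_of_pos (by positivity : 0 < 2 * π)]
    have hσ : |δ - 3 / 2 - n / 2| ≤ n / 2 + 2 := by
      have : (0 : ℝ) ≤ n := n.cast_nonneg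
      rw [abs_le]; constructor <;> linarith
    have hD1 := rpow_mul_exp_neg_le_one hs h0 (by linarith)
    have hD2 := rpow_mul_exp_neg_mul_self_le hs h0 (by linarith)
    generalize 2 * π * t = s at *
    have hr : 0 < √s := Real.sqrt_pos.2 hs
    have hr2 : √s ^ 2 = s := Real.sq_sqrt hs.le
    have hq : ‖X‖ / √s * √s = ‖X‖ := by field_simp
    have hb := abs_bracket_le (σ := δ - 3 / 2 - n / 2) (η := 2 * π * τ) (q := ‖X‖ / √s) (r := √s)
      (x := X k) (y := Y k) (N := ‖Y‖) (i := inner ℝ X Y) (D := s ^ δ * Real.exp (-s))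
      (by positivity) hr (by rwa [hq]) hY (by rwa [hq]) (by positivity) hD1 (by rwa [hr2])
    rw [hq, hr2, hη] at hb
    have t1 : s ^ (-3 / 2 : ℝ) ≤ t ^ (-3 / 2 : ℝ) :=
      Real.rpow_le_rpow_of_nonpos hp hst (by norm_num)
    have t2 : s ^ (-3 / 2 : ℝ) / √s ≤ t ^ (-2 : ℝ) := by
      rw [Real.sqrt_eq_rpow, ← Real.rpow_sub hs]
      norm_num
      have := Real.rpow_le_rpow_of_nonpos hp hst (show (-2 : ℝ) ≤ 0 by norm_num)
      norm_num at this
      exact this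
    rw [abs_mul, rpow_split hs, abs_of_nonneg (by positivity)]
    have hπ := Real.pi_gt_three
    calc _ = s ^ (-3 / 2 : ℝ) * (s ^ (-(n : ℝ) / 2) * Real.exp (-(‖X‖ ^ 2) / (4 * s))) *
          (s ^ δ * Real.exp (-s) * |(δ - 3 / 2 - n / 2) * (2 * π * τ) / s * X k - 2 * π * τ * X k
            + Y k - X k * (inner ℝ X Y) / (2 * s) + X k * ‖X‖ ^ 2 * (2 * π * τ) / (4 * s ^ 2)|) := by
          ring
      _ ≤ s ^ (-3 / 2 : ℝ) * (s ^ (-(n : ℝ) / 2) * Real.exp (-(‖X‖ ^ 2) / (4 * s))) *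
          ((1 + (‖X‖ / √s) ^ 4) * ((|δ - 3 / 2 - n / 2| + 3) * (2 * π * |τ|) / √s + 2 * ‖Y‖)) := by
          gcongr
      _ = ((1 + (‖X‖ / √s) ^ 4) * (s ^ (-(n : ℝ) / 2) * Real.exp (-(‖X‖ ^ 2) / (4 * s)))) *
          ((|δ - 3 / 2 - n / 2| + 3) * (2 * π * |τ|) * (s ^ (-3 / 2 : ℝ) / √s) +
            2 * ‖Y‖ * s ^ (-3 / 2 : ℝ)) := by ring
      _ ≤ (129 * gaussMaj (X, t)) * ((n / 2 + 2 + 3) * (2 * π * |τ|) * t ^ (-2 : ℝ) +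
            2 * ‖Y‖ * t ^ (-3 / 2 : ℝ)) := by gcongr
      _ = 129 * (2 * π * (n / 2 + 5) * (|τ| * t ^ (-2 : ℝ)) +
            2 * (‖Y‖ * t ^ (-3 / 2 : ℝ))) * gaussMaj (X, t) := by ring
      _ ≤ 129 * (2 * π * (n / 2 + 5) * (|τ| * t ^ (-2 : ℝ)) +
            2 * π * (n / 2 + 5) * (‖Y‖ * t ^ (-3 / 2 : ℝ))) * gaussMaj (X, t) := by
          have : (0 : ℝ) ≤ n := n.cast_nonneg
          gcongr
          nlinarith
      _ = _ := by rw [besselBound]; ring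

lemma measurable_besselKernel (δ : ℝ) (k : Fin n) : Measurable (besselKernel δ k) := by
  unfold besselKernel besselProfile
  refine Measurable.ite (measurableSet_lt measurable_const measurable_snd) ?_ measurable_const
  fun_prop

lemma paraKernelBound_besselKernel {δ : ℝ} (h0 : 0 ≤ δ) (h1 : δ ≤ 1 / 2) (k : Fin n) :
    ParaKernelBound (besselKernel δ k) (besselBound n) where
  nonneg := by rw [besselBound]; positivity
  measurable := measurable_besselKernel δ k
  zero p hp := by rw [besselKernel, if_neg hp.not_gt]
  size p hp := by
    refine (size_besselKernel h0 h1 k hp).trans ?_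
    have := gaussMaj_nonneg hp
    have h129 : 129 ≤ besselBound n := by
      have : (0 : ℝ) ≤ n := n.cast_nonneg
      rw [besselBound]; nlinarith [Real.pi_gt_three]
    gcongr
  smooth p hp h := smooth_besselKernel h0 h1 k hp h

lemma integrable_besselKernel {δ : ℝ} (h0 : 0 < δ) (h1 : δ ≤ 1 / 2) (k : Fin n) :
    Integrable (besselKernel δ k) := by
  refine ⟨(measurable_besselKernel δ k).aestronglyMeasurable, ?_⟩
  have hb : ∀ p : Rn1 n, ‖besselKernel δ k p‖ₑ ≤ {p : Rn1 n | p.2 ∈ Ioi (0 : ℝ)}.indicator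
      (fun p => ENNReal.ofReal (129 * ((2 * π * p.2) ^ (δ - 1) * Real.exp (-(2 * π * p.2)))) *
        ENNReal.ofReal (gaussMaj p)) p := by
    rintro ⟨X, t⟩
    by_cases hp : 0 < t
    · rw [indicator_of_mem (by exact hp), ← ENNReal.ofReal_mul (by positivity),
        ← ofReal_norm]
      refine ENNReal.ofReal_le_ofReal ((norm_besselKernel_le h0.le h1 k hp).trans ?_)
      simp only
      have hs : 0 < 2 * π * t := by positivity
      have hX : |X k| ≤ ‖X‖ := PiLp.norm_apply_le X k
      have hQ : (‖X‖ / √(2 * π * t)) ≤ 1 + (‖X‖ / √(2 * π * t)) ^ 4 := by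
        have := sq_nonneg (‖X‖ / √(2 * π * t))
        nlinarith [sq_nonneg ((‖X‖ / √(2 * π * t)) ^ 2 - 1), sq_nonneg (‖X‖ / √(2 * π * t) - 1)]
      have hG := mul_exp_le_gaussMaj hp hQ
      rw [abs_besselProfile hs]
      generalize 2 * π * t = s at *
      have e : s ^ δ * s ^ (-3 / 2 : ℝ) = s ^ (δ - 1) / √s := by
        rw [Real.sqrt_eq_rpow, ← Real.rpow_add hs, ← Real.rpow_sub hs]; ring_nf
      calc _ ≤ s ^ δ * Real.exp (-s) * s ^ (-3 / 2 : ℝ) * ‖X‖ *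
            (s ^ (-(n : ℝ) / 2) * Real.exp (-(‖X‖ ^ 2) / (4 * s))) := by gcongr
        _ = (s ^ δ * s ^ (-3 / 2 : ℝ)) * Real.exp (-s) * ‖X‖ *
            (s ^ (-(n : ℝ) / 2) * Real.exp (-(‖X‖ ^ 2) / (4 * s))) := by ring
        _ = s ^ (δ - 1) * Real.exp (-s) * (‖X‖ / √s *
            (s ^ (-(n : ℝ) / 2) * Real.exp (-(‖X‖ ^ 2) / (4 * s)))) := by rw [e]; ring
        _ ≤ s ^ (δ - 1) * Real.exp (-s) * (129 * gaussMaj (X, t)) := by gcongr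
        _ = _ := by ring
    · simp [besselKernel, hp]
  rw [HasFiniteIntegral]
  refine (lintegral_mono hb).trans_lt ?_
  have hS : MeasurableSet {p : Rn1 n | p.2 ∈ Ioi (0 : ℝ)} := measurable_snd measurableSet_Ioi
  rw [lintegral_indicator hS, lintegral_mul_gaussMaj
    (F := fun t => ENNReal.ofReal (129 * ((2 * π * t) ^ (δ - 1) * Real.exp (-(2 * π * t)))))
    (by fun_prop) measurableSet_Ioi subset_rfl]
  refine ENNReal.mul_lt_top ENNReal.ofReal_lt_top ?_
  have hΓ : IntegrableOn (fun t : ℝ => 129 * ((2 * π * t) ^ (δ - 1) * Real.exp (-(2 * π * t))))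
      (Ioi 0) := by
    have h := Real.GammaIntegral_convergent h0
    have h' := (integrableOn_Ioi_comp_mul_left_iff _ 0 (show 0 < 2 * π by positivity)).2
      (by simpa using h)
    simp only [mul_comm (Real.exp _)] at h'
    exact h'.const_mul 129
  exact hΓ.lintegral_lt_top

end BesselKernel

section FourierKernel

open FourierTransform

variable {n : ℕ}

open VectorFourier in
lemma fourier_coord_mul_gaussian {b : ℝ} (hb : 0 < b) (k : Fin n) (w : Rn n) :
    𝓕 (fun v : Rn n => (v k : ℂ) * cexp (-b * ‖v‖ ^ 2)) w =
      -(I * π * w k / b) * ((π / b) ^ (n / 2 : ℂ) * cexp (-π ^ 2 * ‖w‖ ^ 2 / b)) := by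
  set G : Rn n → ℂ := fun v => cexp (-b * ‖v‖ ^ 2) with hG
  have hGn : ∀ v, ‖G v‖ = Real.exp (-b * ‖v‖ ^ 2) := fun v => by
    rw [hG, Complex.norm_exp]
    norm_cast
  have hGm : AEStronglyMeasurable G := by
    refine Continuous.aestronglyMeasurable ?_
    fun_prop
  have hGi : Integrable G := (integrable_norm_iff hGm).1 <| by
    simpa only [hGn] using integrable_rexp_neg_mul_sq_norm (V := Rn n) hb
  have hGi' : Integrable (fun v => ‖v‖ * ‖G v‖) := by
    have h2 := (integrable_rexp_neg_mul_sq_norm (V := Rn n) (half_pos hb)).const_mul (1 + 1 / b)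
    refine h2.mono' (by fun_prop) (.of_forall fun v => ?_)
    rw [norm_mul, norm_norm, norm_norm, hGn]
    have e : Real.exp (-b * ‖v‖ ^ 2) =
        Real.exp (-(b / 2) * ‖v‖ ^ 2) * Real.exp (-(b / 2) * ‖v‖ ^ 2) := by
      rw [← Real.exp_add]; ring_nf
    rw [e, ← mul_assoc]
    gcongr
    rw [neg_mul, Real.exp_neg, ← div_eq_mul_inv, div_le_iff₀ (Real.exp_pos _)]
    have h3 := Real.add_one_le_exp (b / 2 * ‖v‖ ^ 2)
    have h4 : (1 + 1 / b) * (b / 2 * ‖v‖ ^ 2 + 1) =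
      1 + b / 2 * ‖v‖ ^ 2 + 1 / b + ‖v‖ ^ 2 / 2 := by field_simp; ring
    have h5 : 0 < 1 / b := by positivity
    have h6 : 0 < 1 + 1 / b := by positivity
    have h7 : 0 ≤ b / 2 * ‖v‖ ^ 2 := by positivity
    nlinarith [sq_nonneg (‖v‖ - 1)]
  have h1 := hasFDerivAt_fourier hGi hGi' w
  have h2 : 𝓕 G = fun w : Rn n => (π / b) ^ (n / 2 : ℂ) * cexp (-π ^ 2 * ‖w‖ ^ 2 / b) := by
    ext w
    have := fourier_gaussian_innerProductSpace (b := (b : ℂ)) (by simpa using hb) w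
    rwa [finrank_euclideanSpace_fin] at this
  have h3 : HasDerivAt (fun θ : ℝ => 𝓕 G (w + θ • EuclideanSpace.single k (1 : ℝ)))
      (((π / b) ^ (n / 2 : ℂ) * cexp (-π ^ 2 * ‖w‖ ^ 2 / b)) * (-π ^ 2 * (2 * w k) / b)) 0 := by
    rw [h2]
    have e1 : HasDerivAt (fun θ : ℝ => w + θ • EuclideanSpace.single k (1 : ℝ))
        (EuclideanSpace.single k (1 : ℝ)) 0 := by
      simpa using ((hasDerivAt_id (0 : ℝ)).smul_const (EuclideanSpace.single k (1 : ℝ))).const_add w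
    have e2 : HasDerivAt (fun θ : ℝ => ‖w + θ • EuclideanSpace.single k (1 : ℝ)‖ ^ 2)
        (2 * w k) 0 := by
      simpa [EuclideanSpace.inner_single_right] using e1.norm_sq
    have e3 := ((e2.ofReal_comp.const_mul (-π ^ 2 : ℂ)).div_const (b : ℂ)).cexp.const_mul
      ((π / b : ℂ) ^ (n / 2 : ℂ))
    simp only [zero_smul, add_zero] at e3
    push_cast at e3
    refine e3.congr_deriv ?_
    ring
  have h4 : HasDerivAt (fun θ : ℝ => 𝓕 G (w + θ • EuclideanSpace.single k (1 : ℝ)))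
      (𝓕 (fourierSMulRight (innerSL ℝ) G) w (EuclideanSpace.single k (1 : ℝ))) 0 := by
    exact h1.hasLineDerivAt _
  have h5 := h4.unique h3
  have hInt : Integrable (fourierSMulRight (innerSL ℝ) G) := by
    refine (hGi'.const_mul (2 * π * ‖(innerSL ℝ : Rn n →L[ℝ] Rn n →L[ℝ] ℝ)‖)).mono'
      hGm.fourierSMulRight (.of_forall fun v => ?_)
    rw [← mul_assoc]
    exact norm_fourierSMulRight_le _ _ _
  have h6 : 𝓕 (fourierSMulRight (innerSL ℝ) G) w (EuclideanSpace.single k (1 : ℝ)) =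
      -(2 * π * I) * 𝓕 (fun v : Rn n => (v k : ℂ) * G v) w := by
    refine (Real.fourier_continuousLinearMap_apply hInt).trans ?_
    rw [Real.fourier_eq', Real.fourier_eq', ← integral_const_mul]
    refine integral_congr_ae (.of_forall fun v => ?_)
    have e : (innerSL ℝ v) (EuclideanSpace.single k (1 : ℝ)) = v k := by
      rw [innerSL_apply_apply, EuclideanSpace.inner_single_right]
      simp
    simp only [fourierSMulRight_apply, e, smul_eq_mul, Complex.real_smul]
    ring
  rw [h6] at h5
  have hI : (2 * π * I : ℂ) ≠ 0 := by simp [Real.pi_ne_zero]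
  have hbc : (b : ℂ) ≠ 0 := by exact_mod_cast hb.ne'
  have h7 := mul_left_cancel₀ (neg_ne_zero.2 hI) (h5.trans (b := _)
    (c := -(2 * π * I) * (-(I * π * w k / b) *
      ((π / b) ^ (n / 2 : ℂ) * cexp (-π ^ 2 * ‖w‖ ^ 2 / b)))) (by
    ring_nf
    rw [I_sq]
    ring))
  exact h7

open ProbabilityTheory in
/-- The Gamma integral `∫ s^{a-1} e^{-zs} ds = z^{-a} Γ(a)` for complex `z` with `0 < re z`. -/
lemma integral_rpow_mul_cexp_neg_mul_Ioi {a : ℝ} (ha : 0 < a) {z : ℂ} (hz : 0 < z.re) :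
    ∫ s in Ioi (0 : ℝ), ((s ^ (a - 1) : ℝ) : ℂ) * cexp (-(z * s)) =
      z ^ (-(a : ℂ)) * Complex.Gamma a := by
  set μ : Measure ℝ := (volume.restrict (Ioi 0)).withDensity fun s => ENNReal.ofReal (s ^ (a - 1))
    with hμ
  have hm : Measurable fun s : ℝ => ENNReal.ofReal (s ^ (a - 1)) := by fun_prop
  have htop : ∀ᵐ s ∂volume.restrict (Ioi (0 : ℝ)), ENNReal.ofReal (s ^ (a - 1)) < ∞ :=
    .of_forall fun _ => ENNReal.ofReal_lt_top
  have hF : ∀ z : ℂ, complexMGF (fun s => -s) μ z =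
      ∫ s in Ioi (0 : ℝ), ((s ^ (a - 1) : ℝ) : ℂ) * cexp (-(z * s)) := fun z => by
    rw [complexMGF, hμ, integral_withDensity_eq_integral_toReal_smul hm htop]
    refine setIntegral_congr_fun measurableSet_Ioi fun s hs => ?_
    have hs' : (0 : ℝ) < s := hs
    rw [ENNReal.toReal_ofReal (by positivity), Complex.real_smul]
    push_cast
    ring_nf
  have hset : Ioi (0 : ℝ) ⊆ integrableExpSet (fun s => -s) μ := fun r hr => by
    rw [integrableExpSet, Set.mem_ofPred_eq, hμ,
      integrable_withDensity_iff hm htop]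
    have h := Real.GammaIntegral_convergent ha
    have hr' : (0 : ℝ) < r := hr
    have h' := (integrableOn_Ioi_comp_mul_left_iff _ 0 hr').2 (by simpa using h)
    refine (h'.const_mul (r ^ (a - 1))⁻¹).congr ?_
    filter_upwards [ae_restrict_mem measurableSet_Ioi] with s hs
    have hs' : (0 : ℝ) < s := hs
    rw [ENNReal.toReal_ofReal (by positivity), Real.mul_rpow hr'.le hs'.le]
    have : 0 < r ^ (a - 1) := by positivity
    field_simp
  have hsub : {z : ℂ | 0 < z.re} ⊆ {z : ℂ | z.re ∈ interior (integrableExpSet (fun s => -s) μ)} :=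
    fun z hz => interior_mono hset (by rwa [interior_Ioi])
  have hopen : IsOpen {z : ℂ | 0 < z.re} := isOpen_lt continuous_const Complex.continuous_re
  have hA := (differentiableOn_complexMGF.mono hsub).analyticOnNhd hopen
  have hB : AnalyticOnNhd ℂ (fun z : ℂ => z ^ (-(a : ℂ)) * Complex.Gamma a) {z : ℂ | 0 < z.re} := by
    refine DifferentiableOn.analyticOnNhd (fun z hz => ?_) hopen
    have : z ∈ slitPlane := Or.inl hz
    exact ((differentiableAt_id.cpow_const this).mul_const _).differentiableWithinAt
  have hpre : IsPreconnected {z : ℂ | 0 < z.re} :=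
    (convex_halfSpace_re_gt 0).isPreconnected
  have h1 : (1 : ℂ) ∈ {z : ℂ | 0 < z.re} := by simp
  have hfreq : ∃ᶠ z in 𝓝[≠] (1 : ℂ), complexMGF (fun s => -s) μ z =
      z ^ (-(a : ℂ)) * Complex.Gamma a := by
    have ht : Tendsto (fun r : ℝ => (r : ℂ)) (𝓝[≠] 1) (𝓝[≠] (1 : ℂ)) := by
      refine tendsto_nhdsWithin_iff.2 ⟨?_, ?_⟩
      · exact (Complex.continuous_ofReal.tendsto' 1 1 (by simp)).mono_left nhdsWithin_le_nhds
      · filter_upwards [self_mem_nhdsWithin] with r hr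
        simpa using hr
    refine ht.frequently (Eventually.frequently ?_)
    filter_upwards [nhdsWithin_le_nhds (lt_mem_nhds (zero_lt_one (α := ℝ)))] with r hr
    rw [hF]
    have h := Complex.integral_cpow_mul_exp_neg_mul_Ioi (a := (a : ℂ)) (by simpa using ha) hr
    rw [one_div, Complex.inv_cpow _ _ (by
      rw [Complex.arg_ofReal_of_nonneg hr.le]; exact Real.pi_ne_zero.symm), ← Complex.cpow_neg] at h
    rw [← h]
    refine setIntegral_congr_fun measurableSet_Ioi fun s hs => ?_
    have hs' : (0 : ℝ) < s := hs
    rw [Complex.ofReal_cpow hs'.le]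
    push_cast
    rfl
  rw [← hF]
  exact hA.eqOn_of_preconnected_of_frequently_eq hB hpre h1 hfreq hz

/-- The spatial Fourier transform of the kernel at time `t > 0`. -/
lemma integral_cexp_mul_besselKernel {δ : ℝ} (h0 : 0 < δ) (k : Fin n) (q : Rn1 n) {t : ℝ}
    (ht : 0 < t) :
    ∫ X : Rn n, cexp (-(2 * (π : ℂ) * I) * (((∑ k, X k * q.1 k) + t * q.2 : ℝ) : ℂ)) *
        besselKernel δ k (X, t) =
      (2 * π * q.1 k / Complex.Gamma (1 / 2 + δ : ℝ)) *
        ((((2 * π * t) ^ ((1 / 2 + δ) - 1) : ℝ) : ℂ) *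
          cexp (-((1 + 4 * (π : ℂ) ^ 2 * (‖q.1‖ : ℂ) ^ 2 + I * (q.2 : ℂ)) * (2 * π * t : ℝ)))) := by
  have hs : 0 < 2 * π * t := by positivity
  set s := 2 * π * t with hst
  have hb : 0 < 1 / (4 * s) := by positivity
  have hF := fourier_coord_mul_gaussian hb k q.1
  rw [Real.fourier_eq'] at hF
  have e1 : ∀ X : Rn n, cexp (-(2 * (π : ℂ) * I) * (((∑ k, X k * q.1 k) + t * q.2 : ℝ) : ℂ)) *
      besselKernel δ k (X, t) = (besselConst n δ * (s ^ (δ - 3 / 2 - n / 2) * Real.exp (-s) : ℝ) *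
        cexp (-(s * I * q.2))) * (cexp (↑(-2 * π * inner ℝ X q.1) * I) •
          ((X k : ℂ) * cexp (-(1 / (4 * s) : ℝ) * ‖X‖ ^ 2))) := fun X => by
    rw [besselKernel, if_pos (by exact ht), besselProfile, ← hst]
    have e2 : cexp (-(2 * (π : ℂ) * I) * (((∑ k, X k * q.1 k) + t * q.2 : ℝ) : ℂ)) =
        cexp (-(s * I * q.2)) * cexp (↑(-2 * π * inner ℝ X q.1) * I) := by
      rw [← Complex.exp_add]
      congr 1
      simp only [PiLp.inner_apply, RCLike.inner_apply, conj_trivial, mul_comm (q.1 _)]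
      rw [hst]
      push_cast
      ring
    have e3 : cexp (-(1 / (4 * s) : ℝ) * ‖X‖ ^ 2) =
        ((Real.exp (-(‖X‖ ^ 2) / (4 * s)) : ℝ) : ℂ) := by
      push_cast
      congr 1
      ring
    rw [e2, e3]
    simp only [smul_eq_mul]
    push_cast
    ring
  simp_rw [e1]
  rw [integral_const_mul, hF]
  have hsc : (s : ℂ) ≠ 0 := by exact_mod_cast hs.ne'
  have hΓ : 0 < Real.Gamma (1 / 2 + δ) := Real.Gamma_pos_of_pos (by linarith)
  have e4 : ((π : ℂ) / ((1 / (4 * s) : ℝ) : ℂ)) ^ (n / 2 : ℂ) =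
      (((4 * π) ^ ((n : ℝ) / 2) * s ^ ((n : ℝ) / 2) : ℝ) : ℂ) := by
    rw [← Real.mul_rpow (by positivity) hs.le, Complex.ofReal_cpow (by positivity)]
    congr 1
    · push_cast
      field_simp
    · push_cast
      rfl
  have e5 : cexp (-((1 + 4 * (π : ℂ) ^ 2 * (‖q.1‖ : ℂ) ^ 2 + I * (q.2 : ℂ)) * s)) =
      cexp (-s) * cexp (-(s * I * q.2)) *
        cexp (-(π : ℂ) ^ 2 * ‖q.1‖ ^ 2 / ((1 / (4 * s) : ℝ) : ℂ)) := by
    rw [← Complex.exp_add, ← Complex.exp_add]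
    congr 1
    push_cast
    field_simp
    ring
  have e6 : s ^ (δ - 3 / 2 - n / 2) = s ^ (1 / 2 + δ - 1) / s / s ^ ((n : ℝ) / 2) := by
    rw [← Real.rpow_sub_one hs.ne', ← Real.rpow_sub hs]
    ring_nf
  have e7 : (4 * π) ^ (-(n : ℝ) / 2) = 1 / (4 * π) ^ ((n : ℝ) / 2) := by
    rw [neg_div, Real.rpow_neg (by positivity), one_div]
  rw [e4, e5, e6, besselConst, e7, Complex.Gamma_ofReal]
  have hp1 : (((4 * π) ^ ((n : ℝ) / 2) : ℝ) : ℂ) ≠ 0 := by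
    exact_mod_cast (Real.rpow_pos_of_pos (by positivity) _).ne'
  have hp2 : ((s ^ ((n : ℝ) / 2) : ℝ) : ℂ) ≠ 0 := by
    exact_mod_cast (Real.rpow_pos_of_pos hs _).ne'
  have hp3 : ((Real.Gamma (1 / 2 + δ) : ℝ) : ℂ) ≠ 0 := by exact_mod_cast hΓ.ne'
  simp only [Complex.ofReal_mul, Complex.ofReal_div, Complex.ofReal_one, Complex.ofReal_exp,
    Complex.ofReal_neg, Complex.ofReal_ofNat] at hp1 hp2 hp3 ⊢
  field_simp
  rw [I_sq]
  ring

/-- The Fourier transform of the kernel. -/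
lemma FT1_besselKernel {δ : ℝ} (h0 : 0 < δ) (h1 : δ ≤ 1 / 2) (k : Fin n) (q : Rn1 n) :
    FT1 (besselKernel δ k) q = (q.1 k : ℂ) *
      (1 + 4 * (π : ℂ) ^ 2 * (‖q.1‖ : ℂ) ^ 2 + I * (q.2 : ℂ)) ^ (-((1 / 2 + δ : ℝ) : ℂ)) := by
  have hInt : Integrable fun p : Rn1 n =>
      cexp (-(2 * (π : ℂ) * I) * (((∑ k, p.1 k * q.1 k) + p.2 * q.2 : ℝ) : ℂ)) *
        besselKernel δ k p := by
    refine (integrable_besselKernel h0 h1 k).bdd_mul (c := 1) ?_ (.of_forall fun p => ?_)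
    · exact Continuous.aestronglyMeasurable (by fun_prop)
    · rw [Complex.norm_exp]
      simp
  have hre : 0 < (1 + 4 * (π : ℂ) ^ 2 * (‖q.1‖ : ℂ) ^ 2 + I * (q.2 : ℂ)).re := by
    have : (1 + 4 * (π : ℂ) ^ 2 * (‖q.1‖ : ℂ) ^ 2 + I * (q.2 : ℂ)) =
      ((1 + 4 * π ^ 2 * ‖q.1‖ ^ 2 : ℝ) : ℂ) + q.2 * I := by push_cast; ring
    rw [this, Complex.add_re, Complex.ofReal_re, Complex.re_ofReal_mul]
    simp only [Complex.I_re, mul_zero, add_zero]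
    positivity
  have hΓ : Complex.Gamma ((1 / 2 + δ : ℝ) : ℂ) ≠ 0 := by
    rw [Complex.Gamma_ofReal]
    exact_mod_cast (Real.Gamma_pos_of_pos (by linarith)).ne'
  rw [FT1]
  rw [Measure.volume_eq_prod] at hInt ⊢
  rw [integral_prod_symm _ hInt]
  have hπ : (0 : ℝ) < 2 * π := by positivity
  set z := 1 + 4 * (π : ℂ) ^ 2 * (‖q.1‖ : ℂ) ^ 2 + I * (q.2 : ℂ) with hz
  calc _ = ∫ t : ℝ, (Ioi (0 : ℝ)).indicator (fun t =>
        (2 * π * q.1 k / Complex.Gamma (1 / 2 + δ : ℝ)) *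
        ((((2 * π * t) ^ ((1 / 2 + δ) - 1) : ℝ) : ℂ) * cexp (-(z * (2 * π * t : ℝ))))) t := by
        refine integral_congr_ae (.of_forall fun t => ?_)
        by_cases ht : 0 < t
        · rw [indicator_of_mem (by exact ht)]
          exact integral_cexp_mul_besselKernel h0 k q ht
        · simp [besselKernel, ht]
    _ = _ := by
        rw [integral_indicator measurableSet_Ioi, integral_const_mul,
          integral_comp_mul_left_Ioi (fun s : ℝ => (((s ^ ((1 / 2 + δ) - 1) : ℝ) : ℂ) *
            cexp (-(z * s)))) 0 hπ, mul_zero,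
          integral_rpow_mul_cexp_neg_mul_Ioi (by linarith) hre, Complex.real_smul]
        have : ((2 * π : ℝ) : ℂ) ≠ 0 := by exact_mod_cast hπ.ne'
        rw [Complex.ofReal_inv]
        generalize Complex.Gamma ((1 / 2 + δ : ℝ) : ℂ) = g at hΓ
        rw [Complex.ofReal_mul, Complex.ofReal_ofNat] at this ⊢
        field_simp

end FourierKernel

section Multiplier

open scoped SchwartzMap

variable {n : ℕ}

/-- The base `1 + 4π²|ξ|² + iτ` of the symbol. -/
def heatSym (q : Rn1 n) : ℂ := 1 + 4 * (π : ℂ) ^ 2 * (‖q.1‖ : ℂ) ^ 2 + I * (q.2 : ℂ)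

lemma heatSym_re (q : Rn1 n) : (heatSym q).re = 1 + 4 * π ^ 2 * ‖q.1‖ ^ 2 := by
  have : heatSym q = ((1 + 4 * π ^ 2 * ‖q.1‖ ^ 2 : ℝ) : ℂ) + q.2 * I := by
    rw [heatSym]; push_cast; ring
  rw [this, Complex.add_re, Complex.ofReal_re, Complex.re_ofReal_mul]
  simp

lemma heatSym_mem_slitPlane (q : Rn1 n) : heatSym q ∈ slitPlane := by
  refine Or.inl ?_
  rw [heatSym_re]
  positivity

lemma continuous_heatSym : Continuous (heatSym (n := n)) := by
  unfold heatSym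
  fun_prop

lemma norm_mul_heatSym_cpow_le {a : ℝ} (ha : 1 / 2 ≤ a) (k : Fin n) (q : Rn1 n) :
    ‖(q.1 k : ℂ) * heatSym q ^ (-(a : ℂ))‖ ≤ 1 := by
  have h1 : 1 + 4 * π ^ 2 * ‖q.1‖ ^ 2 ≤ ‖heatSym q‖ :=
    (heatSym_re q).symm.le.trans (Complex.re_le_norm _)
  have hz1 : 1 ≤ ‖heatSym q‖ := by
    have : 0 ≤ 4 * π ^ 2 * ‖q.1‖ ^ 2 := by positivity
    linarith
  have hk : |q.1 k| ≤ ‖q.1‖ := PiLp.norm_apply_le q.1 k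
  have hq : ‖q.1‖ ≤ √‖heatSym q‖ := by
    refine Real.le_sqrt_of_sq_le (le_trans ?_ h1)
    have : 1 ≤ 4 * π ^ 2 := by nlinarith [Real.pi_gt_three]
    nlinarith [sq_nonneg ‖q.1‖]
  rw [norm_mul, Complex.norm_real, Real.norm_eq_abs, ← Complex.ofReal_neg, Complex.norm_cpow_real]
  have h2 : ‖heatSym q‖ ^ (-a) ≤ (√‖heatSym q‖)⁻¹ := by
    rw [Real.sqrt_eq_rpow, ← Real.rpow_neg (norm_nonneg _)]
    exact Real.rpow_le_rpow_of_exponent_le hz1 (by linarith)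
  have h3 : 0 < √‖heatSym q‖ := Real.sqrt_pos.2 (by linarith)
  calc |q.1 k| * ‖heatSym q‖ ^ (-a) ≤ √‖heatSym q‖ * (√‖heatSym q‖)⁻¹ := by
        gcongr
        exact hk.trans hq
    _ = 1 := mul_inv_cancel₀ h3.ne'

lemma norm_FT1_besselKernel_le {δ : ℝ} (h0 : 0 < δ) (h1 : δ ≤ 1 / 2) (k : Fin n) (q : Rn1 n) :
    ‖FT1 (besselKernel δ k) q‖ ≤ 1 := by
  rw [FT1_besselKernel h0 h1]
  exact norm_mul_heatSym_cpow_le (by linarith) k q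

lemma czKernel_besselKernel {δ : ℝ} (h0 : 0 < δ) (h1 : δ ≤ 1 / 2) (k : Fin n) :
    CZKernel (paraSystem n) (ParaKernelBound.hormanderConst n (besselBound n))
      (besselKernel δ k) where
  measurable := measurable_besselKernel δ k
  integrable := integrable_besselKernel h0 h1 k
  hormander j x _ hy := (paraKernelBound_besselKernel h0.le h1 k).hormander j x hy
  lintegral_cv_sq _ hg hC := hC.elim fun _ hC => lintegral_cv_sq_le_of_norm_FT1_le
    (integrable_besselKernel h0 h1 k) (norm_FT1_besselKernel_le h0 h1 k) hg hC

/-- The constant in the `Lᵖ` bound for the regularised multipliers. -/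
def multiplierConst (n : ℕ) (p : ℝ) : ℝ≥0 :=
  czConst' p (paraDoubling n) (ParaKernelBound.hormanderConst n (besselBound n)) ^ p⁻¹

lemma eLpNorm_cv_besselKernel_le {p : ℝ} (hp : 1 < p) {δ : ℝ} (h0 : 0 < δ) (h1 : δ ≤ 1 / 2)
    (k : Fin n) (f : 𝓢(Rn1 n, ℂ)) :
    eLpNorm (cv (besselKernel δ k) f) (ENNReal.ofReal p) volume ≤
      multiplierConst n p * eLpNorm f (ENNReal.ofReal p) volume := by
  have hp0 : 0 < p := by linarith
  have h := (czKernel_besselKernel h0 h1 k).lintegral_cv_rpow_le hp f.continuous f.integrable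
    (fun x => f.norm_le_seminorm ℂ x)
  rw [eLpNorm_eq_lintegral_rpow_enorm_toReal (by simpa using hp0) ENNReal.ofReal_ne_top,
    eLpNorm_eq_lintegral_rpow_enorm_toReal (by simpa using hp0) ENNReal.ofReal_ne_top,
    ENNReal.toReal_ofReal hp0.le, one_div, multiplierConst,
    ENNReal.coe_rpow_of_nonneg _ (by positivity), ← ENNReal.mul_rpow_of_nonneg _ _ (by positivity)]
  gcongr

lemma tendsto_MOp_heatSym (k : Fin n) (f : 𝓢(Rn1 n, ℂ)) {δ : ℕ → ℝ} (h0 : ∀ j, 0 < δ j)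
    (hδ : Tendsto δ atTop (𝓝 0)) (x : Rn1 n) :
    Tendsto (fun j => MOp (fun q => (q.1 k : ℂ) * heatSym q ^ (-((1 / 2 + δ j : ℝ) : ℂ))) f x) atTop
      (𝓝 (MOp (fun q => (q.1 k : ℂ) * heatSym q ^ (-(1 : ℂ) / 2)) f x)) := by
  refine tendsto_integral_of_dominated_convergence (fun q => ‖FT1 f q‖) (fun j => ?_)
    (integrable_FT1_schwartz f).norm (fun j => .of_forall fun q => ?_) (.of_forall fun q => ?_)
  · refine Continuous.aestronglyMeasurable ?_
    have h1 : Continuous fun q : Rn1 n => heatSym q ^ (-((1 / 2 + δ j : ℝ) : ℂ)) :=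
      continuous_heatSym.cpow continuous_const heatSym_mem_slitPlane
    have h2 := continuous_FT1_schwartz f
    fun_prop
  · rw [norm_mul, Complex.norm_exp, norm_mul]
    have h1 := norm_mul_heatSym_cpow_le (a := 1 / 2 + δ j) (by linarith [h0 j]) k q
    have h2 : (2 * (π : ℂ) * I * (((∑ k, q.1 k * x.1 k) + q.2 * x.2 : ℝ) : ℂ)).re = 0 := by simp
    rw [h2, Real.exp_zero, one_mul]
    exact mul_le_of_le_one_left (norm_nonneg _) h1
  · have hexp : Tendsto (fun j => -((1 / 2 + δ j : ℝ) : ℂ)) atTop (𝓝 (-(1 : ℂ) / 2)) := by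
      have h1 := ((Complex.continuous_ofReal.tendsto 0).comp hδ).const_add (1 / 2 : ℂ)
      have h2 := h1.neg
      simp only [Complex.ofReal_zero, add_zero] at h2
      convert h2 using 2 with j
      · simp
      · ring
    have hz : heatSym q ≠ 0 := slitPlane_ne_zero (heatSym_mem_slitPlane q)
    exact (((hexp.const_cpow (Or.inl hz)).const_mul _).mul_const _).const_mul _

lemma pNorm_MOp_heatSym_le {p : ℝ} (hp : 1 < p) (k : Fin n) (f : 𝓢(Rn1 n, ℂ)) :
    pNorm p (MOp (fun q => (q.1 k : ℂ) * heatSym q ^ (-(1 : ℂ) / 2)) f) ≤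
      multiplierConst n p * pNorm p f := by
  set δ : ℕ → ℝ := fun j => 1 / 2 * (1 / ((j : ℝ) + 1)) with hδ
  have h0 : ∀ j, 0 < δ j := fun j => by positivity
  have h1 : ∀ j, δ j ≤ 1 / 2 := fun j => by
    have : 1 / ((j : ℝ) + 1) ≤ 1 := by
      rw [div_le_one (by positivity)]; linarith [(j.cast_nonneg : (0 : ℝ) ≤ j)]
    simp only [hδ]
    linarith
  have hlim : Tendsto δ atTop (𝓝 0) := by
    simpa [hδ] using tendsto_one_div_add_atTop_nhds_zero_nat.const_mul (1 / 2 : ℝ)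
  have hM : ∀ j, MOp (fun q => (q.1 k : ℂ) * heatSym q ^ (-((1 / 2 + δ j : ℝ) : ℂ))) f =
      cv (besselKernel (δ j) k) f := fun j => by
    rw [← MOp_FT1_eq_cv (integrable_besselKernel (h0 j) (h1 j) k)]
    congr 1
    ext q
    rw [FT1_besselKernel (h0 j) (h1 j), heatSym]
  refine eLpNorm_le_of_tendsto (fun j => ?_) (tendsto_MOp_heatSym k f h0 hlim) (fun j => ?_)
    tendsto_const_nhds
  · rw [hM]
    exact aestronglyMeasurable_cv (measurable_besselKernel _ k) f.continuous.aestronglyMeasurable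
  · rw [hM]
    exact eLpNorm_cv_besselKernel_le hp (h0 j) (h1 j) k f

end Multiplier

end CalderonZygmund

/-- The symbols `μ_{1k}(ξ,τ) = ξ_k (1 + 4π²|ξ|² + iτ)^{−1/2}` are
`Lᵖ(ℝ^{n+1})`-multipliers, `1 < p < ∞`. -/
theorem stmt2 (n : ℕ) (hn : 1 ≤ n) (p : ℝ) (hp : 1 < p) :
    ∃ M : ℝ, 0 < M ∧
      ∀ k : Fin n, ∀ f : SchwartzMap (Rn1 n) ℂ,
        pNorm p (MOp (fun q => (q.1 k : ℂ) *
            (1 + 4 * (π : ℂ) ^ 2 * (‖q.1‖ : ℂ) ^ 2 + Complex.I * (q.2 : ℂ)) ^ (-(1 : ℂ) / 2)) ⇑f)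
          ≤ ENNReal.ofReal M * pNorm p ⇑f := by
  refine ⟨multiplierConst n p + 1, by positivity, fun k f =>
    (pNorm_MOp_heatSym_le hp k f).trans (mul_le_mul_left ?_ _)⟩
  rw [← ENNReal.ofReal_coe_nnreal]
  exact ENNReal.ofReal_le_ofReal (by linarith)
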